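/- arXiv:1502.03791 — 2 statements merged into one kernel-verified Lean document; each statement's English description precedes it below -/
import Mathlib

section
/- (Johnson–Odell) Let X be a separable Banach space and suppose there is a constant K < ∞ such that every Banach space isomorphic to X is K-elastic. Then X is finite-dimensional. -/
/-- An isomorphic embedding of Banach spaces: a bounded linear map which is
bounded below (hence an isomorphism onto its range). -/
def IsIsomorphicEmbedding {Y X : Type*} [NormedAddCommGroup Y] [NormedSpace ℝ Y]
    [NormedAddCommGroup X] [NormedSpace ℝ X] (T : Y →L[ℝ] X) : Prop :=
  ∃ c : ℝ, 0 < c ∧ ∀ y : Y, c * ‖y‖ ≤ ‖T y‖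

/-- `Y` embeds isomorphically into `X`. -/
def EmbedsInto (Y X : Type*) [NormedAddCommGroup Y] [NormedSpace ℝ Y]
    [NormedAddCommGroup X] [NormedSpace ℝ X] : Prop :=
  ∃ T : Y →L[ℝ] X, IsIsomorphicEmbedding T

/-- `X` is `K`-elastic: whenever a Banach space `Y` embeds isomorphically into `X`,
there is an embedding `T : Y → X` with `‖y‖ ≤ ‖T y‖ ≤ K * ‖y‖` for all `y`. -/
def IsKElastic (X : Type*) [NormedAddCommGroup X] [NormedSpace ℝ X] (K : ℝ) : Prop :=
  ∀ (Y : Type) [NormedAddCommGroup Y] [NormedSpace ℝ Y] [CompleteSpace Y],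
    EmbedsInto Y X → ∃ T : Y →L[ℝ] X, ∀ y : Y, ‖y‖ ≤ ‖T y‖ ∧ ‖T y‖ ≤ K * ‖y‖


namespace JO

section Basics
variable {X : Type} [NormedAddCommGroup X] [NormedSpace ℝ X]

/-- Oscillation of `f` relative to the base cell `o`. -/
noncomputable def osc {ι : Type} [Fintype ι] (o : ι) (f : ι → ℝ) : ℝ := ‖fun c => f c - f o‖

lemma osc_nonneg {ι : Type} [Fintype ι] (o : ι) (f : ι → ℝ) : 0 ≤ osc o f := norm_nonneg _

lemma le_osc {ι : Type} [Fintype ι] (o : ι) (f : ι → ℝ) (c : ι) : |f c - f o| ≤ osc o f :=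
  norm_le_pi_norm (fun c => f c - f o) c

lemma osc_le {ι : Type} [Fintype ι] {o : ι} {f : ι → ℝ} {C : ℝ} (hC : 0 ≤ C)
    (h : ∀ c, |f c - f o| ≤ C) : osc o f ≤ C :=
  (pi_norm_le_iff_of_nonneg hC).2 h

lemma abs_sub_le_osc {ι : Type} [Fintype ι] (o : ι) (f : ι → ℝ) (c d : ι) :
    |f c - f d| ≤ 2 * osc o f := by
  have h1 := le_osc o f c
  have h2 := le_osc o f d
  rw [abs_le] at *
  constructor <;> linarith [h1.1, h1.2, h2.1, h2.2]

lemma osc_comp_le {ι κ : Type} [Fintype ι] [Fintype κ] (σ : ι → κ) (o : ι) (f : κ → ℝ) :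
    osc o (fun i => f (σ i)) ≤ osc (σ o) f :=
  osc_le (osc_nonneg _ _) fun c => le_osc (σ o) f (σ c)

lemma osc_comp {ι κ : Type} [Fintype ι] [Fintype κ] (σ : ι → κ) (s : κ → ι)
    (hs : ∀ c, σ (s c) = c) (o : ι) (f : κ → ℝ) :
    osc o (fun i => f (σ i)) = osc (σ o) f := by
  apply le_antisymm (osc_comp_le σ o f)
  refine osc_le (osc_nonneg _ _) fun c => ?_
  have := le_osc o (fun i => f (σ i)) (s c)
  simpa [hs] using this

/-- Extension of a position by new cells `N`, carved out of old cells via `ν`. -/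
noncomputable def extn {ι N : Type} [Fintype N] (T : (ι → ℝ) →ₗ[ℝ] X) (ν : N → ι) (z : N → X) :
    ((ι ⊕ N) → ℝ) →ₗ[ℝ] X :=
  T ∘ₗ LinearMap.funLeft ℝ ℝ Sum.inl +
    ∑ n, ((LinearMap.proj (R := ℝ) (φ := fun _ : ι ⊕ N => ℝ) (Sum.inr n)) -
      (LinearMap.proj (R := ℝ) (φ := fun _ : ι ⊕ N => ℝ) (Sum.inl (ν n)))).smulRight (z n)

lemma extn_apply {ι N : Type} [Fintype N] (T : (ι → ℝ) →ₗ[ℝ] X) (ν : N → ι) (z : N → X)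
    (f : (ι ⊕ N) → ℝ) :
    extn T ν z f = T (fun i => f (Sum.inl i)) +
      ∑ n, (f (Sum.inr n) - f (Sum.inl (ν n))) • z n := by
  simp [extn, LinearMap.sum_apply]
  rfl

/-- merging cells -/
noncomputable def mrg {ι κ : Type} (T : (ι → ℝ) →ₗ[ℝ] X) (σ : ι → κ) : (κ → ℝ) →ₗ[ℝ] X :=
  T ∘ₗ LinearMap.funLeft ℝ ℝ σ

lemma mrg_apply {ι κ : Type} (T : (ι → ℝ) →ₗ[ℝ] X) (σ : ι → κ) (f : κ → ℝ) :
    mrg T σ f = T (fun i => f (σ i)) := rfl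

lemma extn_mrg {ι κ N : Type} [Fintype N] (T : (ι → ℝ) →ₗ[ℝ] X) (σ : ι → κ) (s : κ → ι)
    (hs : ∀ c, σ (s c) = c) (ν : N → κ) (z : N → X) :
    extn (mrg T σ) ν z = mrg (extn T (fun n => s (ν n)) z) (Sum.map σ id) := by
  refine LinearMap.ext fun f => ?_
  simp [extn_apply, mrg_apply, hs]

/-- Plain goodness of rank `γ`. -/
def Good (S : AddSubgroup X) (a b : ℝ) (γ : Ordinal.{0}) (ι : Type) [Fintype ι] (o : ι)
    (T : (ι → ℝ) →ₗ[ℝ] X) : Prop :=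
  (∀ f, a * osc o f ≤ ‖T f‖ ∧ ‖T f‖ ≤ b * osc o f) ∧
  (∀ f : ι → ℤ, T (fun c => (f c : ℝ)) ∈ S) ∧
  ∀ γ', γ' < γ → ∀ (k : ℕ) (ν : Fin k → ι), ∃ z : Fin k → X,
    Good S a b γ' (ι ⊕ Fin k) (Sum.inl o) (extn T ν z)
termination_by γ

lemma good_iff (S : AddSubgroup X) (a b : ℝ) (γ : Ordinal.{0}) (ι : Type) [Fintype ι] (o : ι)
    (T : (ι → ℝ) →ₗ[ℝ] X) : Good S a b γ ι o T ↔
  (∀ f, a * osc o f ≤ ‖T f‖ ∧ ‖T f‖ ≤ b * osc o f) ∧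
  (∀ f : ι → ℤ, T (fun c => (f c : ℝ)) ∈ S) ∧
  ∀ γ', γ' < γ → ∀ (k : ℕ) (ν : Fin k → ι), ∃ z : Fin k → X,
    Good S a b γ' (ι ⊕ Fin k) (Sum.inl o) (extn T ν z) := by
  rw [Good]

lemma Good.mono {S : AddSubgroup X} {a b : ℝ} {γ γ₁ : Ordinal.{0}} {ι : Type} [Fintype ι] {o : ι}
    {T : (ι → ℝ) →ₗ[ℝ] X} (h : Good S a b γ ι o T) (hγ : γ₁ ≤ γ) : Good S a b γ₁ ι o T := by
  rw [good_iff] at h ⊢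
  exact ⟨h.1, h.2.1, fun γ' h' => h.2.2 γ' (h'.trans_le hγ)⟩

lemma Good.merge {S : AddSubgroup X} {a b : ℝ} {γ : Ordinal.{0}} : ∀ {ι κ : Type} [Fintype ι]
    [Fintype κ] {o : ι} {T : (ι → ℝ) →ₗ[ℝ] X} (_ : Good S a b γ ι o T) (σ : ι → κ) (s : κ → ι)
    (_ : ∀ c, σ (s c) = c), Good S a b γ κ (σ o) (mrg T σ) := by
  induction γ using WellFoundedLT.induction with
  | ind γ ih =>
    intro ι κ _ _ o T h σ s hs
    rw [good_iff] at h ⊢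
    refine ⟨fun f => ?_, fun f => ?_, fun γ' hγ k ν => ?_⟩
    · rw [mrg_apply, ← osc_comp σ s hs o f]
      exact h.1 _
    · exact h.2.1 (fun i => f (σ i))
    · obtain ⟨z, hz⟩ := h.2.2 γ' hγ k (fun n => s (ν n))
      refine ⟨z, ?_⟩
      rw [extn_mrg T σ s hs]
      exact ih γ' hγ hz (Sum.map σ id) (Sum.map s id) (by rintro (c | c) <;> simp [hs])

lemma Good.request {S : AddSubgroup X} {a b : ℝ} {γ : Ordinal.{0}} {ι : Type} [Fintype ι]
    {o : ι} {T : (ι → ℝ) →ₗ[ℝ] X} (h : Good S a b γ ι o T) {γ' : Ordinal.{0}} (hγ : γ' < γ)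
    {N : Type} [Fintype N] (ν : N → ι) :
    ∃ z : N → X, Good S a b γ' (ι ⊕ N) (Sum.inl o) (extn T ν z) := by
  let e := Fintype.equivFin N
  rw [good_iff] at h
  obtain ⟨z, hz⟩ := h.2.2 γ' hγ _ (fun n => ν (e.symm n))
  refine ⟨fun n => z (e n), ?_⟩
  have := hz.merge (Sum.map id e.symm) (Sum.map id e) (by rintro (c | c) <;> simp)
  have e2 : extn T ν (fun n => z (e n)) =
      mrg (extn T (fun n => ν (e.symm n)) z) (Sum.map id e.symm) := by
    refine LinearMap.ext fun f => ?_
    simp only [extn_apply, mrg_apply]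
    congr 1
    refine Fintype.sum_equiv e _ _ fun n => ?_
    simp
  rw [e2]
  exact this

open Classical in
/-- the collapse map associated with forgetting some of the new cells -/
noncomputable def collapse {ι N N' : Type} (ν : N → ι) (j : N' → N) : ι ⊕ N → ι ⊕ N'
  | Sum.inl a => Sum.inl a
  | Sum.inr n => if h : ∃ n', j n' = n then Sum.inr h.choose else Sum.inl (ν n)

lemma collapse_inr {ι N N' : Type} (ν : N → ι) (j : N' → N) (hj : Function.Injective j) (n : N') :
    collapse ν j (Sum.inr (j n)) = Sum.inr n := by
  have h : ∃ n', j n' = j n := ⟨n, rfl⟩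
  simp only [collapse, dif_pos h]
  exact congrArg _ (hj h.choose_spec)

lemma collapse_inr_not {ι N N' : Type} (ν : N → ι) (j : N' → N) (n : N) (h : ¬ ∃ n', j n' = n) :
    collapse ν j (Sum.inr n) = Sum.inl (ν n) := by
  simp only [collapse, dif_neg h]

lemma mrg_collapse {ι N N' : Type} [Fintype N] [Fintype N'] (T : (ι → ℝ) →ₗ[ℝ] X) (ν : N → ι)
    (j : N' → N) (hj : Function.Injective j) (z : N → X) :
    mrg (extn T ν z) (collapse ν j) = extn T (fun n => ν (j n)) (fun n => z (j n)) := by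
  refine LinearMap.ext fun f => ?_
  simp only [extn_apply, mrg_apply]
  congr 1
  symm
  refine Fintype.sum_of_injective j hj _ _ ?_ ?_
  · intro n hn
    rw [collapse_inr_not ν j n (by simpa using hn)]
    simp [collapse]
  · intro n
    rw [collapse_inr ν j hj]
    simp [collapse]

lemma Good.forget {S : AddSubgroup X} {a b : ℝ} {γ : Ordinal.{0}} {ι N N' : Type} [Fintype ι]
    [Fintype N] [Fintype N'] {o : ι} {T : (ι → ℝ) →ₗ[ℝ] X} {ν : N → ι} {z : N → X}
    (h : Good S a b γ (ι ⊕ N) (Sum.inl o) (extn T ν z)) (j : N' → N) (hj : Function.Injective j) :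
    Good S a b γ (ι ⊕ N') (Sum.inl o) (extn T (fun n => ν (j n)) (fun n => z (j n))) := by
  rw [← mrg_collapse T ν j hj z]
  exact h.merge (collapse ν j) (Sum.map id j) (by
    rintro (c | c)
    · rfl
    · exact collapse_inr ν j hj c)

/-- the sum of `|φ (z n)|` is bounded for the new cells -/
lemma sum_abs_le {b : ℝ} {ι N : Type} [Fintype ι] [Fintype N] {o : ι} (hb : 0 ≤ b)
    {T : (ι → ℝ) →ₗ[ℝ] X} {ν : N → ι} {z : N → X}
    (h : ∀ f, ‖extn T ν z f‖ ≤ b * osc (Sum.inl o) f) (φ : X →L[ℝ] ℝ) :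
    ∑ n, |φ (z n)| ≤ ‖φ‖ * b := by
  set f : ι ⊕ N → ℝ := Sum.elim (fun _ => 0) (fun n => SignType.sign (φ (z n))) with hf
  have h1 : φ (extn T ν z f) = ∑ n, |φ (z n)| := by
    rw [extn_apply]
    have : (fun i => f (Sum.inl i)) = 0 := by ext i; simp [hf]
    rw [this]
    simp [hf, map_sum]
  have h2 : osc (Sum.inl o) f ≤ 1 := by
    refine osc_le zero_le_one ?_
    rintro (c | c)
    · simp [hf]
    · simp only [hf, Sum.elim_inr, Sum.elim_inl, sub_zero]
      rcases lt_trichotomy (φ (z c)) 0 with h | h | h <;> simp [h]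
  rw [← h1]
  calc φ (extn T ν z f) ≤ ‖φ (extn T ν z f)‖ := le_abs_self _
    _ ≤ ‖φ‖ * ‖extn T ν z f‖ := φ.le_opNorm _
    _ ≤ ‖φ‖ * (b * 1) := by
        gcongr
        exact (h f).trans (by gcongr)
    _ = _ := by ring

lemma Good.small {S : AddSubgroup X} {a b : ℝ} (hb : 0 ≤ b) {γ : Ordinal.{0}} {ι : Type} [Fintype ι]
    {o : ι} {T : (ι → ℝ) →ₗ[ℝ] X} (h : Good S a b γ ι o T) {γ' : Ordinal.{0}} (hγ : γ' < γ)
    {N : Type} [Fintype N] (ν : N → ι) {Λ : Type} [Fintype Λ] (B : Λ → X →L[ℝ] ℝ) {ε : ℝ}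
    (hε : 0 < ε) :
    ∃ z : N → X, Good S a b γ' (ι ⊕ N) (Sum.inl o) (extn T ν z) ∧ ∀ n l, |B l (z n)| ≤ ε := by
  obtain ⟨K, hK⟩ := exists_nat_gt ((∑ l, ‖B l‖ * b) / ε)
  obtain ⟨z, hz⟩ := h.request hγ (N := N × Fin K) (fun p => ν p.1)
  have hup : ∀ f, ‖extn T (fun p : N × Fin K => ν p.1) z f‖ ≤ b * osc (Sum.inl o) f := by
    rw [good_iff] at hz
    exact fun f => (hz.1 f).2
  have key : ∀ n, ∃ i : Fin K, ∀ l, |B l (z (n, i))| ≤ ε := by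
    intro n
    by_contra hcon
    push Not at hcon
    have h1 : ∑ l, ∑ p, |B l (z p)| ≤ ∑ l, ‖B l‖ * b :=
      Finset.sum_le_sum fun l _ => sum_abs_le hb hup (B l)
    have h2 : (K : ℝ) * ε ≤ ∑ i : Fin K, ∑ l, |B l (z (n, i))| := by
      have : ∑ i : Fin K, ε ≤ ∑ i : Fin K, ∑ l, |B l (z (n, i))| := by
        refine Finset.sum_le_sum fun i _ => ?_
        obtain ⟨l, hl⟩ := hcon i
        exact hl.le.trans (Finset.single_le_sum (f := fun l => |B l (z (n, i))|)
          (fun _ _ => abs_nonneg _) (Finset.mem_univ l))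
      simpa using this
    have h3 : ∑ i : Fin K, ∑ l, |B l (z (n, i))| ≤ ∑ l, ∑ p, |B l (z p)| := by
      rw [Finset.sum_comm]
      refine Finset.sum_le_sum fun l _ => ?_
      rw [Fintype.sum_prod_type]
      exact Finset.single_le_sum (f := fun n => ∑ i : Fin K, |B l (z (n, i))|)
        (fun _ _ => Finset.sum_nonneg fun _ _ => abs_nonneg _) (Finset.mem_univ n)
    rw [div_lt_iff₀ hε] at hK
    linarith
  choose i hi using key
  refine ⟨fun n => z (n, i n), ?_, fun n l => hi n l⟩
  exact hz.forget (fun n => (n, i n)) (fun n m hnm => (Prod.ext_iff.1 hnm).1)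

end Basics
end JO


namespace JO
section Enriched
variable {X : Type} [NormedAddCommGroup X] [NormedSpace ℝ X]

/-- Enriched goodness: positions carrying biorthogonal functionals. -/
def EE (M b : ℝ) (γ : Ordinal.{0}) (ι : Type) [Fintype ι] (o : ι)
    (T : (ι → ℝ) →ₗ[ℝ] X) (F : ι → X →L[ℝ] ℝ) : Prop :=
  (∀ c f, F c (T f) = f c - f o) ∧ (∀ c, ‖F c‖ ≤ M) ∧ (∀ f, ‖T f‖ ≤ b * osc o f) ∧
  ∀ γ', γ' < γ → ∀ (k : ℕ) (ν : Fin k → ι) (A : Finset X) (B : Finset (X →L[ℝ] ℝ)) (ε : ℝ), 0 < ε →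
    ∃ (z : Fin k → X) (F' : ι ⊕ Fin k → X →L[ℝ] ℝ),
      EE M b γ' (ι ⊕ Fin k) (Sum.inl o) (extn T ν z) F' ∧
      (∀ c, ∀ x ∈ A, |F' c x - F (Sum.elim id ν c) x| ≤ ε) ∧ ∀ n, ∀ φ ∈ B, |φ (z n)| ≤ ε
termination_by γ

lemma ee_iff (M b : ℝ) (γ : Ordinal.{0}) (ι : Type) [Fintype ι] (o : ι)
    (T : (ι → ℝ) →ₗ[ℝ] X) (F : ι → X →L[ℝ] ℝ) : EE M b γ ι o T F ↔
  (∀ c f, F c (T f) = f c - f o) ∧ (∀ c, ‖F c‖ ≤ M) ∧ (∀ f, ‖T f‖ ≤ b * osc o f) ∧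
  ∀ γ', γ' < γ → ∀ (k : ℕ) (ν : Fin k → ι) (A : Finset X) (B : Finset (X →L[ℝ] ℝ)) (ε : ℝ), 0 < ε →
    ∃ (z : Fin k → X) (F' : ι ⊕ Fin k → X →L[ℝ] ℝ),
      EE M b γ' (ι ⊕ Fin k) (Sum.inl o) (extn T ν z) F' ∧
      (∀ c, ∀ x ∈ A, |F' c x - F (Sum.elim id ν c) x| ≤ ε) ∧ ∀ n, ∀ φ ∈ B, |φ (z n)| ≤ ε := by
  rw [EE]

variable {M b : ℝ}

lemma EE.mono {γ γ₁ : Ordinal.{0}} {ι : Type} [Fintype ι] {o : ι} {T : (ι → ℝ) →ₗ[ℝ] X}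
    {F : ι → X →L[ℝ] ℝ} (h : EE M b γ ι o T F) (hγ : γ₁ ≤ γ) : EE M b γ₁ ι o T F := by
  rw [ee_iff] at h ⊢
  exact ⟨h.1, h.2.1, h.2.2.1, fun γ' h' => h.2.2.2 γ' (h'.trans_le hγ)⟩

lemma EE.merge {γ : Ordinal.{0}} : ∀ {ι κ : Type} [Fintype ι] [Fintype κ] {o : ι}
    {T : (ι → ℝ) →ₗ[ℝ] X} {F : ι → X →L[ℝ] ℝ} (_ : EE M b γ ι o T F) (σ : ι → κ) (s : κ → ι)
    (_ : ∀ c, σ (s c) = c), EE M b γ κ (σ o) (mrg T σ) (fun c => F (s c)) := by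
  induction γ using WellFoundedLT.induction with
  | ind γ ih =>
    intro ι κ _ _ o T F h σ s hs
    rw [ee_iff] at h ⊢
    refine ⟨fun c f => ?_, fun c => h.2.1 _, fun f => ?_, fun γ' hγ k ν A B ε hε => ?_⟩
    · rw [mrg_apply, h.1, hs]
    · rw [mrg_apply, ← osc_comp σ s hs o f]
      exact h.2.2.1 _
    · obtain ⟨z, F', hz, hA, hB⟩ := h.2.2.2 γ' hγ k (fun n => s (ν n)) A B ε hε
      refine ⟨z, fun c => F' (Sum.map s id c), ?_, ?_, hB⟩
      · rw [extn_mrg T σ s hs]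
        exact ih γ' hγ hz (Sum.map σ id) (Sum.map s id) (by rintro (c | c) <;> simp [hs])
      · rintro (c | c) x hx
        · exact hA (Sum.inl (s c)) x hx
        · exact hA (Sum.inr c) x hx

lemma pigeon (A : Finset X) (M ε : ℝ) (hε : 0 < ε) (m : ℕ) : ∃ K : ℕ,
    ∀ v : Fin K → X →L[ℝ] ℝ, (∀ i, ‖v i‖ ≤ M) →
      ∃ s : Fin m → Fin K, Function.Injective s ∧ ∀ i j, ∀ x ∈ A, |v (s i) x - v (s j) x| ≤ ε := by
  classical
  let R : ℝ := |M| * ∑ x ∈ A, ‖x‖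
  have htb : TotallyBounded (Metric.closedBall (0 : A → ℝ) R) :=
    (isCompact_closedBall _ _).totallyBounded
  obtain ⟨t, ht, hcov⟩ := Metric.totallyBounded_iff.1 htb (ε / 2) (by positivity)
  lift t to Finset (A → ℝ) using ht
  refine ⟨t.card * m + 1, fun v hv => ?_⟩
  have hmem : ∀ i, ∃ y ∈ t, dist (fun x : A => v i x) y < ε / 2 := by
    intro i
    have : (fun x : A => v i x) ∈ Metric.closedBall (0 : A → ℝ) R := by
      rw [mem_closedBall_zero_iff, pi_norm_le_iff_of_nonneg (by positivity)]
      intro x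
      calc ‖v i x‖ ≤ ‖v i‖ * ‖(x : X)‖ := (v i).le_opNorm _
        _ ≤ |M| * ∑ x ∈ A, ‖x‖ := by
          gcongr
          · exact (hv i).trans (le_abs_self _)
          · exact Finset.single_le_sum (f := fun x : X => ‖x‖) (fun _ _ => norm_nonneg _) x.2
    have := hcov this
    simpa using this
  choose g hg hd using hmem
  obtain ⟨y, hy, hcard⟩ := Finset.exists_lt_card_fiber_of_mul_lt_card_of_maps_to
    (s := Finset.univ) (t := t) (f := g) (n := m) (fun i _ => hg i) (by simp)
  obtain ⟨u, hu, hum⟩ := Finset.exists_subset_card_eq hcard.le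
  refine ⟨fun i => u.orderEmbOfFin hum i, (u.orderEmbOfFin hum).injective, fun i j x hx => ?_⟩
  have hi := (Finset.mem_filter.1 (hu (u.orderEmbOfFin_mem hum i))).2
  have hj := (Finset.mem_filter.1 (hu (u.orderEmbOfFin_mem hum j))).2
  have d1 := hd (u.orderEmbOfFin hum i)
  have d2 := hd (u.orderEmbOfFin hum j)
  rw [hi] at d1
  rw [hj] at d2
  have e1 := (dist_le_pi_dist (fun x : A => v (u.orderEmbOfFin hum i) x) y ⟨x, hx⟩).trans d1.le
  have e2 := (dist_le_pi_dist (fun x : A => v (u.orderEmbOfFin hum j) x) y ⟨x, hx⟩).trans d2.le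
  rw [Real.dist_eq, abs_le] at e1 e2
  rw [abs_le]
  constructor <;> linarith [e1.1, e1.2, e2.1, e2.2]

lemma extn_elim {ι N : Type} [Fintype N] (T : (ι → ℝ) →ₗ[ℝ] X) (ν : N → ι) (z : N → X)
    (f : ι → ℝ) : extn T ν z (fun c => f (Sum.elim id ν c)) = T f := by
  simp [extn_apply]

/-- One uniform request, from goodness and the induction hypothesis. -/
lemma one_request {S : AddSubgroup X} {a b : ℝ} (hb : 0 ≤ b) {γ γ' : Ordinal.{0}}
    (ih : ∀ {ι : Type} [Fintype ι] {o : ι} {T : (ι → ℝ) →ₗ[ℝ] X}, Good S a b γ' ι o T →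
      ∃ F, EE (1 / a) b γ' ι o T F) (hγ : γ' < γ)
    {ι : Type} [Fintype ι] {o : ι} {T : (ι → ℝ) →ₗ[ℝ] X} (h : Good S a b γ ι o T)
    (k : ℕ) (A : Finset X) (B : Finset (X →L[ℝ] ℝ)) {ε : ℝ} (hε : 0 < ε) :
    ∃ (z : ι × Fin k → X) (F' : ι ⊕ (ι × Fin k) → X →L[ℝ] ℝ),
      EE (1 / a) b γ' (ι ⊕ (ι × Fin k)) (Sum.inl o) (extn T Prod.fst z) F' ∧
      (∀ p, ∀ x ∈ A, |F' (Sum.inr p) x - F' (Sum.inl p.1) x| ≤ ε) ∧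
      ∀ p, ∀ φ ∈ B, |φ (z p)| ≤ ε := by
  obtain ⟨K, hK⟩ := pigeon A (1 / a) ε hε (k + 1)
  obtain ⟨z, hz, hzB⟩ := h.small hb hγ (N := ι × Fin K) Prod.fst (Λ := B) (fun φ => φ.1) hε
  obtain ⟨F, hF⟩ := ih hz
  have hFn : ∀ c, ‖F c‖ ≤ 1 / a := by
    rw [ee_iff] at hF
    exact hF.2.1
  have := fun a => hK (fun i => F (Sum.inr (a, i))) (fun i => hFn _)
  choose s hs hsA using this
  let j : ι × Fin k → ι × Fin K := fun p => (p.1, s p.1 p.2.succ)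
  have hj : Function.Injective j := by
    rintro ⟨a, l⟩ ⟨a', l'⟩ hh
    simp only [j, Prod.mk.injEq] at hh
    obtain ⟨rfl, h2⟩ := hh
    simpa using hs a h2
  let sec : ι ⊕ (ι × Fin k) → ι ⊕ (ι × Fin K) :=
    Sum.elim (fun a => Sum.inr (a, s a 0)) (fun p => Sum.inr (j p))
  have hsec : ∀ c, collapse Prod.fst j (sec c) = c := by
    rintro (a | p)
    · have : ¬ ∃ p, j p = (a, s a 0) := by
        rintro ⟨⟨a', l⟩, hh⟩
        simp only [j, Prod.mk.injEq] at hh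
        obtain ⟨rfl, h2⟩ := hh
        exact Fin.succ_ne_zero _ (hs _ h2)
      simp only [sec, Sum.elim_inl]
      rw [collapse_inr_not _ _ _ this]
    · exact collapse_inr _ _ hj p
  have := hF.merge (collapse Prod.fst j) sec hsec
  rw [mrg_collapse T _ j hj z] at this
  refine ⟨fun p => z (j p), _, this, fun p x hx => ?_, fun p φ hφ => hzB (j p) ⟨φ, hφ⟩⟩
  exact hsA p.1 _ _ x hx

lemma exact_exists {a : ℝ} (ha : 0 < a) {ι : Type} [Fintype ι] {o : ι} {T : (ι → ℝ) →ₗ[ℝ] X}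
    (h : ∀ f, a * osc o f ≤ ‖T f‖) (c : ι) :
    ∃ φ : X →L[ℝ] ℝ, (∀ f, φ (T f) = f c - f o) ∧ ‖φ‖ ≤ 1 / a := by
  have hle : ∀ f, |f c - f o| ≤ 1 / a * ‖T f‖ := by
    intro f
    rw [one_div, inv_mul_eq_div, le_div_iff₀ ha]
    have := le_osc o f c
    nlinarith [h f]
  have wd : ∀ f g, T f = T g → f c - f o = g c - g o := by
    intro f g hfg
    have := hle (f - g)
    rw [map_sub, hfg, sub_self, norm_zero, mul_zero] at this
    have := abs_nonpos_iff.1 this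
    simp only [Pi.sub_apply] at this
    linarith
  choose pre hpre using fun y : LinearMap.range T => y.2
  let g : LinearMap.range T →ₗ[ℝ] ℝ :=
    { toFun := fun y => pre y c - pre y o
      map_add' := fun y w => by
        have := wd (pre (y + w)) (pre y + pre w) (by simp [hpre])
        rw [this]; simp only [Pi.add_apply]; ring
      map_smul' := fun r y => by
        have := wd (pre (r • y)) (r • pre y) (by simp [hpre])
        rw [this]; simp only [Pi.smul_apply, smul_eq_mul, RingHom.id_apply]; ring }
  let G : (LinearMap.range T) →L[ℝ] ℝ := g.mkContinuous (1 / a) (fun y => by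
    have := hle (pre y)
    rw [hpre] at this
    exact this)
  obtain ⟨φ, h1, h2⟩ := exists_extension_norm_eq (𝕜 := ℝ) _ G
  refine ⟨φ, fun f => ?_, ?_⟩
  · have := h1 ⟨T f, f, rfl⟩
    rw [this]
    exact wd _ _ (hpre ⟨T f, f, rfl⟩)
  · rw [h2]
    exact LinearMap.mkContinuous_norm_le _ (by positivity) _

end Enriched
end JO


namespace JO
section Exist
variable {X : Type} [NormedAddCommGroup X] [NormedSpace ℝ X]

lemma dual_compact {ι : Type} (M : ℝ) (P : Set (ι × X × ℝ))
    (A : (ι → X →L[ℝ] ℝ) → Finset X) (ε : (ι → X →L[ℝ] ℝ) → ℝ) (hε : ∀ F, 0 < ε F) [Finite ι] :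
    ∃ t : Finset (ι → X →L[ℝ] ℝ), (∀ F ∈ t, (∀ c, ‖F c‖ ≤ M) ∧ ∀ p ∈ P, F p.1 p.2.1 = p.2.2) ∧
      ∀ G : ι → X →L[ℝ] ℝ, (∀ c, ‖G c‖ ≤ M) → (∀ p ∈ P, G p.1 p.2.1 = p.2.2) →
        ∃ F ∈ t, ∀ c, ∀ x ∈ A F, |G c x - F c x| < ε F := by
  classical
  let toW : (ι → X →L[ℝ] ℝ) → (ι → WeakDual ℝ X) := fun F c => StrongDual.toWeakDual (F c)
  let toS : (ι → WeakDual ℝ X) → (ι → X →L[ℝ] ℝ) := fun F c => WeakDual.toStrongDual (F c)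
  let C : Set (ι → WeakDual ℝ X) := {F | (∀ c, ‖WeakDual.toStrongDual (F c)‖ ≤ M) ∧
    ∀ p ∈ P, F p.1 p.2.1 = p.2.2}
  have hev : ∀ (c : ι) (x : X), Continuous fun F : ι → WeakDual ℝ X => F c x := fun c x =>
    (WeakDual.eval_continuous x).comp (continuous_apply c)
  have hC : IsCompact C := by
    have h1 : IsCompact (Set.univ.pi fun _ : ι =>
        (WeakDual.toStrongDual ⁻¹' Metric.closedBall (0 : StrongDual ℝ X) M : Set (WeakDual ℝ X))) :=
      isCompact_univ_pi fun _ => WeakDual.isCompact_closedBall _ _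
    have h2 : IsClosed {F : ι → WeakDual ℝ X | ∀ p ∈ P, F p.1 p.2.1 = p.2.2} := by
      simp only [Set.setOf_forall]
      exact isClosed_iInter fun p => isClosed_iInter fun _ =>
        isClosed_eq (hev p.1 p.2.1) continuous_const
    refine (h1.inter_right h2).of_isClosed_subset ?_ ?_ <;> skip
    · have : C = (Set.univ.pi fun _ : ι =>
        (WeakDual.toStrongDual ⁻¹' Metric.closedBall (0 : StrongDual ℝ X) M : Set (WeakDual ℝ X))) ∩
        {F : ι → WeakDual ℝ X | ∀ p ∈ P, F p.1 p.2.1 = p.2.2} := by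
        ext F
        simp [C]
      rw [this]
      exact (h1.isClosed).inter h2
    · intro F hF
      refine ⟨?_, hF.2⟩
      intro c _
      simpa using hF.1 c
  obtain ⟨t, ht, hcov⟩ := hC.elim_nhds_subcover
    (fun F => {G | ∀ c, ∀ x ∈ A (toS F), |G c x - F c x| < ε (toS F)}) (by
      intro F _
      have : IsOpen {G : ι → WeakDual ℝ X | ∀ c, ∀ x ∈ A (toS F), |G c x - F c x| < ε (toS F)} := by
        simp only [Set.setOf_forall]
        refine isOpen_iInter_of_finite fun c => ?_
        refine isOpen_biInter_finset fun x _ => ?_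
        exact isOpen_lt (((hev c x).sub continuous_const).abs) continuous_const
      exact this.mem_nhds (by intro c x _; simpa using hε _))
  refine ⟨t.image toS, ?_, ?_⟩
  · intro F hF
    obtain ⟨G, hG, rfl⟩ := Finset.mem_image.1 hF
    exact ht G hG
  · intro G hG hP
    have : toW G ∈ C := ⟨hG, hP⟩
    obtain ⟨F, hF, hFG⟩ := Set.mem_iUnion₂.1 (hcov this)
    exact ⟨toS F, Finset.mem_image_of_mem _ hF, hFG⟩

theorem ee_exists {S : AddSubgroup X} {a b : ℝ} (ha : 0 < a) (hb : 0 ≤ b) {γ : Ordinal.{0}} :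
    ∀ {ι : Type} [Fintype ι] {o : ι} {T : (ι → ℝ) →ₗ[ℝ] X}, Good S a b γ ι o T →
      ∃ F, EE (1 / a) b γ ι o T F := by
  induction γ using WellFoundedLT.induction with
  | ind γ ih =>
  intro ι _ o T h
  classical
  by_contra hcon
  push Not at hcon
  have hlow := (good_iff _ _ _ _ _ _ _).1 h
  -- failing requests
  have fail : ∀ F : ι → X →L[ℝ] ℝ, (∀ c f, F c (T f) = f c - f o) → (∀ c, ‖F c‖ ≤ 1 / a) →
      ∃ γ', γ' < γ ∧ ∃ (k : ℕ) (ν : Fin k → ι) (A : Finset X) (B : Finset (X →L[ℝ] ℝ)) (ε : ℝ),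
      0 < ε ∧ ∀ (z : Fin k → X) (F' : ι ⊕ Fin k → X →L[ℝ] ℝ),
      EE (1 / a) b γ' (ι ⊕ Fin k) (Sum.inl o) (extn T ν z) F' →
      (∀ c, ∀ x ∈ A, |F' c x - F (Sum.elim id ν c) x| ≤ ε) → ¬ ∀ n, ∀ φ ∈ B, |φ (z n)| ≤ ε := by
    intro F h1 h2
    have := hcon F
    rw [ee_iff] at this
    push Not at this
    obtain ⟨γ', hγ, k, ν, A, B, ε, hε, H⟩ := this h1 h2 (fun f => (hlow.1 f).2)
    refine ⟨γ', hγ, k, ν, A, B, ε, hε, fun z F' e1 e2 e3 => ?_⟩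
    obtain ⟨n, φ, hφ, hl⟩ := H z F' e1 e2
    exact absurd (e3 n φ hφ) (not_le.2 hl)
  have fail' : ∀ F : ι → X →L[ℝ] ℝ, ∃ (γ' : Ordinal.{0}) (k : ℕ) (ν : Fin k → ι) (A : Finset X)
      (B : Finset (X →L[ℝ] ℝ)) (ε : ℝ), 0 < ε ∧
      ((∀ c f, F c (T f) = f c - f o) → (∀ c, ‖F c‖ ≤ 1 / a) → γ' < γ ∧
      ∀ (z : Fin k → X) (F' : ι ⊕ Fin k → X →L[ℝ] ℝ),
      EE (1 / a) b γ' (ι ⊕ Fin k) (Sum.inl o) (extn T ν z) F' →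
      (∀ c, ∀ x ∈ A, |F' c x - F (Sum.elim id ν c) x| ≤ ε) → ¬ ∀ n, ∀ φ ∈ B, |φ (z n)| ≤ ε) := by
    intro F
    by_cases hF : (∀ c f, F c (T f) = f c - f o) ∧ (∀ c, ‖F c‖ ≤ 1 / a)
    · obtain ⟨γ', hγ, k, ν, A, B, ε, hε, H⟩ := fail F hF.1 hF.2
      exact ⟨γ', k, ν, A, B, ε, hε, fun _ _ => ⟨hγ, H⟩⟩
    · exact ⟨0, 0, Fin.elim0, ∅, ∅, 1, one_pos, fun h1 h2 => absurd ⟨h1, h2⟩ hF⟩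
  choose γf kf νf Af Bf εf hεf Hf using fail'
  let P : Set (ι × X × ℝ) := {p | ∃ f, p.2.1 = T f ∧ p.2.2 = f p.1 - f o}
  have hP : ∀ G : ι → X →L[ℝ] ℝ, (∀ p ∈ P, G p.1 p.2.1 = p.2.2) ↔ ∀ c f, G c (T f) = f c - f o := by
    intro G
    constructor
    · intro hG c f
      exact hG (c, T f, f c - f o) ⟨f, rfl, rfl⟩
    · rintro hG ⟨c, x, r⟩ ⟨f, h1, h2⟩
      simp only at h1 h2 ⊢
      rw [h1, h2, hG]
  obtain ⟨t, ht, hcov⟩ := dual_compact (1 / a) P Af (fun F => εf F / 2) (fun F => half_pos (hεf F))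
  have htne : t.Nonempty := by
    choose G hG1 hG2 using fun c => exact_exists ha (fun f => (hlow.1 f).1) c
    obtain ⟨F, hF, _⟩ := hcov G hG2 ((hP G).2 hG1)
    exact ⟨F, hF⟩
  obtain ⟨F₀, hF₀, hmax⟩ := Finset.exists_max_image t γf htne
  obtain ⟨F₁, hF₁, hmin⟩ := Finset.exists_min_image t εf htne
  have hlt : γf F₀ < γ := (Hf F₀ ((hP F₀).1 (ht _ hF₀).2) (ht _ hF₀).1).1
  obtain ⟨z, F', hE, hA, hB⟩ := one_request hb (ih _ hlt) hlt h (t.sup kf) (t.biUnion Af)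
    (t.biUnion Bf) (half_pos (hεf F₁))
  have hE' := (ee_iff _ _ _ _ _ _ _).1 hE
  have hex : ∀ c f, F' (Sum.inl c) (T f) = f c - f o := by
    intro c f
    have := hE'.1 (Sum.inl c) (fun c => f (Sum.elim id Prod.fst c))
    rw [extn_elim] at this
    simpa using this
  obtain ⟨F, hF, hclose⟩ := hcov (fun c => F' (Sum.inl c)) (fun c => hE'.2.1 _) ((hP _).2 hex)
  have hk : kf F ≤ t.sup kf := Finset.le_sup hF
  let j : Fin (kf F) → ι × Fin (t.sup kf) := fun n => (νf F n, Fin.castLE hk n)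
  have hj : Function.Injective j := fun n m hnm => by
    have := (Prod.ext_iff.1 hnm).2
    exact Fin.castLE_injective hk this
  have hm := (hE.merge (collapse Prod.fst j) (Sum.map id j) (by
    rintro (c | c)
    · rfl
    · exact collapse_inr _ j hj c)).mono (hmax F hF)
  rw [mrg_collapse T _ j hj z] at hm
  refine (Hf F ((hP F).1 (ht _ hF).2) (ht _ hF).1).2 _ _ hm ?_ ?_
  · intro c x hx
    have hx' : x ∈ t.biUnion Af := Finset.mem_biUnion.2 ⟨F, hF, hx⟩
    have hmin' := hmin F hF
    rcases c with c | n
    · have := hclose c x hx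
      simp only [Sum.map_inl, Sum.elim_inl, id]
      exact this.le.trans (by linarith [hεf F])
    · have h1 := hclose (νf F n) x hx
      have h2 := hA (j n) x hx'
      simp only [Sum.map_inr, Sum.elim_inr]
      calc |F' (Sum.inr (j n)) x - F (νf F n) x| ≤ |F' (Sum.inr (j n)) x - F' (Sum.inl (j n).1) x|
            + |F' (Sum.inl (νf F n)) x - F (νf F n) x| := abs_sub_le _ _ _
        _ ≤ εf F := by linarith
  · intro n φ hφ
    exact (hB (j n) φ (Finset.mem_biUnion.2 ⟨F, hF, hφ⟩)).trans (by linarith [hmin F hF, hεf F₁])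

end Exist
end JO


namespace JO

lemma closed_seq {α : Type*} (P : ℕ → α → α → Prop) (hmono : ∀ n x y, P n x y → P (n + 1) x y)
    (R : α → ℕ → α → Prop) (x₀ : α) (h0 : P 0 x₀ x₀)
    (step : ∀ n (f : ℕ → α), (∀ i ≤ n, ∀ j ≤ n, P n (f i) (f j)) → ∀ i ≤ n, ∀ r,
      ∃ w, R (f i) r w ∧ P (n + 1) w w ∧ ∀ j ≤ n, P (n + 1) (f j) w ∧ P (n + 1) w (f j)) :
    ∃ u : ℕ → α, u 0 = x₀ ∧ (∀ i j, ∃ n, P n (u i) (u j)) ∧ ∀ i r, ∃ j, R (u i) r (u j) := by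
  classical
  have nxt : ∀ n (f : {f : ℕ → α // ∀ i ≤ n, ∀ j ≤ n, P n (f i) (f j)}),
      ∃ g : {f : ℕ → α // ∀ i ≤ n + 1, ∀ j ≤ n + 1, P (n + 1) (f i) (f j)},
        (∀ i ≤ n, g.1 i = f.1 i) ∧ R (f.1 n.unpair.1) n.unpair.2 (g.1 (n + 1)) := by
    rintro n ⟨f, hf⟩
    obtain ⟨w, hR, hw, hfw⟩ := step n f hf n.unpair.1 (Nat.unpair_left_le n) n.unpair.2
    refine ⟨⟨Function.update f (n + 1) w, ?_⟩, ?_, ?_⟩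
    · intro i hi j hj
      by_cases h1 : i = n + 1 <;> by_cases h2 : j = n + 1
      · simpa [h1, h2] using hw
      · simpa [h1, h2] using (hfw j (by omega)).2
      · simpa [h1, h2] using (hfw i (by omega)).1
      · simpa [h1, h2] using hmono _ _ _ (hf i (by omega) j (by omega))
    · intro i hi
      simp [show i ≠ n + 1 by omega]
    · simpa using hR
  choose g hg hgR using nxt
  let s : (n : ℕ) → {f : ℕ → α // ∀ i ≤ n, ∀ j ≤ n, P n (f i) (f j)} := fun n =>
    Nat.rec ⟨fun _ => x₀, fun _ _ _ _ => h0⟩ (fun n f => g n f) n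
  have hs : ∀ n, s (n + 1) = g n (s n) := fun n => rfl
  have hst : ∀ i d, (s (i + d)).1 i = (s i).1 i := by
    intro i d
    induction d with
    | zero => rfl
    | succ d ih => rw [← ih, ← add_assoc, hs, hg _ _ _ (by omega)]
  have hst' : ∀ i m, i ≤ m → (s m).1 i = (s i).1 i := by
    intro i m h
    obtain ⟨d, rfl⟩ := Nat.exists_eq_add_of_le h
    exact hst i d
  refine ⟨fun n => (s n).1 n, rfl, fun i j => ⟨max i j, ?_⟩, fun i r => ⟨Nat.pair i r + 1, ?_⟩⟩
  · have := (s (max i j)).2 i (le_max_left _ _) j (le_max_right _ _)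
    rwa [hst' i _ (le_max_left _ _), hst' j _ (le_max_right _ _)] at this
  · have := hgR (Nat.pair i r) (s (Nat.pair i r))
    rw [← hs, Nat.unpair_pair] at this
    rwa [hst' i _ (Nat.left_le_pair i r)] at this

section Loop
variable {X : Type} [NormedAddCommGroup X] [NormedSpace ℝ X]

/-- nodes of the construction -/
structure Node (X : Type) [NormedAddCommGroup X] [NormedSpace ℝ X] where
  γ : Ordinal.{0}
  ι : Type
  fin : Fintype ι
  o : ι
  T : (ι → ℝ) →ₗ[ℝ] X
  F : ι → X →L[ℝ] ℝ

attribute [instance] Node.fin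

/-- validity of a node -/
def Node.Valid (M b : ℝ) (v : Node X) : Prop :=
  EE M b v.γ v.ι v.o v.T v.F ∧ (Set.Iio v.γ).Countable

lemma kills_const {b : ℝ} {ι : Type} [Fintype ι] {o : ι} {T : (ι → ℝ) →ₗ[ℝ] X}
    (h : ∀ f, ‖T f‖ ≤ b * osc o f) (r : ℝ) : T (fun _ => r) = 0 := by
  have := h (fun _ => r)
  have h0 : osc o (fun _ : ι => r) = 0 := by
    apply le_antisymm _ (osc_nonneg _ _)
    exact osc_le le_rfl (by simp)
  rw [h0, mul_zero] at this
  exact norm_le_zero_iff.1 this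

open Classical in
lemma T_eq_sum {b : ℝ} {ι : Type} [Fintype ι] {o : ι} {T : (ι → ℝ) →ₗ[ℝ] X}
    (h : ∀ f, ‖T f‖ ≤ b * osc o f) (f : ι → ℝ) :
    T f = ∑ c, (f c - f o) • T (Pi.single c 1) := by
  have e1 : f = (∑ c, (f c - f o) • (Pi.single c 1 : ι → ℝ)) + (fun _ => f o) := by
    ext d
    simp [Finset.sum_apply, Pi.single_apply]
  conv_lhs => rw [e1]
  rw [map_add, kills_const h, add_zero, map_sum]
  simp

lemma abs_F_diff {b ε : ℝ} {ι : Type} [Fintype ι] {o : ι} {T : (ι → ℝ) →ₗ[ℝ] X}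
    (h : ∀ f, ‖T f‖ ≤ b * osc o f) (φ ψ : X →L[ℝ] ℝ) 
    (hc : ∀ c, |φ (T (fun d => open Classical in if d = c then 1 else 0)) -
      ψ (T (fun d => open Classical in if d = c then 1 else 0))| ≤ ε) (f : ι → ℝ) :
    |φ (T f) - ψ (T f)| ≤ Fintype.card ι * ε * osc o f := by
  classical
  have hs : ∀ c : ι, (Pi.single c 1 : ι → ℝ) = fun d => if d = c then 1 else 0 := by
    intro c; ext d; simp [Pi.single_apply]
  rw [T_eq_sum h f, map_sum, map_sum, ← Finset.sum_sub_distrib]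
  calc |∑ c, (φ ((f c - f o) • T (Pi.single c 1)) - ψ ((f c - f o) • T (Pi.single c 1)))|
      ≤ ∑ c, |φ ((f c - f o) • T (Pi.single c 1)) - ψ ((f c - f o) • T (Pi.single c 1))| :=
        Finset.abs_sum_le_sum_abs _ _
    _ ≤ ∑ c : ι, osc o f * ε := by
        refine Finset.sum_le_sum fun c _ => ?_
        rw [map_smul, map_smul, smul_eq_mul, smul_eq_mul, ← mul_sub, abs_mul, hs c]
        refine mul_le_mul (le_osc o f c) ?_ (abs_nonneg _) (osc_nonneg _ _)
        convert hc c
    _ = _ := by simp; ring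

theorem loop {M b : ℝ} (v₀ : Node X) (h₀ : v₀.Valid M b) :
    ∃ 𝒩 : Set (Node X), v₀ ∈ 𝒩 ∧ (∀ v ∈ 𝒩, v.Valid M b) ∧
      (∀ v ∈ 𝒩, ∀ w ∈ 𝒩, ∀ c f, |v.F c (w.T f)| ≤ 2 * osc w.o f) ∧
      ∀ v ∈ 𝒩, ∀ γ' < v.γ, ∀ (k : ℕ) (ν : Fin k → v.ι), ∃ z F',
        Node.mk γ' (v.ι ⊕ Fin k) inferInstance (Sum.inl v.o) (extn v.T ν z) F' ∈ 𝒩 := by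
  classical
  let Q : Node X → Type 1 := fun v => Σ (_ : Set.Iio v.γ) (k : ℕ), (Fin k → v.ι)
  have henc : ∀ v : Node X, ∃ e : Q v → ℕ, v.Valid M b → Function.Injective e := by
    intro v
    by_cases hv : (Set.Iio v.γ).Countable
    · haveI : Countable (Set.Iio v.γ) := hv
      haveI : Countable (Q v) := by dsimp only [Q]; infer_instance
      obtain ⟨e, he⟩ := Countable.exists_injective_nat (Q v)
      exact ⟨e, fun _ => he⟩
    · exact ⟨fun _ => 0, fun h => absurd h.2 hv⟩
  choose enc henc using henc
  let P : ℕ → Node X → Node X → Prop := fun n v w =>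
    v.Valid M b ∧ w.Valid M b ∧ ∀ c f, |v.F c (w.T f)| ≤ (2 - (1 / 2) ^ n) * osc w.o f
  let R : Node X → ℕ → Node X → Prop := fun v r w => ∀ q : Q v, enc v q = r → ∃ z F',
    w = Node.mk q.1 (v.ι ⊕ Fin q.2.1) inferInstance (Sum.inl v.o) (extn v.T q.2.2 z) F'
  have hself : ∀ n (w : Node X), w.Valid M b → P n w w := by
    intro n w hw
    refine ⟨hw, hw, fun c f => ?_⟩
    have hw1 := (ee_iff _ _ _ _ _ _ _).1 hw.1
    rw [hw1.1]
    have h1 := le_osc w.o f c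
    have h2 : ((1 : ℝ) / 2) ^ n ≤ 1 := pow_le_one₀ (by norm_num) (by norm_num)
    nlinarith [osc_nonneg w.o f]
  have hmono : ∀ n x y, P n x y → P (n + 1) x y := by
    rintro n x y ⟨hx, hy, h⟩
    refine ⟨hx, hy, fun c f => (h c f).trans ?_⟩
    have h2 : ((1 : ℝ) / 2) ^ (n + 1) ≤ (1 / 2) ^ n :=
      pow_le_pow_of_le_one (by norm_num) (by norm_num) (Nat.le_succ n)
    exact mul_le_mul_of_nonneg_right (by linarith) (osc_nonneg _ _)
  obtain ⟨u, hu0, huP, huR⟩ := closed_seq P hmono R v₀ (hself 0 _ h₀) (by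
    intro n f hf i hi r
    by_cases hq : ∃ q : Q (f i), enc (f i) q = r
    swap
    · exact ⟨f i, fun q h => absurd ⟨q, h⟩ hq, hmono _ _ _ (hf i hi i hi),
        fun j hj => ⟨hmono _ _ _ (hf j hj i hi), hmono _ _ _ (hf i hi j hj)⟩⟩
    obtain ⟨q, hq⟩ := hq
    have hval : ∀ j ≤ n, (f j).Valid M b := fun j hj => (hf j hj j hj).1
    have hv := (ee_iff _ _ _ _ _ _ _).1 (hval i hi).1
    let k := q.2.1
    let D : ℝ := 1 + 2 * k + ∑ j ∈ Finset.range (n + 1), (Fintype.card (f j).ι : ℝ)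
    have hS : ∀ j ≤ n, (Fintype.card (f j).ι : ℝ) ≤
        ∑ j ∈ Finset.range (n + 1), (Fintype.card (f j).ι : ℝ) := fun j hj =>
      Finset.single_le_sum (f := fun j => (Fintype.card (f j).ι : ℝ)) (fun _ _ => Nat.cast_nonneg _)
        (Finset.mem_range.2 (by omega))
    have hS0 : (0 : ℝ) ≤ ∑ j ∈ Finset.range (n + 1), (Fintype.card (f j).ι : ℝ) :=
      Finset.sum_nonneg fun _ _ => Nat.cast_nonneg _
    have hk0 : (0 : ℝ) ≤ k := Nat.cast_nonneg _
    have hD : 0 < D := by positivity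
    let δ : ℝ := (1 / 2) ^ (n + 1)
    have hδ : 0 < δ := by positivity
    have hδ2 : ((1 : ℝ) / 2) ^ n = 2 * δ := by simp only [δ, pow_succ]; ring
    have hk1 : 2 * (k : ℝ) * (δ / D) ≤ δ := by
      rw [mul_div_assoc', div_le_iff₀ hD, mul_comm]
      exact mul_le_mul_of_nonneg_left (by simp only [D]; linarith) hδ.le
    have hc1 : ∀ j ≤ n, (Fintype.card (f j).ι : ℝ) * (δ / D) ≤ δ := by
      intro j hj
      rw [mul_div_assoc', div_le_iff₀ hD, mul_comm]
      exact mul_le_mul_of_nonneg_left (by have := hS j hj; simp only [D]; linarith) hδ.le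
    let A : Finset X := (Finset.range (n + 1)).biUnion fun j =>
      Finset.univ.image fun c => (f j).T (fun d => if d = c then 1 else 0)
    let B : Finset (X →L[ℝ] ℝ) := (Finset.range (n + 1)).biUnion fun j =>
      Finset.univ.image fun c => (f j).F c
    obtain ⟨z, F', hE, hA, hB⟩ := hv.2.2.2 q.1 q.1.2 q.2.1 q.2.2 A B (δ / D) (by positivity)
    let w : Node X := Node.mk q.1 ((f i).ι ⊕ Fin q.2.1) inferInstance (Sum.inl (f i).o)
      (extn (f i).T q.2.2 z) F'
    have hw : w.Valid M b :=
      ⟨hE, (hval i hi).2.mono (Set.Iio_subset_Iio (le_of_lt q.1.2))⟩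
    refine ⟨w, ?_, hself _ _ hw, fun j hj => ⟨⟨hval j hj, hw, ?_⟩, hw, hval j hj, ?_⟩⟩
    · intro q' hq'
      obtain rfl := henc _ (hval i hi) (hq'.trans hq.symm)
      exact ⟨z, F', rfl⟩
    · intro c g
      change |(f j).F c (extn (f i).T q.2.2 z g)| ≤ (2 - δ) * osc (Sum.inl (f i).o) g
      have h1 : |(f j).F c ((f i).T (fun a => g (Sum.inl a)))| ≤
          (2 - 2 * δ) * osc (Sum.inl (f i).o) g := by
        refine ((hf j hj i hi).2.2 c _).trans ?_
        rw [hδ2]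
        have hd1 : ((1 : ℝ) / 2) ^ n ≤ 1 := pow_le_one₀ (by norm_num) (by norm_num)
        exact mul_le_mul_of_nonneg_left (osc_comp_le Sum.inl _ g) (by linarith)
      have h2 : |∑ m, (g (Sum.inr m) - g (Sum.inl (q.2.2 m))) * (f j).F c (z m)| ≤
          δ * osc (Sum.inl (f i).o) g := by
        calc _ ≤ ∑ m, |(g (Sum.inr m) - g (Sum.inl (q.2.2 m))) * (f j).F c (z m)| :=
              Finset.abs_sum_le_sum_abs _ _
          _ ≤ ∑ m : Fin q.2.1, (2 * osc (Sum.inl (f i).o) g) * (δ / D) := by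
              refine Finset.sum_le_sum fun m _ => ?_
              rw [abs_mul]
              refine mul_le_mul (abs_sub_le_osc _ g _ _) (hB m _ ?_) (abs_nonneg _)
                (mul_nonneg zero_le_two (osc_nonneg _ _))
              exact Finset.mem_biUnion.2 ⟨j, Finset.mem_range.2 (by omega),
                Finset.mem_image_of_mem _ (Finset.mem_univ c)⟩
          _ = 2 * (k : ℝ) * (δ / D) * osc (Sum.inl (f i).o) g := by simp [k]; ring
          _ ≤ _ := mul_le_mul_of_nonneg_right hk1 (osc_nonneg _ _)
      rw [extn_apply, map_add, map_sum]
      simp only [map_smul, smul_eq_mul]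
      refine (abs_add_le _ _).trans ?_
      linarith
    · intro c g
      change |F' c ((f j).T g)| ≤ (2 - δ) * osc (f j).o g
      have hvj := (ee_iff _ _ _ _ _ _ _).1 (hval j hj).1
      have h1 := (hf i hi j hj).2.2 (Sum.elim id q.2.2 c) g
      have h2 := abs_F_diff (ε := δ / D) hvj.2.2.1 (F' c) ((f i).F (Sum.elim id q.2.2 c)) (by
        intro d
        refine hA c _ ?_
        refine Finset.mem_biUnion.2 ⟨j, Finset.mem_range.2 (by omega), ?_⟩
        refine Finset.mem_image.2 ⟨d, Finset.mem_univ d, ?_⟩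
        congr) g
      have h3 := mul_le_mul_of_nonneg_right (hc1 j hj) (osc_nonneg (f j).o g)
      have h4 := abs_sub_abs_le_abs_sub (F' c ((f j).T g)) ((f i).F (Sum.elim id q.2.2 c) ((f j).T g))
      rw [hδ2] at h1
      linarith)
  refine ⟨Set.range u, ⟨0, hu0⟩, ?_, ?_, ?_⟩
  · rintro _ ⟨i, rfl⟩
    obtain ⟨n, hn⟩ := huP i i
    exact hn.1
  · rintro _ ⟨i, rfl⟩ _ ⟨j, rfl⟩ c f
    obtain ⟨n, hn⟩ := huP i j
    refine (hn.2.2 c f).trans (mul_le_mul_of_nonneg_right ?_ (osc_nonneg _ _))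
    have : (0 : ℝ) ≤ (1 / 2) ^ n := by positivity
    linarith
  · rintro _ ⟨i, rfl⟩ γ' hγ k ν
    obtain ⟨j, hj⟩ := huR i (enc (u i) ⟨⟨γ', hγ⟩, k, ν⟩)
    obtain ⟨z, F', h⟩ := hj ⟨⟨γ', hγ⟩, k, ν⟩ rfl
    exact ⟨z, F', j, h⟩

end Loop
end JO


namespace JO
section Renorm
variable {X : Type} [NormedAddCommGroup X] [NormedSpace ℝ X] [CompleteSpace X]

/-- The renorming map. -/
lemma renorm_map (Φ : Set (X →L[ℝ] ℝ)) {M c : ℝ} (hc : 0 < c) (hM : ∀ φ ∈ Φ, ‖φ‖ ≤ M)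
    (hn : ∀ x, ∃ φ ∈ Φ, c * ‖x‖ ≤ |φ x|) :
    ∃ (V : Type) (_ : NormedAddCommGroup V) (_ : NormedSpace ℝ V) (_ : CompleteSpace V)
      (e : X ≃L[ℝ] V), (∀ x, ∀ φ ∈ Φ, |φ x| ≤ ‖e x‖) ∧
      ∀ x C, (∀ φ ∈ Φ, |φ x| ≤ C) → ‖e x‖ ≤ C := by
  have hΦ : Φ.Nonempty := by
    obtain ⟨φ, hφ, _⟩ := hn 0
    exact ⟨φ, hφ⟩
  obtain ⟨φ₀, hφ₀⟩ := hΦ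
  have hbd : ∀ x, ∀ φ ∈ Φ, |φ x| ≤ M * ‖x‖ := fun x φ hφ =>
    (φ.le_opNorm x).trans (mul_le_mul_of_nonneg_right (hM φ hφ) (norm_nonneg _))
  let Ψ₀ : X →ₗ[ℝ] lp (fun _ : Φ => ℝ) ⊤ :=
    { toFun := fun x => ⟨fun φ => φ.1 x, memℓp_infty ⟨M * ‖x‖, by
        rintro _ ⟨φ, rfl⟩
        exact hbd x φ.1 φ.2⟩⟩
      map_add' := fun x y => by ext φ; simp; rfl
      map_smul' := fun r x => by ext φ; simp }
  have hle : ∀ x C, (∀ φ ∈ Φ, |φ x| ≤ C) → ‖Ψ₀ x‖ ≤ C := by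
    intro x C h
    refine lp.norm_le_of_forall_le ((abs_nonneg _).trans (h φ₀ hφ₀)) ?_
    intro φ
    exact h φ.1 φ.2
  have hge : ∀ x, ∀ φ ∈ Φ, |φ x| ≤ ‖Ψ₀ x‖ := by
    intro x φ hφ
    exact lp.norm_apply_le_norm ENNReal.top_ne_zero (Ψ₀ x) ⟨φ, hφ⟩
  let Ψ : X →L[ℝ] lp (fun _ : Φ => ℝ) ⊤ := Ψ₀.mkContinuous M fun x => hle x _ (hbd x)
  have hΨ : ∀ x, Ψ x = Ψ₀ x := fun x => rfl
  have hanti : AntilipschitzWith (Real.toNNReal c⁻¹) Ψ := by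
    refine Ψ.antilipschitz_of_bound fun x => ?_
    obtain ⟨φ, hφ, h⟩ := hn x
    rw [Real.coe_toNNReal _ (by positivity), inv_mul_eq_div, le_div_iff₀ hc, mul_comm]
    exact h.trans (hge x φ hφ)
  have hcl : IsClosed (Set.range Ψ) := hanti.isClosed_range Ψ.uniformContinuous
  let e := Ψ.equivRange hanti.injective hcl
  have hcomp : CompleteSpace (LinearMap.range (Ψ : X →ₗ[ℝ] lp (fun _ : Φ => ℝ) ⊤)) := by
    exact IsClosed.completeSpace_coe (hs := hcl)
  exact ⟨_, _, _, hcomp, e, hge, hle⟩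

variable {K : ℝ}

theorem renorm_i (h : ∀ (V : Type) [NormedAddCommGroup V] [NormedSpace ℝ V] [CompleteSpace V],
      Nonempty (X ≃L[ℝ] V) → IsKElastic V K) (hK : 0 ≤ K)
    (Φ : Set (X →L[ℝ] ℝ)) {M c : ℝ} (hc : 0 < c) (hM : ∀ φ ∈ Φ, ‖φ‖ ≤ M)
    (hn : ∀ x, ∃ φ ∈ Φ, c * ‖x‖ ≤ |φ x|) :
    ∃ J : X →L[ℝ] X, ∀ x, (∀ φ ∈ Φ, |φ x| ≤ ‖J x‖) ∧ ∀ C, (∀ φ ∈ Φ, |φ x| ≤ C) → ‖J x‖ ≤ K * C := by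
  obtain ⟨V, _, _, _, e, h1, h2⟩ := renorm_map Φ hc hM hn
  obtain ⟨T, hT⟩ := h X ⟨ContinuousLinearEquiv.refl ℝ X⟩ V
    ⟨(e.symm : V →L[ℝ] X), by
      obtain ⟨C, hC, hC'⟩ := (e : X →L[ℝ] V).bound
      refine ⟨C⁻¹, by positivity, fun y => ?_⟩
      have := hC' (e.symm y)
      rw [inv_mul_le_iff₀ hC]
      simpa using this⟩
  refine ⟨T.comp (e : X →L[ℝ] V), fun x => ⟨fun φ hφ => (h1 x φ hφ).trans (hT (e x)).1, ?_⟩⟩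
  intro C hC
  exact (hT (e x)).2.trans (mul_le_mul_of_nonneg_left (h2 x C hC) hK)

theorem renorm_ii (h : ∀ (V : Type) [NormedAddCommGroup V] [NormedSpace ℝ V] [CompleteSpace V],
      Nonempty (X ≃L[ℝ] V) → IsKElastic V K)
    (Φ : Set (X →L[ℝ] ℝ)) {M c : ℝ} (hc : 0 < c) (hM : ∀ φ ∈ Φ, ‖φ‖ ≤ M)
    (hn : ∀ x, ∃ φ ∈ Φ, c * ‖x‖ ≤ |φ x|) :
    ∃ J : X →L[ℝ] X, ∀ x, (∀ φ ∈ Φ, |φ (J x)| ≤ K * ‖x‖) ∧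
      ∀ C, (∀ φ ∈ Φ, |φ (J x)| ≤ C) → ‖x‖ ≤ C := by
  obtain ⟨V, _, _, _, e, h1, h2⟩ := renorm_map Φ hc hM hn
  obtain ⟨T, hT⟩ := h V ⟨e⟩ X
    ⟨(e : X →L[ℝ] V), by
      obtain ⟨C, hC, hC'⟩ := (e.symm : V →L[ℝ] X).bound
      refine ⟨C⁻¹, by positivity, fun y => ?_⟩
      have := hC' (e y)
      rw [inv_mul_le_iff₀ hC]
      simpa using this⟩
  refine ⟨(e.symm : V →L[ℝ] X).comp T, fun x => ⟨fun φ hφ => ?_, fun C hC => ?_⟩⟩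
  · have := h1 (e.symm (T x)) φ hφ
    rw [e.apply_symm_apply] at this
    exact this.trans (hT x).2
  · have := h2 (e.symm (T x)) C hC
    rw [e.apply_symm_apply] at this
    exact (hT x).1.trans this

/-- Lifting an enriched position to a position with good constants. -/
theorem j_lift (h : ∀ (V : Type) [NormedAddCommGroup V] [NormedSpace ℝ V] [CompleteSpace V],
      Nonempty (X ≃L[ℝ] V) → IsKElastic V K) (hK : 0 ≤ K) {M b : ℝ} (hM : 0 < M) (hb : 0 < b)
    {γ : Ordinal.{0}} (hγ : (Set.Iio γ).Countable) {ι : Type} [Fintype ι] {o : ι}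
    {T : (ι → ℝ) →ₗ[ℝ] X} {F : ι → X →L[ℝ] ℝ} (hE : EE M b γ ι o T F) :
    ∃ J : X →L[ℝ] X, Good ⊤ 1 (2 * K) γ ι o ((J : X →ₗ[ℝ] X) ∘ₗ T) := by
  obtain ⟨𝒩, hv0, hval, hbd, hcl⟩ := loop (Node.mk γ ι _ o T F) ⟨hE, hγ⟩
  let Φ : Set (X →L[ℝ] ℝ) := {φ | ‖φ‖ ≤ M ∧ ∀ v ∈ 𝒩, ∀ f, |φ (v.T f)| ≤ 2 * osc v.o f}
  have hF : ∀ v ∈ 𝒩, ∀ c, v.F c ∈ Φ := fun v hv c =>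
    ⟨((ee_iff _ _ _ _ _ _ _).1 (hval v hv).1).2.1 c, fun w hw f => hbd v hv w hw c f⟩
  obtain ⟨J, hJ⟩ := renorm_i h hK Φ (c := min M (2 / b)) (by positivity) (fun φ hφ => hφ.1) (by
    intro x
    obtain ⟨φ, h1, h2⟩ := exists_dual_vector'' ℝ x
    refine ⟨(min M (2 / b)) • φ, ⟨?_, fun v hv f => ?_⟩, ?_⟩
    · rw [norm_smul, Real.norm_of_nonneg (by positivity)]
      calc _ ≤ M * 1 := mul_le_mul (min_le_left _ _) h1 (norm_nonneg _) hM.le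
        _ = M := mul_one M
    · have hvv := ((ee_iff _ _ _ _ _ _ _).1 (hval v hv).1).2.2.1 f
      rw [ContinuousLinearMap.smul_apply, smul_eq_mul, abs_mul, abs_of_nonneg (by positivity)]
      calc _ ≤ 2 / b * (b * osc v.o f) := by
            refine mul_le_mul (min_le_right _ _) ?_ (abs_nonneg _) (by positivity)
            refine (φ.le_opNorm _).trans ?_
            calc _ ≤ 1 * ‖v.T f‖ := mul_le_mul_of_nonneg_right h1 (norm_nonneg _)
              _ ≤ _ := by rw [one_mul]; exact hvv
        _ = _ := by field_simp
    · rw [ContinuousLinearMap.smul_apply, h2, smul_eq_mul, abs_mul, abs_of_nonneg (by positivity)]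
      simp)
  refine ⟨J, ?_⟩
  have key : ∀ γ (v : Node X), v ∈ 𝒩 → v.γ = γ →
      Good ⊤ 1 (2 * K) γ v.ι v.o ((J : X →ₗ[ℝ] X) ∘ₗ v.T) := by
    intro γ
    induction γ using WellFoundedLT.induction with
    | ind γ ih =>
      intro v hv hvγ
      have hvv := (ee_iff _ _ _ _ _ _ _).1 (hval v hv).1
      rw [good_iff]
      refine ⟨fun f => ⟨?_, ?_⟩, fun _ => trivial, fun γ' hγ' k ν => ?_⟩
      · rw [one_mul]
        refine osc_le (norm_nonneg _) fun c => ?_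
        have := (hJ (v.T f)).1 (v.F c) (hF v hv c)
        rwa [hvv.1] at this
      · have := (hJ (v.T f)).2 (2 * osc v.o f) (fun φ hφ => hφ.2 v hv f)
        refine this.trans (le_of_eq (by ring))
      · obtain ⟨z, F', hw⟩ := hcl v hv γ' (hvγ ▸ hγ') k ν
        refine ⟨fun n => J (z n), ?_⟩
        have := ih γ' hγ' _ hw rfl
        have e : extn ((J : X →ₗ[ℝ] X) ∘ₗ v.T) ν (fun n => J (z n)) =
            (J : X →ₗ[ℝ] X) ∘ₗ extn v.T ν z := by
          refine LinearMap.ext fun f => ?_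
          simp [extn_apply]
        rw [e]
        exact this
  exact key γ _ hv0 rfl

end Renorm
end JO


namespace JO
section Fresh
variable {X : Type} [NormedAddCommGroup X] [NormedSpace ℝ X]

/-- position obtained by adding fresh vectors `e` -/
noncomputable def freshT {k : ℕ} (e : Fin k → X) {ι κ : Type} (o : ι) (i : ι → κ) (j : Fin k → κ)
    (μ : ι → Option (Fin k)) (T : (ι → ℝ) →ₗ[ℝ] X) : (κ → ℝ) →ₗ[ℝ] X :=
  (∑ l, ((LinearMap.proj (R := ℝ) (φ := fun _ : κ => ℝ) (j l)) -
      (LinearMap.proj (R := ℝ) (φ := fun _ : κ => ℝ) (i o))).smulRight (e l)) +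
  T ∘ₗ (LinearMap.funLeft ℝ ℝ i - LinearMap.funLeft ℝ ℝ (fun a => (μ a).elim (i o) j))

lemma freshT_apply {k : ℕ} (e : Fin k → X) {ι κ : Type} (o : ι) (i : ι → κ) (j : Fin k → κ)
    (μ : ι → Option (Fin k)) (T : (ι → ℝ) →ₗ[ℝ] X) (f : κ → ℝ) :
    freshT e o i j μ T f = (∑ l, (f (j l) - f (i o)) • e l) +
      T (fun a => f (i a) - f ((μ a).elim (i o) j)) := by
  simp only [freshT, LinearMap.add_apply, LinearMap.sum_apply, LinearMap.smulRight_apply,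
    LinearMap.sub_apply, LinearMap.proj_apply, LinearMap.comp_apply]
  rfl

lemma fresh_bounds {k : ℕ} {e : Fin k → X} {estar : Fin k → X →L[ℝ] ℝ}
    (hbi : ∀ l m, estar l (e m) = if l = m then 1 else 0) {a b B s τ : ℝ} (ha : 0 < a) (hb : 0 ≤ b)
    (hB : ∀ l, ‖estar l‖ ≤ B) (hB0 : 0 ≤ B) (hs : s = ∑ l, ‖e l‖) (hτ : 0 ≤ τ) (hτs : s * τ ≤ a / 2)
    {ι κ : Type} [Fintype ι] [Fintype κ] {o : ι} {i : ι → κ} {j : Fin k → κ}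
    {μ : ι → Option (Fin k)} {T : (ι → ℝ) →ₗ[ℝ] X} (hμ : μ o = none)
    (hsurj : ∀ c, ∃ q : ι ⊕ Fin k, Sum.elim i j q = c)
    (hT : ∀ f, a * osc o f ≤ ‖T f‖ ∧ ‖T f‖ ≤ b * osc o f)
    (hθ : ∀ l g, |estar l (T g)| ≤ τ * osc o g) (f : κ → ℝ) :
    ((1 + τ) * (2 * (1 + s * B) / a) + B)⁻¹ * osc (i o) f ≤ ‖freshT e o i j μ T f‖ ∧
      ‖freshT e o i j μ T f‖ ≤ (s + 2 * b + 1) * osc (i o) f := by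
  have hs0 : 0 ≤ s := by rw [hs]; exact Finset.sum_nonneg fun _ _ => norm_nonneg _
  set g : ι → ℝ := fun a => f (i a) - f ((μ a).elim (i o) j) with hg
  set N := ‖freshT e o i j μ T f‖ with hN
  have hgo : g o = 0 := by simp [hg, hμ]
  have happ := freshT_apply e o i j μ T f
  have hd : ∀ l, |f (j l) - f (i o)| ≤ B * N + τ * osc o g := by
    intro l
    have h1 : estar l (freshT e o i j μ T f) = (f (j l) - f (i o)) + estar l (T g) := by
      rw [happ, map_add, map_sum]
      simp [hbi, hg]
    have h2 : |estar l (freshT e o i j μ T f)| ≤ B * N :=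
      ((estar l).le_opNorm _).trans (mul_le_mul_of_nonneg_right (hB l) (norm_nonneg _))
    have h3 := hθ l g
    rw [h1] at h2
    rw [abs_le] at *
    constructor <;> linarith [h2.1, h2.2, h3.1, h3.2]
  have hG0 := osc_nonneg o g
  have hN0 : 0 ≤ N := norm_nonneg _
  have hsum : ∀ D : ℝ, (∀ l, |f (j l) - f (i o)| ≤ D) →
      ‖∑ l, (f (j l) - f (i o)) • e l‖ ≤ s * D := by
    intro D hD
    refine (norm_sum_le _ _).trans ?_
    rw [hs, Finset.sum_mul]
    refine Finset.sum_le_sum fun l _ => ?_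
    rw [norm_smul, mul_comm]
    exact mul_le_mul_of_nonneg_left (hD l) (norm_nonneg _)
  have hG : osc o g ≤ 2 * (1 + s * B) / a * N := by
    have h1 := (hT g).1
    have h2 : ‖T g‖ ≤ N + s * (B * N + τ * osc o g) := by
      have : T g = freshT e o i j μ T f - ∑ l, (f (j l) - f (i o)) • e l := by
        rw [happ]; simp [hg]
      rw [this]
      exact (norm_sub_le _ _).trans (add_le_add le_rfl (hsum _ hd))
    rw [div_mul_eq_mul_div, le_div_iff₀ ha]
    nlinarith
  have hi : ∀ a, |f (i a) - f (i o)| ≤ osc o g + (B * N + τ * osc o g) := by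
    intro a
    have h1 : |g a| ≤ osc o g := by simpa [hgo] using le_osc o g a
    rcases hm : μ a with _ | l
    · have : f (i a) - f (i o) = g a := by simp [hg, hm]
      rw [this]
      have : 0 ≤ B * N + τ * osc o g := by positivity
      linarith
    · have : f (i a) - f (i o) = g a + (f (j l) - f (i o)) := by simp [hg, hm]
      rw [this]
      exact (abs_add_le _ _).trans (add_le_add h1 (hd l))
  constructor
  · have hC : 0 < (1 + τ) * (2 * (1 + s * B) / a) + B := by positivity
    rw [inv_mul_le_iff₀ hC]
    have hmain : osc (i o) f ≤ osc o g + (B * N + τ * osc o g) := by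
      refine osc_le (by positivity) fun c => ?_
      obtain ⟨q | q, rfl⟩ := hsurj c
      · exact hi q
      · have := hd q
        simp only [Sum.elim_inr]
        linarith
    have : (1 + τ) * osc o g ≤ (1 + τ) * (2 * (1 + s * B) / a * N) :=
      mul_le_mul_of_nonneg_left hG (by positivity)
    nlinarith
  · rw [hN, happ]
    have hO := osc_nonneg (i o) f
    refine (norm_add_le _ _).trans ?_
    have h1 := hsum (osc (i o) f) (fun l => le_osc _ f _)
    have h2 := (hT g).2
    have h3 : osc o g ≤ 2 * osc (i o) f := by
      refine osc_le (by positivity) fun c => ?_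
      rw [hgo, sub_zero]
      exact abs_sub_le_osc _ f _ _
    have h4 := mul_le_mul_of_nonneg_left h3 hb
    linarith

lemma fresh_sim {S : AddSubgroup X} {k : ℕ} {e : Fin k → X} {estar : Fin k → X →L[ℝ] ℝ}
    (hbi : ∀ l m, estar l (e m) = if l = m then 1 else 0) {a b B s τ : ℝ} (ha : 0 < a) (hb : 0 ≤ b)
    (hB : ∀ l, ‖estar l‖ ≤ B) (hB0 : 0 ≤ B) (hs : s = ∑ l, ‖e l‖) (hτ : 0 ≤ τ) (hτs : s * τ ≤ a / 2)
    {γ : Ordinal.{0}} : ∀ {ι κ : Type} [Fintype ι] [Fintype κ] {o : ι} {i : ι → κ} {j : Fin k → κ}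
    {μ : ι → Option (Fin k)} {T : (ι → ℝ) →ₗ[ℝ] X} {θ : ℝ} (_ : μ o = none)
    (_ : ∀ c, ∃ q : ι ⊕ Fin k, Sum.elim i j q = c)
    (_ : Good S a b γ ι o T) (_ : 0 ≤ θ) (_ : θ < τ)
    (_ : ∀ l g, |estar l (T g)| ≤ θ * osc o g),
    Good ⊤ ((1 + τ) * (2 * (1 + s * B) / a) + B)⁻¹ (s + 2 * b + 1) γ κ (i o)
      (freshT e o i j μ T) := by
  induction γ using WellFoundedLT.induction with
  | ind γ ih =>
  intro ι κ _ _ o i j μ T θ hμ hsurj hgood hθ0 hθτ hθ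
  have hg := (good_iff _ _ _ _ _ _ _).1 hgood
  rw [good_iff]
  refine ⟨fresh_bounds hbi ha hb hB hB0 hs hτ hτs hμ hsurj hg.1 (fun l g => (hθ l g).trans
    (mul_le_mul_of_nonneg_right hθτ.le (osc_nonneg _ _))), fun _ => trivial, ?_⟩
  intro γ' hγ k' ν
  choose q hq using fun n => hsurj (ν n)
  have hε : 0 < (τ - θ) / (2 * (2 * k' + 1)) := div_pos (by linarith) (by positivity)
  obtain ⟨z, hz, hzs⟩ := hgood.small hb hγ (fun n => Sum.elim id (fun _ => o) (q n)) estar hε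
  refine ⟨z, ?_⟩
  have hnew := ih γ' hγ (ι := ι ⊕ Fin k') (κ := κ ⊕ Fin k') (o := Sum.inl o) (i := Sum.map i id)
    (j := fun l => Sum.inl (j l)) (μ := Sum.elim μ (fun n => Sum.elim μ some (q n)))
    (T := extn T (fun n => Sum.elim id (fun _ => o) (q n)) z)
    (θ := θ + 2 * k' * ((τ - θ) / (2 * (2 * k' + 1)))) hμ (by
      rintro (c | n)
      · obtain ⟨r | r, rfl⟩ := hsurj c
        · exact ⟨Sum.inl (Sum.inl r), rfl⟩
        · exact ⟨Sum.inr r, rfl⟩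
      · exact ⟨Sum.inl (Sum.inr n), rfl⟩) hz (by
      have : 0 ≤ 2 * (k' : ℝ) * ((τ - θ) / (2 * (2 * k' + 1))) := by positivity
      linarith) (by
      have : 2 * (k' : ℝ) * ((τ - θ) / (2 * (2 * k' + 1))) < τ - θ := by
        rw [mul_div_assoc', div_lt_iff₀ (by positivity)]
        have : (0 : ℝ) ≤ k' := Nat.cast_nonneg _
        nlinarith
      linarith) (by
      intro l g
      rw [extn_apply, map_add, map_sum]
      have h1 : |estar l (T fun c => g (Sum.inl c))| ≤ θ * osc (Sum.inl o) g := by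
        refine (hθ l _).trans ?_
        exact mul_le_mul_of_nonneg_left (osc_comp_le _ _ _) hθ0
      have h2 : |∑ n, estar l ((g (Sum.inr n) - g (Sum.inl (Sum.elim id (fun _ => o) (q n)))) • z n)| ≤
          2 * k' * ((τ - θ) / (2 * (2 * k' + 1))) * osc (Sum.inl o) g := by
        refine (Finset.abs_sum_le_sum_abs _ _).trans ?_
        calc _ ≤ ∑ n : Fin k', (2 * osc (Sum.inl o) g) * ((τ - θ) / (2 * (2 * k' + 1))) := by
              refine Finset.sum_le_sum fun n _ => ?_
              rw [map_smul, smul_eq_mul, abs_mul]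
              exact mul_le_mul (abs_sub_le_osc _ _ _ _) (hzs n l) (abs_nonneg _)
                (mul_nonneg zero_le_two (osc_nonneg _ _))
          _ = _ := by simp; ring
      rw [add_mul]
      exact (abs_add_le _ _).trans (add_le_add h1 h2))
  have heq : extn (freshT e o i j μ T) ν z = freshT e (Sum.inl o) (Sum.map i id)
      (fun l => Sum.inl (j l)) (Sum.elim μ (fun n => Sum.elim μ some (q n)))
      (extn T (fun n => Sum.elim id (fun _ => o) (q n)) z) := by
    refine LinearMap.ext fun f => ?_
    rw [extn_apply, freshT_apply, freshT_apply, extn_apply, add_assoc]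
    congr 1
    have hel : ∀ m : Option (Fin k), (m.elim (Sum.inl (i o)) (fun l => Sum.inl (j l)) : κ ⊕ Fin k') =
        Sum.inl (m.elim (i o) j) := by
      rintro (_ | l) <;> rfl
    congr 1
    · congr 1
      ext a
      simp [hel]
    · refine Finset.sum_congr rfl fun n _ => ?_
      congr 1
      rw [← hq n]
      rcases hqn : q n with r | r
      · simp [hel, hqn]
      · simp [hel, hμ, hqn]
  rw [heq]
  exact hnew

lemma exists_biorth [CompleteSpace X] (hX : ¬ FiniteDimensional ℝ X) (k : ℕ) :
    ∃ (e : Fin k → X) (estar : Fin k → X →L[ℝ] ℝ),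
      ∀ l m, estar l (e m) = if l = m then 1 else 0 := by
  have hrank : (k : Cardinal) ≤ Module.rank ℝ X := by
    have : Cardinal.aleph0 ≤ Module.rank ℝ X := by
      rw [← not_lt]
      exact fun h => hX (Module.rank_lt_aleph0_iff.1 h)
    exact (Cardinal.natCast_le_aleph0).trans this
  obtain ⟨e, he⟩ := exists_linearIndependent_of_le_rank hrank
  let V := Submodule.span ℝ (Set.range e)
  let bs : Module.Basis (Fin k) ℝ V := Module.Basis.span he
  have : FiniteDimensional ℝ V := Module.Basis.finiteDimensional_of_finite bs
  choose φ hφ _ using fun l => exists_extension_norm_eq (𝕜 := ℝ) V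
    (LinearMap.toContinuousLinearMap (bs.coord l))
  refine ⟨e, φ, fun l m => ?_⟩
  have h1 := hφ l (bs m)
  have h2 : ((bs m : V) : X) = e m := by
    simp only [bs]
    rw [Module.Basis.span_apply]
  rw [h2] at h1
  rw [h1]
  simp [Finsupp.single_apply, eq_comm]

theorem fresh [CompleteSpace X] (hX : ¬ FiniteDimensional ℝ X) {S : AddSubgroup X} {a b : ℝ}
    (ha : 0 < a) (hb : 0 ≤ b) {γ : Ordinal.{0}} (h : Good S a b γ Unit () 0) (k : ℕ) :
    ∃ (e : Fin k → X) (a' b' : ℝ), 0 < a' ∧ 0 < b' ∧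
      Good ⊤ a' b' γ (Unit ⊕ Fin k) (Sum.inl ()) (extn 0 (fun _ => ()) e) := by
  obtain ⟨e, estar, hbi⟩ := exists_biorth hX k
  let B := ∑ l, ‖estar l‖
  let s := ∑ l, ‖e l‖
  have hs : 0 ≤ s := Finset.sum_nonneg fun _ _ => norm_nonneg _
  have hB : 0 ≤ B := Finset.sum_nonneg fun _ _ => norm_nonneg _
  let τ := a / (2 * (s + 1))
  have hτ : 0 < τ := by positivity
  have hτs : s * τ ≤ a / 2 := by
    simp only [τ]
    rw [mul_div_assoc', div_le_div_iff₀ (by positivity) (by positivity)]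
    nlinarith
  have := fresh_sim (S := S) hbi ha hb
    (fun l => Finset.single_le_sum (f := fun l => ‖estar l‖) (fun _ _ => norm_nonneg _)
      (Finset.mem_univ l)) hB rfl hτ.le hτs (γ := γ) (o := ()) (i := Sum.inl) (j := Sum.inr)
    (μ := fun _ : Unit => none) (T := 0) (θ := 0) (κ := Unit ⊕ Fin k) rfl (fun c => ⟨c, by
      rcases c with c | c <;> rfl⟩) h le_rfl hτ (by simp)
  have heq : extn (0 : (Unit → ℝ) →ₗ[ℝ] X) (fun _ : Fin k => ()) e =
      freshT e () Sum.inl Sum.inr (fun _ : Unit => none) 0 := by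
    refine LinearMap.ext fun f => ?_
    rw [extn_apply, freshT_apply]
    simp
  rw [← heq] at this
  exact ⟨e, _, _, by positivity, by positivity, this⟩

end Fresh
end JO


namespace JO
section Gain
variable {X : Type} [NormedAddCommGroup X] [NormedSpace ℝ X]

lemma extn_diff {β δ : ℝ} {k : ℕ} (hβ : 0 ≤ β) {ι : Type} [Fintype ι] {o : ι}
    {T T' : (ι → ℝ) →ₗ[ℝ] X} (hd : ∀ f, ‖T f - T' f‖ ≤ β * osc o f) (ν : Fin k → ι)
    {z z' : Fin k → X} (hz : ∀ n, ‖z n - z' n‖ ≤ δ) (f : ι ⊕ Fin k → ℝ) :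
    ‖extn T ν z f - extn T' ν z' f‖ ≤ (β + 2 * k * δ) * osc (Sum.inl o) f := by
  rw [extn_apply, extn_apply, add_sub_add_comm, ← Finset.sum_sub_distrib]
  refine (norm_add_le _ _).trans ?_
  rw [add_mul]
  refine add_le_add ((hd _).trans (mul_le_mul_of_nonneg_left (osc_comp_le _ _ _) hβ)) ?_
  refine (norm_sum_le _ _).trans ?_
  calc _ ≤ ∑ n : Fin k, (2 * osc (Sum.inl o) f) * δ := by
        refine Finset.sum_le_sum fun n _ => ?_
        rw [← smul_sub, norm_smul]
        exact mul_le_mul (abs_sub_le_osc _ _ _ _) (hz n) (norm_nonneg _)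
          (mul_nonneg zero_le_two (osc_nonneg _ _))
    _ = _ := by simp; ring

lemma extn_int {D : AddSubgroup X} {k : ℕ} {ι : Type} {T' : (ι → ℝ) →ₗ[ℝ] X}
    (hT : ∀ f : ι → ℤ, T' (fun c => (f c : ℝ)) ∈ D) (ν : Fin k → ι) {z' : Fin k → X}
    (hz : ∀ n, z' n ∈ D) (f : ι ⊕ Fin k → ℤ) : extn T' ν z' (fun c => (f c : ℝ)) ∈ D := by
  rw [extn_apply]
  refine D.add_mem (hT _) (D.sum_mem fun n _ => ?_)
  have : ((f (Sum.inr n) : ℝ) - f (Sum.inl (ν n))) • z' n =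
      (f (Sum.inr n) - f (Sum.inl (ν n))) • z' n := by
    rw [← Int.cast_sub, Int.cast_smul_eq_zsmul]
  rw [this]
  exact D.zsmul_mem (hz n) _

lemma perturb {D : AddSubgroup X} (hD : ∀ (x : X) (ε : ℝ), 0 < ε → ∃ d ∈ D, ‖x - d‖ ≤ ε) {b : ℝ}
    {γ : Ordinal.{0}} : ∀ {ι : Type} [Fintype ι] {o : ι} {T T' : (ι → ℝ) →ₗ[ℝ] X} {β : ℝ}
    (_ : Good ⊤ 1 b γ ι o T) (_ : ∀ f : ι → ℤ, T' (fun c => (f c : ℝ)) ∈ D) (_ : 0 ≤ β)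
    (_ : β < 1 / 2) (_ : ∀ f, ‖T f - T' f‖ ≤ β * osc o f), Good D (1 / 2) (b + 1 / 2) γ ι o T' := by
  induction γ using WellFoundedLT.induction with
  | ind γ ih =>
  intro ι _ o T T' β hg hT' hβ0 hβ hd
  rw [good_iff] at hg ⊢
  refine ⟨fun f => ?_, hT', fun γ' hγ k ν => ?_⟩
  · have h1 := hg.1 f
    have h2 := hd f
    have h3 := osc_nonneg o f
    have h4 := norm_sub_norm_le (T f) (T' f)
    have h5 := norm_sub_norm_le (T' f) (T f)
    rw [norm_sub_rev] at h5
    have h6 : β * osc o f ≤ 1 / 2 * osc o f := mul_le_mul_of_nonneg_right hβ.le h3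
    constructor <;> linarith [h1.1, h1.2]
  · obtain ⟨z, hz⟩ := hg.2.2 γ' hγ k ν
    have hδ : 0 < (1 / 2 - β) / (2 * (2 * k + 1)) := div_pos (by linarith) (by positivity)
    choose z' hz' hzz using fun n => hD (z n) _ hδ
    refine ⟨z', ih γ' hγ hz (extn_int hT' ν hz') ?_ ?_ (extn_diff hβ0 hd ν hzz)⟩
    · positivity
    · have : 2 * (k : ℝ) * ((1 / 2 - β) / (2 * (2 * k + 1))) < 1 / 2 - β := by
        rw [mul_div_assoc', div_lt_iff₀ (by positivity)]
        have : (0 : ℝ) ≤ k := Nat.cast_nonneg _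
        nlinarith
      linarith

theorem stable_rank (D : AddSubgroup X) (hDc : Countable D) (a b : ℝ) :
    ∃ γ : Ordinal.{0}, (Set.Iio γ).Countable ∧ ∀ (ι : Type) [Fintype ι] (o : ι)
      (T : (ι → ℝ) →ₗ[ℝ] X), Good D a b γ ι o T →
      ∀ γ' : Ordinal.{0}, (Set.Iio γ').Countable → Good D a b γ' ι o T := by
  classical
  let C := Σ n : ℕ, Fin n × (Fin n → D)
  let TC : (p : C) → (Fin p.1 → ℝ) →ₗ[ℝ] X := fun p => ∑ c,
    (LinearMap.proj (R := ℝ) (φ := fun _ : Fin p.1 => ℝ) c).smulRight (p.2.2 c : X)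
  have hTC : ∀ p f, TC p f = ∑ c, f c • (p.2.2 c : X) := by
    intro p f
    simp [TC, LinearMap.sum_apply]
  have hch : ∀ p : C, ∃ γ : Ordinal.{0}, (Set.Iio γ).Countable ∧
      ((∃ γ' : Ordinal.{0}, (Set.Iio γ').Countable ∧ ¬ Good D a b γ' (Fin p.1) p.2.1 (TC p)) →
        ¬ Good D a b γ (Fin p.1) p.2.1 (TC p)) := by
    intro p
    by_cases hp : ∃ γ' : Ordinal.{0}, (Set.Iio γ').Countable ∧
        ¬ Good D a b γ' (Fin p.1) p.2.1 (TC p)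
    · obtain ⟨γ', h1, h2⟩ := hp
      exact ⟨γ', h1, fun _ => h2⟩
    · exact ⟨0, by simp, fun h => absurd h hp⟩
  choose g hg hgn using hch
  have hbdd : BddAbove (Set.range g) := Ordinal.bddAbove_of_small
  refine ⟨⨆ p, g p, ?_, ?_⟩
  · refine (Set.countable_iUnion hg).mono ?_
    intro x hx
    have : ∃ p, x < g p := by
      by_contra hcon
      push Not at hcon
      exact absurd hx (not_lt.2 (Ordinal.iSup_le hcon))
    simpa using this
  · intro ι _ o T hT γ' hγ'
    let e := Fintype.equivFin ι
    have h1 := hT.merge e e.symm (by simp)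
    have hmem : ∀ c, mrg T e (Pi.single c 1) ∈ D := by
      intro c
      have := ((good_iff _ _ _ _ _ _ _).1 h1).2.1 (Pi.single c 1)
      convert this using 2
      ext d
      by_cases hdc : d = c
      · subst hdc; simp
      · simp [hdc]
    let p : C := ⟨Fintype.card ι, e o, fun c => ⟨_, hmem c⟩⟩
    have hp : TC p = mrg T e := by
      refine LinearMap.ext fun f => ?_
      rw [hTC]
      conv_rhs => rw [pi_eq_sum_univ' f]
      rw [map_sum]
      refine Finset.sum_congr rfl fun c _ => ?_
      rw [map_smul]
    have h2 : Good D a b γ' (Fin (Fintype.card ι)) (e o) (mrg T e) := by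
      by_contra hcon
      rw [← hp] at hcon h1
      exact hgn p ⟨γ', hγ', hcon⟩ (h1.mono (le_ciSup hbdd p))
    have h3 := h2.merge e.symm e (by simp)
    have e1 : e.symm (e o) = o := by simp
    have e2 : mrg (mrg T e) e.symm = T := by
      refine LinearMap.ext fun f => ?_
      simp [mrg_apply]
    rwa [e1, e2] at h3

variable [CompleteSpace X] {K : ℝ}

theorem rank_all (hX : ¬ FiniteDimensional ℝ X)
    (h : ∀ (V : Type) [NormedAddCommGroup V] [NormedSpace ℝ V] [CompleteSpace V],
      Nonempty (X ≃L[ℝ] V) → IsKElastic V K) (hK : 0 ≤ K)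
    {D : AddSubgroup X} (hD : ∀ (x : X) (ε : ℝ), 0 < ε → ∃ d ∈ D, ‖x - d‖ ≤ ε)
    {γ : Ordinal.{0}} (hγ : (Set.Iio γ).Countable) :
    Good D (1 / 2) (2 * K + 1 / 2) γ Unit () 0 := by
  induction γ using WellFoundedLT.induction with
  | ind γ ih =>
  have hosc : ∀ f : Unit → ℝ, osc () f = 0 := fun f =>
    le_antisymm (osc_le le_rfl (by simp)) (osc_nonneg _ _)
  rw [good_iff]
  refine ⟨fun f => by simp [hosc], fun _ => by simp, fun γ' hγ' k ν => ?_⟩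
  have hc' : (Set.Iio γ').Countable := hγ.mono (Set.Iio_subset_Iio hγ'.le)
  obtain ⟨e, a', b', ha', hb', hf⟩ := fresh hX (by norm_num) (by positivity) (ih γ' hγ' hc') k
  obtain ⟨F, hF⟩ := ee_exists ha' hb'.le hf
  obtain ⟨J, hJ⟩ := j_lift h hK (by positivity) hb' hc' hF
  have heq : (J : X →ₗ[ℝ] X) ∘ₗ extn (0 : (Unit → ℝ) →ₗ[ℝ] X) (fun _ : Fin k => ()) e =
      extn 0 ν (fun n => J (e n)) := by
    refine LinearMap.ext fun f => ?_
    simp [extn_apply]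
  rw [heq] at hJ
  have hδ : 0 < (1 : ℝ) / (4 * (2 * k + 1)) := by positivity
  choose z' hz' hzz using fun n => hD (J (e n)) _ hδ
  refine ⟨z', perturb hD hJ (extn_int (by simp) ν hz') (β := 0 + 2 * k * (1 / (4 * (2 * k + 1))))
    (by positivity) ?_ (extn_diff le_rfl (by simp) ν hzz)⟩
  rw [zero_add, mul_one_div, div_lt_iff₀ (by positivity)]
  have : (0 : ℝ) ≤ k := Nat.cast_nonneg _
  linarith

/-- The dyadic system. -/
theorem dyadic [TopologicalSpace.SeparableSpace X] (hX : ¬ FiniteDimensional ℝ X)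
    (h : ∀ (V : Type) [NormedAddCommGroup V] [NormedSpace ℝ V] [CompleteSpace V],
      Nonempty (X ≃L[ℝ] V) → IsKElastic V K) (hK : 0 ≤ K) :
    ∃ T : (n : ℕ) → ((Fin n → Bool) → ℝ) →ₗ[ℝ] X,
      (∀ n f, 1 / 2 * osc (fun _ => false) f ≤ ‖T n f‖ ∧
        ‖T n f‖ ≤ (2 * K + 1 / 2) * osc (fun _ => false) f) ∧
      ∀ n f, T (n + 1) (fun c => f (Fin.init c)) = T n f := by
  let D : AddSubgroup X := 
    (Finsupp.linearCombination ℤ (TopologicalSpace.denseSeq X)).toAddMonoidHom.range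
  have hDc : Countable D := by
    have : (D : Set X).Countable := Set.countable_range _
    exact this
  have hD : ∀ (x : X) (ε : ℝ), 0 < ε → ∃ d ∈ D, ‖x - d‖ ≤ ε := by
    intro x ε hε
    obtain ⟨n, hn⟩ := (TopologicalSpace.denseRange_denseSeq X).exists_dist_lt x hε
    refine ⟨_, ⟨Finsupp.single n 1, by simp; rfl⟩, ?_⟩
    rw [← dist_eq_norm]
    exact hn.le
  obtain ⟨γ, hγ, hst⟩ := stable_rank D hDc (1 / 2) (2 * K + 1 / 2)
  let P : (n : ℕ) → (((Fin n → Bool) → ℝ) →ₗ[ℝ] X) → Prop := fun n T =>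
    Good D (1 / 2) (2 * K + 1 / 2) γ (Fin n → Bool) (fun _ => false) T
  have h0 : ∃ T, P 0 T := by
    have := (rank_all hX h hK hD hγ).merge (κ := Fin 0 → Bool) (fun _ => fun _ => false)
      (fun _ => ()) (fun c => Subsingleton.elim _ _)
    exact ⟨_, this⟩
  have hstep : ∀ n T, P n T → ∃ T', P (n + 1) T' ∧ ∀ f, T' (fun c => f (Fin.init c)) = T f := by
    intro n T hT
    have hcs : (Set.Iio (Order.succ γ)).Countable := by
      rw [Order.Iio_succ_eq_insert]
      exact hγ.insert _
    obtain ⟨z, hz⟩ := (hst _ _ _ hT _ hcs).request (Order.lt_succ γ) (N := Fin n → Bool) id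
    let σ : (Fin n → Bool) ⊕ (Fin n → Bool) → (Fin (n + 1) → Bool) :=
      Sum.elim (fun c => Fin.snoc c false) (fun c => Fin.snoc c true)
    have h1 := hz.merge σ (fun c => bif c (Fin.last n) then Sum.inr (Fin.init c)
      else Sum.inl (Fin.init c)) (by
        intro c
        cases hc : c (Fin.last n)
        · simp only [cond_false, σ, Sum.elim_inl]
          rw [← hc]; exact Fin.snoc_init_self c
        · simp only [cond_true, σ, Sum.elim_inr]
          rw [← hc]; exact Fin.snoc_init_self c)
    have ho : σ (Sum.inl (fun _ => false)) = fun _ => false := by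
      ext i
      refine Fin.lastCases ?_ (fun i => ?_) i
      · simp [σ]
      · simp [σ]
    rw [ho] at h1
    refine ⟨_, h1, fun f => ?_⟩
    rw [mrg_apply, ← extn_elim T id z f]
    congr 1
    ext c
    rcases c with c | c <;> simp [σ, Fin.init_snoc]
  choose! nx hnx hnx' using hstep
  obtain ⟨T₀, hT₀⟩ := h0
  let T : (n : ℕ) → ((Fin n → Bool) → ℝ) →ₗ[ℝ] X := fun n => Nat.rec T₀ (fun n T => nx n T) n
  have hT : ∀ n, P n (T n) := by
    intro n
    induction n with
    | zero => exact hT₀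
    | succ n ih => exact hnx n _ ih
  exact ⟨T, fun n f => ((good_iff _ _ _ _ _ _ _).1 (hT n)).1 f, fun n f => hnx' n _ (hT n) f⟩

end Gain
end JO


namespace JO
section Tree

/-- extend a finite word by `false` -/
def hat {n : ℕ} (c : Fin n → Bool) : ℕ → Bool := fun i => if h : i < n then c ⟨i, h⟩ else false

lemma hat_of_lt {n : ℕ} (u : ℕ → Bool) {i : ℕ} (h : i < n) :
    hat (fun j : Fin n => u j) i = u i := by simp [hat, h]

lemma hat_init {n : ℕ} (c : Fin (n + 1) → Bool) {i : ℕ} (h : i < n) :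
    hat (Fin.init c) i = hat c i := by
  simp [hat, h, show i < n + 1 by omega, Fin.init]

open Classical in
/-- indicator of the cylinder given by the first `n` letters of `t` (after a leading `true`) -/
noncomputable def cyl (t : ℕ → Bool) (n : ℕ) (u : ℕ → Bool) : ℝ :=
  if u 0 = true ∧ ∀ i < n, u (i + 1) = t i then 1 else 0

lemma cyl_false (t : ℕ → Bool) (n : ℕ) (u : ℕ → Bool) (h : u 0 = false) : cyl t n u = 0 := by
  simp [cyl, h]

lemma cyl_congr (t : ℕ → Bool) (n m : ℕ) (hm : n < m) (u v : ℕ → Bool) (h : ∀ i < m, u i = v i) :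
    cyl t n u = cyl t n v := by
  have : (u 0 = true ∧ ∀ i < n, u (i + 1) = t i) ↔ (v 0 = true ∧ ∀ i < n, v (i + 1) = t i) := by
    rw [h 0 (by omega)]
    refine and_congr_right fun _ => forall₂_congr fun i hi => ?_
    rw [h (i + 1) (by omega)]
  simp [cyl, this]

lemma sum_initial (lam : ℕ → ℝ) (p : ℕ → Prop) [DecidablePred p] (hp : ∀ n, p (n + 1) → p n)
    (N : ℕ) : ∃ m ≤ N, ∑ n ∈ Finset.range N, (if p n then lam n else 0) =
      ∑ n ∈ Finset.range m, lam n := by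
  have hp' : ∀ d n, p (n + d) → p n := by
    intro d
    induction d with
    | zero => exact fun n h => h
    | succ d ih => exact fun n h => ih n (hp _ h)
  induction N with
  | zero => exact ⟨0, le_rfl, by simp⟩
  | succ N ih =>
    by_cases hN : p N
    · refine ⟨N + 1, le_rfl, Finset.sum_congr rfl fun n hn => ?_⟩
      have : p n := hp' (N - n) n (by
        have := Finset.mem_range.1 hn
        rwa [show n + (N - n) = N by omega])
      simp [this]
    · obtain ⟨m, hm, he⟩ := ih
      exact ⟨m, by omega, by rw [Finset.sum_range_succ, he]; simp [hN]⟩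

variable {X : Type} [NormedAddCommGroup X] [NormedSpace ℝ X]

theorem tree_facts {a b : ℝ} (hb : 0 ≤ b) (T : (n : ℕ) → ((Fin n → Bool) → ℝ) →ₗ[ℝ] X)
    (hT : ∀ n f, a * osc (fun _ => false) f ≤ ‖T n f‖ ∧ ‖T n f‖ ≤ b * osc (fun _ => false) f)
    (hst : ∀ n f, T (n + 1) (fun c => f (Fin.init c)) = T n f) (ha : 0 ≤ a) :
    ∃ x : (ℕ → Bool) → ℕ → X,
      (∀ t N (lam : ℕ → ℝ), a * |∑ n ∈ Finset.range N, lam n| ≤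
        ‖∑ n ∈ Finset.range N, lam n • x t n‖) ∧
      (∀ t N (lam : ℕ → ℝ), (∀ m ≤ N, |∑ n ∈ Finset.range m, lam n| ≤ 1) →
        ‖∑ n ∈ Finset.range N, lam n • x t n‖ ≤ b) ∧
      (∀ u : Finset (ℕ → Bool), ∃ n₀, ∀ n ≥ n₀, ∀ ε : (ℕ → Bool) → ℝ, (∀ t, |ε t| ≤ 1) →
        ‖∑ t ∈ u, ε t • x t n‖ ≤ b) := by
  classical
  have hlift : ∀ n (G : (ℕ → Bool) → ℝ), (∀ u v : ℕ → Bool, (∀ i < n, u i = v i) → G u = G v) →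
      ∀ d, T (n + d) (fun c => G (hat c)) = T n (fun c => G (hat c)) := by
    intro n G hG d
    induction d with
    | zero => rfl
    | succ d ih =>
      rw [← ih, ← hst (n + d), ← add_assoc]
      congr 1
      ext c
      exact hG _ _ fun i hi => (hat_init c (by omega)).symm
  let x : (ℕ → Bool) → ℕ → X := fun t n => T (n + 1) (fun c => cyl t n (hat c))
  have hx : ∀ t n N, n < N → x t n = T N (fun c => cyl t n (hat c)) := by
    intro t n N h
    obtain ⟨d, rfl⟩ := Nat.exists_eq_add_of_lt h
    have := hlift (n + 1) (cyl t n) (fun u v huv => cyl_congr t n (n + 1) (by omega) u v huv) d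
    simp only [x]
    rw [← this, show n + d + 1 = n + 1 + d by omega]
  have hfalse : ∀ N, hat (fun _ : Fin N => false) 0 = false := by
    intro N
    simp [hat]
  have hup : ∀ N (g : (ℕ → Bool) → ℝ), (∀ u, u 0 = false → g u = 0) → (∀ u, |g u| ≤ 1) →
      ‖T N (fun c => g (hat c))‖ ≤ b := by
    intro N g hg0 hg1
    refine (hT N _).2.trans ?_
    calc _ ≤ b * 1 := mul_le_mul_of_nonneg_left (osc_le zero_le_one fun c => by
            rw [hg0 _ (hfalse N), sub_zero]; exact hg1 _) hb
      _ = b := mul_one b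
  have hsum : ∀ t N (lam : ℕ → ℝ), ∑ n ∈ Finset.range N, lam n • x t n =
      T N (fun c => ∑ n ∈ Finset.range N, lam n * cyl t n (hat c)) := by
    intro t N lam
    have : (fun c : Fin N → Bool => ∑ n ∈ Finset.range N, lam n * cyl t n (hat c)) =
        ∑ n ∈ Finset.range N, lam n • (fun c : Fin N → Bool => cyl t n (hat c)) := by
      ext c
      simp [Finset.sum_apply]
    rw [this, map_sum]
    refine Finset.sum_congr rfl fun n hn => ?_
    rw [map_smul, hx t n N (Finset.mem_range.1 hn)]
  refine ⟨x, ?_, ?_, ?_⟩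
  · intro t N lam
    rw [hsum]
    refine le_trans ?_ (hT N _).1
    refine mul_le_mul_of_nonneg_left ?_ ha
    refine le_trans ?_ (le_osc _ _ (fun j : Fin N => (fun i => if i = 0 then true else t (i - 1)) (j : ℕ)))
    refine le_of_eq ?_
    congr 1
    rw [← Finset.sum_sub_distrib]
    refine Finset.sum_congr rfl fun n hn => ?_
    have hn' := Finset.mem_range.1 hn
    rw [cyl_false _ _ _ (hfalse N), mul_zero, sub_zero]
    have h1 : cyl t n (hat (fun j : Fin N => (fun i => if i = 0 then true else t (i - 1)) (j : ℕ))) = 1 := by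
      rw [cyl_congr t n (n + 1) (by omega) _ (fun i => if i = 0 then true else t (i - 1))
        (fun i hi => hat_of_lt (fun i => if i = 0 then true else t (i - 1)) (by omega))]
      simp [cyl]
    rw [h1, mul_one]
  · intro t N lam hlam
    rw [hsum]
    refine hup N (fun u => ∑ n ∈ Finset.range N, lam n * cyl t n u) ?_ ?_
    · intro u hu
      simp [cyl_false _ _ _ hu]
    · intro u
      obtain ⟨m, hm, he⟩ := sum_initial lam (fun n => u 0 = true ∧ ∀ i < n, u (i + 1) = t i)
        (fun n hn => ⟨hn.1, fun i hi => hn.2 i (by omega)⟩) N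
      have : ∑ n ∈ Finset.range N, lam n * cyl t n u = ∑ n ∈ Finset.range m, lam n := by
        rw [← he]
        refine Finset.sum_congr rfl fun n _ => ?_
        simp [cyl]
      rw [this]
      exact hlam m hm
  · intro u
    have hsep : ∀ t t' : ℕ → Bool, ∃ n, t ≠ t' → ∃ i < n, t i ≠ t' i := by
      intro t t'
      by_cases h : t = t'
      · exact ⟨0, fun h' => absurd h h'⟩
      · obtain ⟨i, hi⟩ := Function.ne_iff.1 h
        exact ⟨i + 1, fun _ => ⟨i, by omega, hi⟩⟩
    choose sp hsp using hsep
    refine ⟨u.sup fun t => u.sup fun t' => sp t t', fun n hn ε hε => ?_⟩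
    have hs : ∑ t ∈ u, ε t • x t n = T (n + 1) (fun c => ∑ t ∈ u, ε t * cyl t n (hat c)) := by
      have : (fun c : Fin (n + 1) → Bool => ∑ t ∈ u, ε t * cyl t n (hat c)) =
          ∑ t ∈ u, ε t • (fun c : Fin (n + 1) → Bool => cyl t n (hat c)) := by
        ext c
        simp [Finset.sum_apply]
      rw [this, map_sum]
      simp [x]
    rw [hs]
    refine hup (n + 1) (fun v => ∑ t ∈ u, ε t * cyl t n v) ?_ ?_
    · intro v hv
      simp [cyl_false _ _ _ hv]
    · intro v
      by_cases hex : ∃ t ∈ u, cyl t n v ≠ 0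
      · obtain ⟨t, ht, htv⟩ := hex
        rw [Finset.sum_eq_single_of_mem t ht]
        · rw [abs_mul]
          have : |cyl t n v| ≤ 1 := by
            unfold cyl; split_ifs <;> simp
          exact mul_le_one₀ (hε t) (abs_nonneg _) this
        · intro t' ht' hne
          by_contra hcon
          have hc' : cyl t' n v ≠ 0 := fun h => hcon (by simp [h])
          obtain ⟨i, hi, hii⟩ := hsp t' t hne
          have hle : sp t' t ≤ n := le_trans (le_trans
            (Finset.le_sup (f := fun t => sp t' t) ht)
            (Finset.le_sup (f := fun t => u.sup fun t' => sp t t') ht')) hn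
          unfold cyl at htv hc'
          simp only [ne_eq, ite_eq_right_iff, one_ne_zero, imp_false, not_not] at htv hc'
          exact hii ((hc'.2 i (by omega)).symm.trans (htv.2 i (by omega)))
      · push Not at hex
        rw [Finset.sum_eq_zero fun t ht => by rw [hex t ht, mul_zero]]
        simp

end Tree
end JO


namespace JO
section Final

open Filter Topology

variable {X : Type} [NormedAddCommGroup X] [NormedSpace ℝ X]

lemma nets (e : ℕ → X) : ∃ Q : ℕ → Finset (X →L[ℝ] ℝ), (∀ r, ∀ ψ ∈ Q r, ‖ψ‖ ≤ 1) ∧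
    ∀ r (τ : X →L[ℝ] ℝ), ‖τ‖ ≤ 1 → ∃ ψ ∈ Q r, ∀ i < r, |ψ (e i) - τ (e i)| ≤ 1 / ((r : ℝ) + 1) := by
  classical
  have H : ∀ r : ℕ, ∃ Q : Finset (X →L[ℝ] ℝ), (∀ ψ ∈ Q, ‖ψ‖ ≤ 1) ∧
      ∀ (τ : X →L[ℝ] ℝ), ‖τ‖ ≤ 1 →
        ∃ ψ ∈ Q, ∀ i < r, |ψ (e i) - τ (e i)| ≤ 1 / ((r : ℝ) + 1) := by
    intro r
    obtain ⟨t, ht, hcov⟩ := dual_compact (ι := Unit) (X := X) 1 ∅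
      (fun _ => (Finset.range r).image e) (fun _ => 1 / ((r : ℝ) + 1)) (fun _ => by positivity)
    refine ⟨t.image fun F => F (), ?_, ?_⟩
    · intro ψ hψ
      obtain ⟨F, hF, rfl⟩ := Finset.mem_image.1 hψ
      exact (ht F hF).1 ()
    · intro τ hτ
      obtain ⟨F, hF, hc⟩ := hcov (fun _ => τ) (fun _ => hτ) (by simp)
      refine ⟨F (), Finset.mem_image_of_mem _ hF, fun i hi => ?_⟩
      rw [abs_sub_comm]
      exact (hc () (e i) (Finset.mem_image_of_mem _ (Finset.mem_range.2 hi))).le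
  choose Q h1 h2 using H
  exact ⟨Q, h1, h2⟩

lemma dens {e : ℕ → X} (he : DenseRange e) (v : X) {δ : ℝ} (hδ : 0 < δ) :
    ∃ R : ℕ, ∀ r ≥ R, ∀ f g : X →L[ℝ] ℝ, ‖f‖ ≤ 1 → ‖g‖ ≤ 1 →
      (∀ i < r, |f (e i) - g (e i)| ≤ 2 / ((r : ℝ) + 1)) → |f v - g v| ≤ δ := by
  obtain ⟨i, hi⟩ := he.exists_dist_lt v (show 0 < δ / 4 by positivity)
  obtain ⟨R, hR⟩ := exists_nat_gt (4 / δ)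
  refine ⟨max R (i + 1), fun r hr f g hf hg h => ?_⟩
  have hr1 : R ≤ r := le_trans (le_max_left _ _) hr
  have hr2 : i < r := lt_of_lt_of_le (Nat.lt_succ_self i) (le_trans (le_max_right _ _) hr)
  have h1 := h i hr2
  have h2 : 2 / ((r : ℝ) + 1) ≤ δ / 2 := by
    have : (R : ℝ) ≤ r := by exact_mod_cast hr1
    have h3 : 4 / δ < (r : ℝ) + 1 := by linarith
    rw [div_lt_iff₀ hδ] at h3
    rw [div_le_iff₀ (by positivity)]
    linarith
  have h3 : |f (v - e i)| ≤ δ / 4 := by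
    have := f.le_opNorm (v - e i)
    rw [dist_eq_norm] at hi
    rw [Real.norm_eq_abs] at this
    nlinarith [norm_nonneg (v - e i), norm_nonneg f]
  have h4 : |g (v - e i)| ≤ δ / 4 := by
    have := g.le_opNorm (v - e i)
    rw [dist_eq_norm] at hi
    rw [Real.norm_eq_abs] at this
    nlinarith [norm_nonneg (v - e i), norm_nonneg g]
  rw [map_sub] at h3 h4
  rw [abs_le] at *
  constructor <;> linarith [h1.1, h1.2, h3.1, h3.2, h4.1, h4.2]

/-- alternating sums are bounded -/
lemma alt_bound {b : ℝ} {x : ℕ → X}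
    (F2 : ∀ N (lam : ℕ → ℝ), (∀ m ≤ N, |∑ n ∈ Finset.range m, lam n| ≤ 1) →
        ‖∑ n ∈ Finset.range N, lam n • x n‖ ≤ b)
    (p q : ℕ → ℕ) (hpq : ∀ i, p i ≤ q i) (hqp : ∀ i, q i < p (i + 1)) (L : ℕ) :
    ‖∑ i ∈ Finset.range L, (x (p i) - x (q i))‖ ≤ b := by
  classical
  let lam : ℕ → ℝ := fun n => ∑ i ∈ Finset.range L,
    ((if p i = n then (1 : ℝ) else 0) - (if q i = n then (1 : ℝ) else 0))
  obtain ⟨N, hN⟩ : ∃ N, ∀ i < L, q i < N := by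
    refine ⟨(Finset.range L).sup q + 1, fun i hi => ?_⟩
    exact Nat.lt_succ_of_le (Finset.le_sup (f := q) (Finset.mem_range.2 hi))
  have h := F2 N lam (by
    intro m _
    have h1 : ∑ n ∈ Finset.range m, lam n = ∑ i ∈ Finset.range L,
        ((if p i < m then (1 : ℝ) else 0) - (if q i < m then (1 : ℝ) else 0)) := by
      simp only [lam]
      rw [Finset.sum_comm]
      refine Finset.sum_congr rfl fun i _ => ?_
      rw [Finset.sum_sub_distrib, Finset.sum_ite_eq, Finset.sum_ite_eq]
      simp
    have h2 : ∀ L : ℕ, (0 ≤ ∑ i ∈ Finset.range L,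
        ((if p i < m then (1 : ℝ) else 0) - (if q i < m then (1 : ℝ) else 0)) ∧
        ∑ i ∈ Finset.range L,
        ((if p i < m then (1 : ℝ) else 0) - (if q i < m then (1 : ℝ) else 0)) ≤ 1) ∧
        (p L < m → ∑ i ∈ Finset.range L,
        ((if p i < m then (1 : ℝ) else 0) - (if q i < m then (1 : ℝ) else 0)) = 0) := by
      intro L
      induction L with
      | zero => simp
      | succ L ih =>
        rw [Finset.sum_range_succ]
        have e1 := hpq L
        have e2 := hqp L
        obtain ⟨⟨i1, i2⟩, i3⟩ := ih
        by_cases c1 : p L < m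
        · rw [i3 c1]
          by_cases c2 : q L < m
          · simp [c1, c2]
          · refine ⟨by simp [c1, c2], fun c3 => absurd (lt_trans e2 c3) c2⟩
        · have c2 : ¬ q L < m := by omega
          rw [if_neg c1, if_neg c2]
          exact ⟨⟨by linarith, by linarith⟩, fun c3 => by omega⟩
    rw [h1, abs_le]
    have := (h2 L).1
    constructor <;> linarith [this.1, this.2])
  have h3 : ∑ n ∈ Finset.range N, lam n • x n = ∑ i ∈ Finset.range L, (x (p i) - x (q i)) := by
    simp only [lam, Finset.sum_smul]
    rw [Finset.sum_comm]
    refine Finset.sum_congr rfl fun i hi => ?_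
    have hq := hN i (Finset.mem_range.1 hi)
    have hp := lt_of_le_of_lt (hpq i) hq
    simp only [sub_smul, ite_smul, one_smul, zero_smul]
    rw [Finset.sum_sub_distrib, Finset.sum_ite_eq, Finset.sum_ite_eq]
    simp [hp, hq]
  rw [← h3]
  exact h

/-- averages have norm at least `a` -/
lemma avg_bound {a : ℝ} {x : ℕ → X}
    (F1 : ∀ N (lam : ℕ → ℝ), a * |∑ n ∈ Finset.range N, lam n| ≤
        ‖∑ n ∈ Finset.range N, lam n • x n‖) (p : ℕ → ℕ) (L : ℕ) :
    a * L ≤ ‖∑ i ∈ Finset.range L, x (p i)‖ := by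
  classical
  let lam : ℕ → ℝ := fun n => ∑ i ∈ Finset.range L, (if p i = n then (1 : ℝ) else 0)
  obtain ⟨N, hN⟩ : ∃ N, ∀ i < L, p i < N := by
    refine ⟨(Finset.range L).sup p + 1, fun i hi => ?_⟩
    exact Nat.lt_succ_of_le (Finset.le_sup (f := p) (Finset.mem_range.2 hi))
  have h := F1 N lam
  have h3 : ∑ n ∈ Finset.range N, lam n • x n = ∑ i ∈ Finset.range L, x (p i) := by
    simp only [lam, Finset.sum_smul]
    rw [Finset.sum_comm]
    refine Finset.sum_congr rfl fun i hi => ?_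
    have hp := hN i (Finset.mem_range.1 hi)
    simp only [ite_smul, one_smul, zero_smul]
    rw [Finset.sum_ite_eq]
    simp [hp]
  have h1 : ∑ n ∈ Finset.range N, lam n = L := by
    simp only [lam]
    rw [Finset.sum_comm]
    rw [Finset.sum_congr rfl (g := fun _ => (1 : ℝ))]
    · simp
    · intro i hi
      rw [Finset.sum_ite_eq]
      simp [hN i (Finset.mem_range.1 hi)]
  rw [h3, h1, abs_of_nonneg (by positivity)] at h
  exact h

/-- step one: functionals which are large on a whole tail -/
lemma tail_large {a b K : ℝ} (ha : 0 < a) (hK : 0 ≤ K) {x : ℕ → X}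
    (F1 : ∀ N (lam : ℕ → ℝ), a * |∑ n ∈ Finset.range N, lam n| ≤
        ‖∑ n ∈ Finset.range N, lam n • x n‖)
    (F2 : ∀ N (lam : ℕ → ℝ), (∀ m ≤ N, |∑ n ∈ Finset.range m, lam n| ≤ 1) →
        ‖∑ n ∈ Finset.range N, lam n • x n‖ ≤ b)
    (Φ : Set (X →L[ℝ] ℝ)) (hsym : ∀ φ ∈ Φ, -φ ∈ Φ) (J : X →L[ℝ] X)
    (hJ : ∀ x, (∀ φ ∈ Φ, |φ (J x)| ≤ K * ‖x‖) ∧ ∀ C, (∀ φ ∈ Φ, |φ (J x)| ≤ C) → ‖x‖ ≤ C) :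
    ∃ p, ∀ q, ∃ φ ∈ Φ, ∀ n, p ≤ n → n ≤ q → a / 2 ≤ φ (J (x n)) := by
  by_contra hcon
  push Not at hcon
  choose q hq using hcon
  have hpq0 : ∀ p, p ≤ max p (q p) := fun p => le_max_left _ _
  let p : ℕ → ℕ := fun i => Nat.rec 0 (fun _ s => max s (q s) + 1) i
  have hps : ∀ i, p (i + 1) = max (p i) (q (p i)) + 1 := fun i => rfl
  obtain ⟨L, hL⟩ := exists_nat_gt (K * b / (a / 4))
  have hL' : K * b < a / 4 * L := by
    rw [div_lt_iff₀ (by positivity)] at hL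
    linarith
  have hbb : 0 ≤ b := le_trans (norm_nonneg _) (F2 0 (fun _ => 0) (by simp))
  have hLpos : 0 < (L : ℝ) := by
    by_contra hn
    have : (L : ℝ) ≤ 0 := not_lt.1 hn
    nlinarith [mul_nonneg hK hbb]
  set v := ∑ i ∈ Finset.range L, x (p i) with hv
  have hav := avg_bound F1 p L
  obtain ⟨φ, hφ, hbig⟩ : ∃ φ ∈ Φ, 3 / 4 * a * L < φ (J v) := by
    by_contra hn
    push Not at hn
    have := (hJ v).2 (3 / 4 * a * L) (fun φ hφ => abs_le.2 ⟨by
      have := hn _ (hsym φ hφ)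
      simp only [neg_apply] at this
      linarith, hn φ hφ⟩)
    have h2 : 0 < a * L := by positivity
    linarith
  choose n hn1 hn2 hn3 using fun i => hq (p i) φ hφ
  have h1 := alt_bound F2 p n hn1 (fun i => by
    rw [hps]; exact Nat.lt_succ_of_le (le_trans (hn2 i) (le_max_right _ _))) L
  have h2 := (hJ (∑ i ∈ Finset.range L, (x (p i) - x (n i)))).1 φ hφ
  have h3 : φ (J (∑ i ∈ Finset.range L, (x (p i) - x (n i)))) =
      φ (J v) - ∑ i ∈ Finset.range L, φ (J (x (n i))) := by
    rw [Finset.sum_sub_distrib]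
    simp [hv, map_sum]
  have h4 : ∑ i ∈ Finset.range L, φ (J (x (n i))) ≤ ∑ i ∈ Finset.range L, a / 2 :=
    Finset.sum_le_sum fun i _ => (hn3 i).le
  simp only [Finset.sum_const, Finset.card_range, nsmul_eq_mul] at h4
  have h5 := le_trans (le_abs_self _) h2
  rw [h3] at h5
  nlinarith [mul_le_mul_of_nonneg_left h1 hK]

lemma weak_limit (U : Ultrafilter ℕ) (ψ : ℕ → X →L[ℝ] ℝ) (h : ∀ q, ‖ψ q‖ ≤ 1) :
    ∃ g : X →L[ℝ] ℝ, ‖g‖ ≤ 1 ∧ ∀ v, Tendsto (fun q => ψ q v) U (𝓝 (g v)) := by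
  have hC := WeakDual.isCompact_closedBall (𝕜 := ℝ) (E := X) 0 1
  obtain ⟨g, hg, hle⟩ := hC.ultrafilter_le_nhds (U.map fun q => StrongDual.toWeakDual (ψ q)) (by
    simp only [Ultrafilter.coe_map, le_principal_iff, mem_map]
    refine Filter.univ_mem' fun q => ?_
    simpa using h q)
  refine ⟨WeakDual.toStrongDual g, by simpa using hg, fun v => ?_⟩
  exact ((WeakDual.eval_continuous (𝕜 := ℝ) (E := X) v).tendsto g).comp hle

end Final
end JO


namespace JO
section Final2

open Filter Topology

variable {X : Type} [NormedAddCommGroup X] [NormedSpace ℝ X]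

/-- chains of net elements -/
def Chain (e : ℕ → X) (Q : ℕ → Finset (X →L[ℝ] ℝ)) (r : ℕ → ℕ) (ψ : ℕ → X →L[ℝ] ℝ) : Prop :=
  (∀ j, ψ j ∈ Q (r j)) ∧ ∀ j, ∀ i < r j, |ψ j (e i) - ψ (j + 1) (e i)| ≤ 2 / ((r j : ℝ) + 1)

/-- the alternating functionals -/
def PhiSet (e : ℕ → X) (Q : ℕ → Finset (X →L[ℝ] ℝ)) (N : ℕ) : Set (X →L[ℝ] ℝ) :=
  {φ | ∃ (r : ℕ → ℕ) (ψ : ℕ → X →L[ℝ] ℝ) (m : ℕ) (s : ℝ), Chain e Q r ψ ∧ m ≤ N ∧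
    (s = 1 ∨ s = -1) ∧ φ = s • ∑ j ∈ Finset.range m, (-1 : ℝ) ^ j • ψ j}

lemma phi_neg {e : ℕ → X} {Q : ℕ → Finset (X →L[ℝ] ℝ)} {N : ℕ} :
    ∀ φ ∈ PhiSet e Q N, -φ ∈ PhiSet e Q N := by
  rintro φ ⟨r, ψ, m, s, h1, h2, h3, rfl⟩
  refine ⟨r, ψ, m, -s, h1, h2, ?_, by ext v; simp⟩
  rcases h3 with rfl | rfl
  · right; rfl
  · left; simp

lemma phi_norm {e : ℕ → X} {Q : ℕ → Finset (X →L[ℝ] ℝ)} (hQ : ∀ r, ∀ ψ ∈ Q r, ‖ψ‖ ≤ 1) {N : ℕ} :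
    ∀ φ ∈ PhiSet e Q N, ‖φ‖ ≤ N := by
  rintro φ ⟨r, ψ, m, s, h1, h2, h3, rfl⟩
  have hs : ‖s‖ = 1 := by rcases h3 with rfl | rfl <;> simp
  rw [norm_smul, hs, one_mul]
  refine (norm_sum_le _ _).trans ?_
  have : ∑ j ∈ Finset.range m, ‖(-1 : ℝ) ^ j • ψ j‖ ≤ ∑ j ∈ Finset.range m, (1 : ℝ) := by
    refine Finset.sum_le_sum fun j _ => ?_
    rw [norm_smul]
    simpa using hQ _ _ (h1.1 j)
  refine this.trans ?_
  simpa using h2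

lemma phi_norming {e : ℕ → X} (he : DenseRange e) {Q : ℕ → Finset (X →L[ℝ] ℝ)}
    (hQ : ∀ r, ∀ ψ ∈ Q r, ‖ψ‖ ≤ 1)
    (hQ2 : ∀ r (τ : X →L[ℝ] ℝ), ‖τ‖ ≤ 1 →
      ∃ ψ ∈ Q r, ∀ i < r, |ψ (e i) - τ (e i)| ≤ 1 / ((r : ℝ) + 1)) {N : ℕ} (hN : 1 ≤ N) (v : X) :
    ∃ φ ∈ PhiSet e Q N, 1 / 2 * ‖v‖ ≤ |φ v| := by
  obtain ⟨g, hg, hgv⟩ := exists_dual_vector'' ℝ v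
  obtain ⟨R, hR⟩ : ∃ R : ℕ, ∀ r ≥ R, ∀ f g : X →L[ℝ] ℝ, ‖f‖ ≤ 1 → ‖g‖ ≤ 1 →
      (∀ i < r, |f (e i) - g (e i)| ≤ 2 / ((r : ℝ) + 1)) → |f v - g v| ≤ 1 / 2 * ‖v‖ := by
    by_cases hv : v = 0
    · exact ⟨0, by simp [hv]⟩
    · exact dens he v (by have := norm_pos_iff.2 hv; positivity)
  choose ψ h1 h2 using fun j => hQ2 (R + j) g hg
  refine ⟨ψ 0, ⟨fun j => R + j, ψ, 1, 1, ⟨h1, fun j i hi => ?_⟩, hN, Or.inl rfl, by simp⟩, ?_⟩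
  · change i < R + j at hi
    change _ ≤ 2 / (((R + j : ℕ) : ℝ) + 1)
    have a1 := h2 j i hi
    have a2 := h2 (j + 1) i (by omega)
    have a3 : 1 / (((R + (j + 1) : ℕ) : ℝ) + 1) ≤ 1 / (((R + j : ℕ) : ℝ) + 1) := by
      apply one_div_le_one_div_of_le (by positivity)
      push_cast
      linarith
    have a4 : 2 / (((R + j : ℕ) : ℝ) + 1) = 1 / (((R + j : ℕ) : ℝ) + 1) +
      1 / (((R + j : ℕ) : ℝ) + 1) := by ring
    rw [a4]
    rw [abs_le] at *
    constructor <;> linarith [a1.1, a1.2, a2.1, a2.2]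
  · have := hR (R + 0) (by simp) (ψ 0) g (hQ _ _ (h1 0)) hg (fun i hi => (h2 0 i hi).trans (by
      apply div_le_div_of_nonneg_right (by norm_num) (by positivity)))
    have hgv' : g v = ‖v‖ := by simpa using hgv
    rw [hgv', abs_le] at this
    refine le_trans ?_ (le_abs_self _)
    linarith [this.1]

/-- Only countably many branches are charged by a given functional. -/
lemma charged_countable {b : ℝ} (V : Ultrafilter ℕ) (hV : (V : Filter ℕ) ≤ atTop)
    {x : (ℕ → Bool) → ℕ → X}
    (F3 : ∀ u : Finset (ℕ → Bool), ∃ n₀, ∀ n ≥ n₀, ∀ ε : (ℕ → Bool) → ℝ, (∀ t, |ε t| ≤ 1) →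
        ‖∑ t ∈ u, ε t • x t n‖ ≤ b) (d : X →L[ℝ] ℝ) :
    {t | ¬ Tendsto (fun n => d (x t n)) V (𝓝 0)}.Countable := by
  have hsub : {t | ¬ Tendsto (fun n => d (x t n)) V (𝓝 0)} ⊆
      ⋃ k : ℕ, {t | ∀ᶠ n in V, 1 / ((k : ℝ) + 1) < |d (x t n)|} := by
    intro t ht
    by_contra hcon
    simp only [Set.mem_iUnion, Set.mem_ofPred_eq, not_exists] at hcon
    apply ht
    rw [Metric.tendsto_nhds]
    intro δ hδ
    obtain ⟨k, hk⟩ := exists_nat_one_div_lt hδ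
    have := Ultrafilter.eventually_not.2 (hcon k)
    filter_upwards [this] with n hn
    rw [Real.dist_eq, sub_zero]
    exact lt_of_le_of_lt (not_lt.1 hn) hk
  refine Set.Countable.mono hsub (Set.countable_iUnion fun k => Set.Finite.countable ?_)
  by_contra hinf
  obtain ⟨M, hM⟩ := exists_nat_gt (‖d‖ * b * ((k : ℝ) + 1))
  obtain ⟨u, hu, hcard⟩ := Set.Infinite.exists_subset_card_eq hinf M
  obtain ⟨n₀, hn₀⟩ := F3 u
  have h1 : ∀ᶠ n in V, ∀ t ∈ u, 1 / ((k : ℝ) + 1) < |d (x t n)| :=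
    (Filter.eventually_all_finset u).2 fun t ht => hu ht
  obtain ⟨n, hn1, hn2⟩ := (h1.and (hV (eventually_ge_atTop n₀))).exists
  have h2 := hn₀ n hn2 (fun t => (SignType.sign (d (x t n)) : ℝ)) (by
    intro t
    rcases lt_trichotomy (d (x t n)) 0 with h | h | h <;> simp [h])
  have h3 := d.le_opNorm (∑ t ∈ u, (SignType.sign (d (x t n)) : ℝ) • x t n)
  have h4 : d (∑ t ∈ u, (SignType.sign (d (x t n)) : ℝ) • x t n) = ∑ t ∈ u, |d (x t n)| := by
    rw [map_sum]
    refine Finset.sum_congr rfl fun t _ => ?_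
    rw [map_smul, smul_eq_mul, sign_mul_self]
  have h5 : ∑ t ∈ u, 1 / ((k : ℝ) + 1) ≤ ∑ t ∈ u, |d (x t n)| :=
    Finset.sum_le_sum fun t ht => (hn1 t ht).le
  rw [Finset.sum_const, hcard, nsmul_eq_mul, mul_one_div, div_le_iff₀ (by positivity)] at h5
  rw [h4, Real.norm_eq_abs] at h3
  have h6 : ∑ t ∈ u, |d (x t n)| ≤ ‖d‖ * b :=
    (le_abs_self _).trans (h3.trans (mul_le_mul_of_nonneg_left h2 (norm_nonneg _)))
  have h7 := mul_le_mul_of_nonneg_right h6 (show (0 : ℝ) ≤ (k : ℝ) + 1 by positivity)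
  linarith

lemma exists_generic {b : ℝ} (V : Ultrafilter ℕ) (hV : (V : Filter ℕ) ≤ atTop)
    {x : (ℕ → Bool) → ℕ → X}
    (F3 : ∀ u : Finset (ℕ → Bool), ∃ n₀, ∀ n ≥ n₀, ∀ ε : (ℕ → Bool) → ℝ, (∀ t, |ε t| ≤ 1) →
        ‖∑ t ∈ u, ε t • x t n‖ ≤ b) (J : X →L[ℝ] X) (Q : ℕ → Finset (X →L[ℝ] ℝ)) :
    ∃ t, ∀ r, ∀ ψ ∈ Q r, Tendsto (fun n => ψ (J (x t n))) V (𝓝 0) := by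
  have hc : (⋃ r : ℕ, ⋃ ψ ∈ Q r,
      {t | ¬ Tendsto (fun n => (ψ.comp J) (x t n)) V (𝓝 0)}).Countable :=
    Set.countable_iUnion fun r => Set.Countable.biUnion (Q r).countable_toSet
      fun ψ _ => charged_countable V hV F3 _
  have hne : (⋃ r : ℕ, ⋃ ψ ∈ Q r,
      {t | ¬ Tendsto (fun n => (ψ.comp J) (x t n)) V (𝓝 0)}) ≠ Set.univ := by
    intro h
    rw [h, Set.countable_univ_iff] at hc
    obtain ⟨f, hf⟩ := exists_surjective_nat (ℕ → Bool)
    obtain ⟨n, hn⟩ := hf fun n => !(f n n)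
    have := congrFun hn n
    simp at this
  obtain ⟨t, ht⟩ := (Set.ne_univ_iff_exists_notMem _).1 hne
  refine ⟨t, fun r ψ hψ => ?_⟩
  by_contra hn
  exact ht (Set.mem_iUnion.2 ⟨r, Set.mem_iUnion₂.2 ⟨ψ, hψ, hn⟩⟩)

/-- weak star limits of alternating functionals -/
lemma limit_structure (U V : Ultrafilter ℕ) {e : ℕ → X} (he : DenseRange e)
    {Q : ℕ → Finset (X →L[ℝ] ℝ)}
    (hQ : ∀ r, ∀ ψ ∈ Q r, ‖ψ‖ ≤ 1) {N : ℕ} (y : ℕ → X)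
    (hy : ∀ r, ∀ ψ ∈ Q r, Tendsto (fun n => ψ (y n)) V (𝓝 0))
    (φ : ℕ → X →L[ℝ] ℝ) (hφ : ∀ q, φ q ∈ PhiSet e Q N) :
    ∃ H σ : X →L[ℝ] ℝ, ‖σ‖ ≤ 1 ∧ Tendsto (fun n => H (y n)) V (𝓝 0) ∧
      ∀ v, Tendsto (fun q => φ q v) U (𝓝 (H v + σ v)) := by
  choose r ψ m s hch hm hs heq using hφ
  have hn : ∀ q j, ‖ψ q j‖ ≤ 1 := fun q j => hQ _ _ ((hch q).1 j)
  choose g hg hlim using fun j => weak_limit U (fun q => ψ q j) (fun q => hn q j)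
  -- the length is eventually constant
  obtain ⟨m₀, hm₀⟩ : ∃ m₀, ∀ᶠ q in U, m q = m₀ := by
    have : ∀ᶠ q in U, ∃ k ∈ Finset.range (N + 1), m q = k :=
      Eventually.of_forall fun q => ⟨m q, Finset.mem_range.2 (Nat.lt_succ_of_le (hm q)), rfl⟩
    obtain ⟨k, _, hk⟩ := (Ultrafilter.eventually_exists_mem_iff (Finset.finite_toSet _)).1 this
    exact ⟨k, hk⟩
  obtain ⟨s₀, hs₁, hs₀⟩ : ∃ s₀ : ℝ, (s₀ = 1 ∨ s₀ = -1) ∧ ∀ᶠ q in U, s q = s₀ := by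
    have : ∀ᶠ q in U, s q = 1 ∨ s q = -1 := Eventually.of_forall hs
    rcases Ultrafilter.eventually_or.1 this with h | h
    · exact ⟨1, Or.inl rfl, h⟩
    · exact ⟨-1, Or.inr rfl, h⟩
  have hφlim : ∀ v, Tendsto (fun q => φ q v) U
      (𝓝 ((s₀ • ∑ j ∈ Finset.range m₀, (-1 : ℝ) ^ j • g j) v)) := by
    intro v
    have h1 : Tendsto (fun q => s₀ * ∑ j ∈ Finset.range m₀, (-1 : ℝ) ^ j * ψ q j v) U
        (𝓝 (s₀ * ∑ j ∈ Finset.range m₀, (-1 : ℝ) ^ j * g j v)) :=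
      (tendsto_finsetSum _ fun j _ => (hlim j v).const_mul _).const_mul _
    have h2 : (s₀ • ∑ j ∈ Finset.range m₀, (-1 : ℝ) ^ j • g j) v =
        s₀ * ∑ j ∈ Finset.range m₀, (-1 : ℝ) ^ j * g j v := by
      simp [sum_apply]
    rw [h2]
    refine h1.congr' ?_
    filter_upwards [hm₀, hs₀] with q h3 h4
    rw [heq, h3, h4]
    simp [sum_apply]
  -- structure of the limits
  let Z : (X →L[ℝ] ℝ) → Prop := fun f => Tendsto (fun n => f (y n)) V (𝓝 0)
  let unb : ℕ → Prop := fun j => ∀ B, ∀ᶠ q in U, B ≤ r q j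
  have hA : ∀ j, ¬ unb j → Z (g j) := by
    intro j hj
    simp only [unb, not_forall] at hj
    obtain ⟨B, hB⟩ := hj
    have hB' := Ultrafilter.eventually_not.2 hB
    have : ∀ᶠ q in U, ∃ k ∈ Finset.range B, r q j = k := by
      filter_upwards [hB'] with q hq
      exact ⟨r q j, Finset.mem_range.2 (not_le.1 hq), rfl⟩
    obtain ⟨k, _, hk⟩ := (Ultrafilter.eventually_exists_mem_iff (Finset.finite_toSet _)).1 this
    have : ∀ᶠ q in U, ∃ f ∈ Q k, ψ q j = f := by
      filter_upwards [hk] with q hq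
      exact ⟨ψ q j, hq ▸ (hch q).1 j, rfl⟩
    obtain ⟨f, hf, hfe⟩ := (Ultrafilter.eventually_exists_mem_iff (Finset.finite_toSet _)).1 this
    have hgf : g j = f := by
      ext v
      refine tendsto_nhds_unique (hlim j v) (tendsto_const_nhds.congr' ?_)
      filter_upwards [hfe] with q hq
      rw [hq]
    rw [hgf]
    exact hy k f hf
  have hBB : ∀ j, unb j → g (j + 1) = g j := by
    intro j hj
    ext v
    have h0 : ∀ δ > 0, |g j v - g (j + 1) v| ≤ δ := by
      intro δ hδ
      obtain ⟨R, hR⟩ := dens he v hδ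
      refine le_of_tendsto ((hlim j v).sub (hlim (j + 1) v)).abs ?_
      filter_upwards [hj R] with q hq
      exact hR _ hq _ _ (hn q j) (hn q (j + 1)) ((hch q).2 j)
    have := le_of_forall_pos_le_add (a := |g j v - g (j + 1) v|) (b := 0)
      (fun δ hδ => by simpa using h0 δ hδ)
    have := abs_nonpos_iff.1 this
    linarith
  have hadd : ∀ f f', Z f → Z f' → Z (f + f') := by
    intro f f' h h'
    simpa [Z] using Tendsto.add h h'
  have hsmul : ∀ (c : ℝ) f, Z f → Z (c • f) := by
    intro c f h
    simpa [Z] using Tendsto.const_mul c h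
  have key : ∀ m, Z (∑ j ∈ Finset.range m, (-1 : ℝ) ^ j • g j) ∨ ∃ k, m = k + 1 ∧ unb k ∧
      Z (∑ j ∈ Finset.range m, (-1 : ℝ) ^ j • g j - (-1 : ℝ) ^ k • g k) := by
    intro m
    induction m with
    | zero => left; simp [Z]
    | succ m ih =>
      rw [Finset.sum_range_succ]
      rcases ih with ih | ⟨k, rfl, hk, ih⟩
      · by_cases hu : unb m
        · right
          refine ⟨m, rfl, hu, ?_⟩
          rw [add_sub_cancel_right]
          exact ih
        · left
          exact hadd _ _ ih (hsmul _ _ (hA m hu))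
      · left
        rw [hBB k hk]
        convert ih using 1
        ext v
        simp [pow_succ]
        ring
  have hs1 : ‖s₀‖ = 1 := by rcases hs₁ with rfl | rfl <;> simp
  rcases key m₀ with h | ⟨k, _, _, h⟩
  · refine ⟨s₀ • ∑ j ∈ Finset.range m₀, (-1 : ℝ) ^ j • g j, 0, by simp, hsmul _ _ h, fun v => ?_⟩
    simpa using hφlim v
  · refine ⟨s₀ • (∑ j ∈ Finset.range m₀, (-1 : ℝ) ^ j • g j - (-1 : ℝ) ^ k • g k),
      s₀ • (-1 : ℝ) ^ k • g k, ?_, hsmul _ _ h, fun v => ?_⟩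
    · rw [norm_smul, norm_smul, hs1]
      simpa using hg k
    · rw [← add_apply, ← smul_add, sub_add_cancel]
      exact hφlim v

end Final2
end JO


namespace JO
section Final3

open Filter Topology

variable {X : Type} [NormedAddCommGroup X] [NormedSpace ℝ X]

lemma alt_pairs (ψ : ℕ → X →L[ℝ] ℝ) (M : ℕ) (v : X) :
    (∑ j ∈ Finset.range (2 * M), (-1 : ℝ) ^ j • ψ j) v =
      ∑ k ∈ Finset.range M, (ψ (2 * k) v - ψ (2 * k + 1) v) := by
  induction M with
  | zero => simp
  | succ M ih =>
    rw [show 2 * (M + 1) = 2 * M + 1 + 1 by ring, Finset.sum_range_succ, Finset.sum_range_succ,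
      Finset.sum_range_succ, add_apply, add_apply, ih]
    simp [pow_succ, pow_mul]
    ring

/-- the final evaluation -/
lemma eval_contra {a b K : ℝ} (ha : 0 < a) (hK : 0 ≤ K) {x : ℕ → X}
    (F2 : ∀ N (lam : ℕ → ℝ), (∀ m ≤ N, |∑ n ∈ Finset.range m, lam n| ≤ 1) →
        ‖∑ n ∈ Finset.range N, lam n • x n‖ ≤ b)
    {e : ℕ → X} (he : DenseRange e) {Q : ℕ → Finset (X →L[ℝ] ℝ)}
    (hQ : ∀ r, ∀ ψ ∈ Q r, ‖ψ‖ ≤ 1)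
    (hQ2 : ∀ r (τ : X →L[ℝ] ℝ), ‖τ‖ ≤ 1 →
      ∃ ψ ∈ Q r, ∀ i < r, |ψ (e i) - τ (e i)| ≤ 1 / ((r : ℝ) + 1))
    {M : ℕ} (hM : K * b < M * (a / 8)) (hM0 : 0 < M) (J : X →L[ℝ] X)
    (hJ : ∀ x, ∀ φ ∈ PhiSet e Q (2 * M), |φ (J x)| ≤ K * ‖x‖)
    (V : Ultrafilter ℕ) (hV : (V : Filter ℕ) ≤ atTop)
    (hy : ∀ r, ∀ ψ ∈ Q r, Tendsto (fun n => ψ (J (x n))) V (𝓝 0))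
    (τ : X →L[ℝ] ℝ) (hτ : ‖τ‖ ≤ 1) (hτ2 : ∀ᶠ n in V, a / 4 ≤ τ (J (x n))) : False := by
  have hMR : (0 : ℝ) < M := by exact_mod_cast hM0
  obtain ⟨δ, hδ, hδM⟩ : ∃ δ > 0, 4 * (M : ℝ) * δ = a / 8 :=
    ⟨a / 8 / (4 * M), by positivity, by field_simp⟩
  obtain ⟨f, hP, hrel⟩ := exists_seq_of_forall_finset_exists
    (fun s : ℕ × ℕ × (X →L[ℝ] ℝ) => a / 4 ≤ τ (J (x s.1)) ∧ s.2.2 ∈ Q s.2.1 ∧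
      (∀ i < s.2.1, |s.2.2 (e i) - τ (e i)| ≤ 1 / ((s.2.1 : ℝ) + 1)) ∧
      |s.2.2 (J (x s.1)) - τ (J (x s.1))| ≤ δ)
    (fun s s' => s.1 < s'.1 ∧ s.2.1 ≤ s'.2.1 ∧ |s.2.2 (J (x s'.1))| ≤ δ ∧
      |s'.2.2 (J (x s.1)) - τ (J (x s.1))| ≤ δ) (by
    intro S hS
    have h1 : ∀ᶠ n in V, ∀ s ∈ S, s.1 < n ∧ |s.2.2 (J (x n))| ≤ δ := by
      refine (Filter.eventually_all_finset S).2 fun s hs => ?_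
      have h2 := Metric.tendsto_nhds.1 (hy _ _ (hS s hs).2.1) δ hδ
      filter_upwards [h2, hV (eventually_gt_atTop s.1)] with n h3 h4
      refine ⟨h4, ?_⟩
      rw [Real.dist_eq, sub_zero] at h3
      exact h3.le
    obtain ⟨n, hn1, hn2⟩ := (h1.and hτ2).exists
    choose R hR using fun v => dens he v hδ
    let r := (S.sup fun s => max s.2.1 (R (J (x s.1)))) + R (J (x n))
    have hr1 : ∀ s ∈ S, max s.2.1 (R (J (x s.1))) ≤ r := fun s hs =>
      le_trans (Finset.le_sup (f := fun s : ℕ × ℕ × (X →L[ℝ] ℝ) =>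
        max s.2.1 (R (J (x s.1)))) hs) (Nat.le_add_right _ _)
    obtain ⟨ψ, hψ, hψτ⟩ := hQ2 r τ hτ
    have h12 : (1 : ℝ) / ((r : ℝ) + 1) ≤ 2 / ((r : ℝ) + 1) :=
      div_le_div_of_nonneg_right (by norm_num) (by positivity)
    refine ⟨(n, r, ψ), ⟨hn2, hψ, hψτ, ?_⟩, fun s hs => ⟨(hn1 s hs).1, ?_, (hn1 s hs).2, ?_⟩⟩
    · exact hR _ r (Nat.le_add_left _ _) ψ τ (hQ _ _ hψ) hτ fun i hi => (hψτ i hi).trans h12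
    · exact le_trans (le_max_left _ _) (hr1 s hs)
    · exact hR _ r (le_trans (le_max_right _ _) (hr1 s hs)) ψ τ (hQ _ _ hψ) hτ
        fun i hi => (hψτ i hi).trans h12)
  -- unpack
  let n : ℕ → ℕ := fun j => (f j).1
  let r : ℕ → ℕ := fun j => (f j).2.1
  let ψ : ℕ → X →L[ℝ] ℝ := fun j => (f j).2.2
  let y : ℕ → X := fun i => J (x (n i))
  have hch : Chain e Q r ψ := by
    refine ⟨fun j => (hP j).2.1, fun j i hi => ?_⟩
    have a0 : r j ≤ r (j + 1) := (hrel j (j + 1) (Nat.lt_succ_self j)).2.1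
    have a1 : |ψ j (e i) - τ (e i)| ≤ 1 / ((r j : ℝ) + 1) := (hP j).2.2.1 i hi
    have a2 : |ψ (j + 1) (e i) - τ (e i)| ≤ 1 / ((r (j + 1) : ℝ) + 1) :=
      (hP (j + 1)).2.2.1 i (lt_of_lt_of_le hi a0)
    have a3 : 1 / ((r (j + 1) : ℝ) + 1) ≤ 1 / ((r j : ℝ) + 1) := by
      apply one_div_le_one_div_of_le (by positivity)
      have : (r j : ℝ) ≤ r (j + 1) := by exact_mod_cast a0
      linarith
    have a4 : 2 / ((r j : ℝ) + 1) = 1 / ((r j : ℝ) + 1) + 1 / ((r j : ℝ) + 1) := by ring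
    rw [a4]
    rw [abs_le] at *
    constructor <;> linarith [a1.1, a1.2, a2.1, a2.2]
  have hbig : ∀ i, a / 4 ≤ τ (y i) := fun i => (hP i).1
  have hle : ∀ i j, i ≤ j → |ψ j (y i) - τ (y i)| ≤ δ := by
    intro i j hij
    rcases hij.eq_or_lt with rfl | h
    · exact (hP i).2.2.2
    · exact (hrel i j h).2.2.2
  have hgt : ∀ i j, j < i → |ψ j (y i)| ≤ δ := fun i j h => (hrel j i h).2.2.1
  have hmono : ∀ i j, i < j → n i < n j := fun i j h => (hrel i j h).1
  set w := ∑ i ∈ Finset.range M, (x (n (2 * i)) - x (n (2 * i + 1))) with hw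
  have hwb : ‖w‖ ≤ b := alt_bound F2 (fun i => n (2 * i)) (fun i => n (2 * i + 1))
    (fun i => (hmono _ _ (Nat.lt_succ_self _)).le) (fun i => hmono _ _ (by omega)) M
  have hφ : (∑ j ∈ Finset.range (2 * M), (-1 : ℝ) ^ j • ψ j) ∈ PhiSet e Q (2 * M) :=
    ⟨r, ψ, 2 * M, 1, hch, le_rfl, Or.inl rfl, by simp⟩
  have hup := (le_abs_self _).trans (hJ w _ hφ)
  rw [alt_pairs] at hup
  have hlow : ∀ k ∈ Finset.range M, a / 4 - M * (4 * δ) ≤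
      ψ (2 * k) (J w) - ψ (2 * k + 1) (J w) := by
    intro k hk
    have h1 : ψ (2 * k) (J w) - ψ (2 * k + 1) (J w) = ∑ i ∈ Finset.range M,
        ((ψ (2 * k) (y (2 * i)) - ψ (2 * k) (y (2 * i + 1))) -
          (ψ (2 * k + 1) (y (2 * i)) - ψ (2 * k + 1) (y (2 * i + 1)))) := by
      rw [Finset.sum_sub_distrib]
      simp [hw, y, map_sum]
    have h2 : ∑ i ∈ Finset.range M, ((if k = i then a / 4 else 0) - 4 * δ) =
        a / 4 - M * (4 * δ) := by
      rw [Finset.sum_sub_distrib, Finset.sum_ite_eq, if_pos hk]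
      simp
    rw [h1, ← h2]
    refine Finset.sum_le_sum fun i _ => ?_
    rcases lt_trichotomy k i with h | h | h
    · have b1 := abs_le.1 (hgt (2 * i) (2 * k) (by omega))
      have b2 := abs_le.1 (hgt (2 * i + 1) (2 * k) (by omega))
      have b3 := abs_le.1 (hgt (2 * i) (2 * k + 1) (by omega))
      have b4 := abs_le.1 (hgt (2 * i + 1) (2 * k + 1) (by omega))
      rw [if_neg (by omega)]
      linarith [b1.1, b2.2, b3.2, b4.1]
    · subst h
      have b1 := abs_le.1 (hle (2 * k) (2 * k) le_rfl)
      have b2 := abs_le.1 (hgt (2 * k + 1) (2 * k) (by omega))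
      have b3 := abs_le.1 (hle (2 * k) (2 * k + 1) (by omega))
      have b4 := abs_le.1 (hle (2 * k + 1) (2 * k + 1) le_rfl)
      rw [if_pos rfl]
      linarith [b1.1, b2.2, b3.2, b4.1, hbig (2 * k + 1)]
    · have b1 := abs_le.1 (hle (2 * i) (2 * k) (by omega))
      have b2 := abs_le.1 (hle (2 * i + 1) (2 * k) (by omega))
      have b3 := abs_le.1 (hle (2 * i) (2 * k + 1) (by omega))
      have b4 := abs_le.1 (hle (2 * i + 1) (2 * k + 1) (by omega))
      rw [if_neg (by omega)]
      linarith [b1.1, b2.2, b3.2, b4.1]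
  have hsum := Finset.sum_le_sum hlow
  rw [Finset.sum_const, Finset.card_range, nsmul_eq_mul] at hsum
  have h3 : a / 4 - M * (4 * δ) = a / 8 := by linarith
  rw [h3] at hsum
  have h4 := mul_le_mul_of_nonneg_left hwb hK
  linarith

theorem main [CompleteSpace X] [TopologicalSpace.SeparableSpace X] {K : ℝ}
    (h : ∀ (V : Type) [NormedAddCommGroup V] [NormedSpace ℝ V] [CompleteSpace V],
      Nonempty (X ≃L[ℝ] V) → IsKElastic V K) : FiniteDimensional ℝ X := by
  by_contra hX
  have hnt : Nontrivial X := by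
    by_contra hn
    rw [not_nontrivial_iff_subsingleton] at hn
    exact hX inferInstance
  have hK : 0 ≤ K := by
    obtain ⟨T, hT⟩ := h X ⟨ContinuousLinearEquiv.refl ℝ X⟩ X
      ⟨ContinuousLinearMap.id ℝ X, 1, one_pos, fun y => by simp⟩
    obtain ⟨v, hv⟩ := exists_ne (0 : X)
    have h1 := (hT v).1.trans (hT v).2
    have h2 := norm_pos_iff.2 hv
    by_contra hn
    nlinarith
  obtain ⟨T, hT, hst⟩ := dyadic hX h hK
  obtain ⟨x, F1, F2, F3⟩ := tree_facts (a := 1 / 2) (b := 2 * K + 1 / 2) (by linarith) T hT hst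
    (by norm_num)
  have ha : (0 : ℝ) < 1 / 2 := by norm_num
  generalize hae : (1 / 2 : ℝ) = a at F1 ha
  generalize 2 * K + 1 / 2 = b at F2 F3
  obtain ⟨M, hM⟩ := exists_nat_gt (max (K * b / (a / 8)) 0)
  have hM0 : 0 < M := by exact_mod_cast lt_of_le_of_lt (le_max_right _ _) hM
  have hM1 : K * b < M * (a / 8) := by
    have := lt_of_le_of_lt (le_max_left _ _) hM
    rwa [div_lt_iff₀ (by positivity)] at this
  let e := TopologicalSpace.denseSeq X
  have he : DenseRange e := TopologicalSpace.denseRange_denseSeq X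
  obtain ⟨Q, hQ, hQ2⟩ := nets e
  obtain ⟨J, hJ⟩ := renorm_ii h (PhiSet e Q (2 * M)) (c := 1 / 2) (by norm_num) (phi_norm hQ)
    (phi_norming he hQ hQ2 (by omega))
  let V : Ultrafilter ℕ := hyperfilter ℕ
  have hV : (V : Filter ℕ) ≤ atTop := by
    rw [← Nat.cofinite_eq_atTop]
    exact hyperfilter_le_cofinite
  obtain ⟨t, ht⟩ := exists_generic V hV F3 J Q
  obtain ⟨p, hp⟩ := tail_large ha hK (F1 t) (F2 t) _ phi_neg J hJ
  choose φ hφ hφ2 using hp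
  obtain ⟨H, σ, hσ, hH, hlim⟩ := limit_structure V V he hQ (fun n => J (x t n)) ht φ hφ
  have hge : ∀ n ≥ p, a / 2 ≤ H (J (x t n)) + σ (J (x t n)) := by
    intro n hn
    refine ge_of_tendsto (hlim (J (x t n))) ?_
    filter_upwards [hV (eventually_ge_atTop n)] with q hq
    exact hφ2 q n hn hq
  refine eval_contra ha hK (F2 t) he hQ hQ2 hM1 hM0 J (fun v => (hJ v).1) V hV ht σ hσ ?_
  filter_upwards [hV (eventually_ge_atTop p), Metric.tendsto_nhds.1 hH (a / 4) (by positivity)]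
    with n h1 h2
  rw [Real.dist_eq, sub_zero, abs_lt] at h2
  linarith [hge n h1, h2.2]

end Final3
end JO

/-- **Johnson–Odell.** If `X` is a separable Banach space and there is a `K` so that
every Banach space isomorphic to `X` is `K`-elastic, then `X` is finite dimensional. -/
theorem johnson_odell_uniformly_elastic_finiteDimensional
    (X : Type) [NormedAddCommGroup X] [NormedSpace ℝ X] [CompleteSpace X]
    [TopologicalSpace.SeparableSpace X]
    (K : ℝ)
    (h : ∀ (V : Type) [NormedAddCommGroup V] [NormedSpace ℝ V] [CompleteSpace V],
      Nonempty (X ≃L[ℝ] V) → IsKElastic V K) :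
    FiniteDimensional ℝ X := by
  exact JO.main h
end

section
/- (Johnson–Odell) Let X be a separable infinite dimensional elastic Banach space. Then c₀ (the space of real sequences converging to 0 with the supremum norm) is isomorphic to a subspace of X. -/
namespace JO

/-- Linear combination of a list of vectors. -/
def comb {X : Type*} [NormedAddCommGroup X] [NormedSpace ℝ X] : List X → (ℕ → ℝ) → X
  | [], _ => 0
  | x :: l, a => a 0 • x + comb l (fun i => a (i + 1))

section basics
variable {X : Type*} [NormedAddCommGroup X] [NormedSpace ℝ X]

@[simp] lemma comb_nil (a : ℕ → ℝ) : comb ([] : List X) a = 0 := rfl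

@[simp] lemma comb_cons (x : X) (l : List X) (a : ℕ → ℝ) :
    comb (x :: l) a = a 0 • x + comb l (fun i => a (i + 1)) := rfl

lemma comb_append (l m : List X) (a : ℕ → ℝ) :
    comb (l ++ m) a = comb l a + comb m (fun i => a (i + l.length)) := by
  induction l generalizing a with
  | nil => simp
  | cons x l ih =>
    simp only [List.cons_append, comb_cons, ih, List.length_cons, add_assoc]

lemma comb_add (l : List X) (a b : ℕ → ℝ) :
    comb l (fun i => a i + b i) = comb l a + comb l b := by
  induction l generalizing a b with
  | nil => simp
  | cons x l ih => simp only [comb_cons, ih, add_smul]; abel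

lemma comb_smul (l : List X) (t : ℝ) (a : ℕ → ℝ) :
    comb l (fun i => t * a i) = t • comb l a := by
  induction l generalizing a with
  | nil => simp
  | cons x l ih => simp only [comb_cons, ih, smul_add, mul_smul]

lemma comb_congr (l : List X) (a b : ℕ → ℝ) (h : ∀ i < l.length, a i = b i) :
    comb l a = comb l b := by
  induction l generalizing a b with
  | nil => simp
  | cons x l ih =>
    simp only [comb_cons]
    rw [h 0 (by simp), ih _ (fun i => b (i + 1)) (fun i hi => h (i + 1) (by simpa using hi))]

lemma comb_zero (l : List X) : comb l (fun _ => 0) = 0 := by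
  induction l with
  | nil => simp
  | cons x l ih => simp [ih]

lemma map_comb {Y : Type*} [NormedAddCommGroup Y] [NormedSpace ℝ Y] (T : X →ₗ[ℝ] Y)
    (l : List X) (a : ℕ → ℝ) : T (comb l a) = comb (l.map T) a := by
  induction l generalizing a with
  | nil => simp
  | cons x l ih => simp [ih]

lemma comb_kill (f : X →L[ℝ] ℝ) (l : List X) (h : ∀ x ∈ l, f x = 0) (a : ℕ → ℝ) :
    f (comb l a) = 0 := by
  induction l generalizing a with
  | nil => simp
  | cons x l ih =>
    simp only [comb_cons, map_add, map_smul]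
    rw [h x (by simp), ih (fun y hy => h y (by simp [hy]))]; simp

lemma comb_eq_sum (l : List X) (a : ℕ → ℝ) :
    comb l a = ∑ i : Fin l.length, a i • l.get i := by
  induction l generalizing a with
  | nil => simp
  | cons x l ih =>
    simp only [comb_cons, ih]
    erw [Fin.sum_univ_succ]
    simp

lemma comb_ofFn {n : ℕ} (x : ℕ → X) (a : ℕ → ℝ) :
    comb (List.ofFn (fun i : Fin n => x i)) a = ∑ i ∈ Finset.range n, a i • x i := by
  induction n generalizing x a with
  | zero => simp
  | succ n ih =>
    rw [List.ofFn_succ, Finset.sum_range_succ']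
    simp only [comb_cons, Fin.val_succ, Fin.val_zero]
    rw [ih (fun i => x (i + 1)) (fun i => a (i + 1))]
    abel

/-- two-sided `ℓ_∞` estimate -/
def Est (C : ℝ) (v : List X) : Prop :=
  (∀ a : ℕ → ℝ, (∀ i, |a i| ≤ 1) → ‖comb v a‖ ≤ C) ∧
  (∀ a : ℕ → ℝ, ∀ i < v.length, |a i| ≤ 2 * ‖comb v a‖)

lemma Est.left {C : ℝ} {v w : List X} (h : Est C (v ++ w)) : Est C v := by
  have key : ∀ a : ℕ → ℝ, comb (v ++ w) (fun i => if i < v.length then a i else 0) = comb v a := by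
    intro a
    rw [comb_append]
    have h1 : comb w (fun i => if i + v.length < v.length then a (i + v.length) else 0) = 0 := by
      simpa using comb_zero w
    rw [h1, add_zero]
    exact comb_congr _ _ _ (fun i hi => by simp [hi])
  refine ⟨fun a ha => ?_, fun a i hi => ?_⟩
  · rw [← key a]
    refine h.1 _ (fun i => ?_)
    split_ifs
    · exact ha i
    · simp
  · have := h.2 (fun i => if i < v.length then a i else 0) i (by simp; omega)
    rw [key a] at this
    simpa [hi] using this

lemma Est.right {C : ℝ} {v w : List X} (h : Est C (v ++ w)) : Est C w := by
  have key : ∀ a : ℕ → ℝ,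
      comb (v ++ w) (fun i => if i < v.length then 0 else a (i - v.length)) = comb w a := by
    intro a
    rw [comb_append]
    have h1 : comb v (fun i => if i < v.length then 0 else a (i - v.length)) = 0 := by
      rw [← comb_zero v]
      exact comb_congr _ _ _ (fun i hi => by simp [hi])
    rw [h1, zero_add]
    exact comb_congr _ _ _ (fun i hi => by simp)
  refine ⟨fun a ha => ?_, fun a i hi => ?_⟩
  · rw [← key a]
    refine h.1 _ (fun i => ?_)
    split_ifs
    · simp
    · exact ha _
  · have := h.2 (fun i => if i < v.length then 0 else a (i - v.length)) (i + v.length)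
      (by simp; omega)
    rw [key a] at this
    simpa using this

/-- `v` is a list of normalized blocks of `w`. -/
def IsBlock (v w : List X) : Prop :=
  ∀ c : ℕ → ℝ, ∃ b : ℕ → ℝ, comb w b = comb v c ∧ ((∀ i, |c i| ≤ 1) → ∀ i, |b i| ≤ 1) ∧
    ∀ i < v.length, ∃ j < w.length, |c i| ≤ |b j|

lemma IsBlock.nil : IsBlock ([] : List X) [] := fun c => ⟨c, by simp⟩

lemma IsBlock.append {v w v' w' : List X} (h : IsBlock v w) (h' : IsBlock v' w') :
    IsBlock (v ++ v') (w ++ w') := by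
  intro c
  obtain ⟨b, hb1, hb2, hb3⟩ := h c
  obtain ⟨b', hb1', hb2', hb3'⟩ := h' (fun i => c (i + v.length))
  refine ⟨fun i => if i < w.length then b i else b' (i - w.length), ?_, ?_, ?_⟩
  · rw [comb_append, comb_append, ← hb1, ← hb1']
    congr 1
    · exact comb_congr _ _ _ (fun i hi => by simp [hi])
    · exact comb_congr _ _ _ (fun i hi => by simp)
  · intro hc i
    dsimp only
    split_ifs
    · exact hb2 hc i
    · exact hb2' (fun i => hc _) _
  · intro i hi
    by_cases hiv : i < v.length
    · obtain ⟨j, hj, hj'⟩ := hb3 i hiv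
      exact ⟨j, by simp; omega, by simpa [hj] using hj'⟩
    · obtain ⟨j, hj, hj'⟩ := hb3' (i - v.length) (by simp at hi; omega)
      refine ⟨j + w.length, by simp; omega, ?_⟩
      have e : i - v.length + v.length = i := by omega
      simpa [e] using hj'

def Bio (fs : List (X →L[ℝ] ℝ)) (v : List X) : Prop :=
  (∀ f ∈ fs, ∃ i < v.length, ∀ c, f (comb v c) = c i) ∧
  (∀ i < v.length, ∃ f ∈ fs, ∀ c, f (comb v c) = c i)

lemma single_block (Φ : List (X →L[ℝ] ℝ)) (w : List X) (hw : w.length = Φ.length + 1) :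
    ∃ x : X, IsBlock [x] w ∧ ∀ f ∈ Φ, f x = 0 := by
  have h : ¬ LinearIndependent ℝ
      (fun i : Fin w.length => (fun k : Fin Φ.length => (Φ.get k) (w.get i))) := by
    intro h
    have := h.fintype_card_le_finrank
    simp at this
    omega
  obtain ⟨g, hg, i0, hi0⟩ := Fintype.not_linearIndependent_iff.1 h
  have : Nonempty (Fin w.length) := ⟨i0⟩
  obtain ⟨i1, hi1⟩ := Finite.exists_max (fun i => |g i|)
  have hpos : 0 < |g i1| := lt_of_lt_of_le (abs_pos.2 hi0) (hi1 i0)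
  set a : ℕ → ℝ := fun i => if h : i < w.length then g ⟨i, h⟩ / |g i1| else 0 with ha
  have ha1 : ∀ i, |a i| ≤ 1 := by
    intro i
    simp only [ha]
    split_ifs with h
    · rw [abs_div, abs_abs]
      exact div_le_one_of_le₀ (hi1 _) (abs_nonneg _)
    · simp
  have ha2 : |a i1| = 1 := by
    simp only [ha, i1.2, dif_pos, abs_div, abs_abs]
    exact div_self hpos.ne'
  refine ⟨comb w a, ?_, ?_⟩
  · intro c
    refine ⟨fun i => c 0 * a i, ?_, ?_, ?_⟩
    · rw [comb_smul]; simp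
    · intro hc i
      rw [abs_mul]
      exact mul_le_one₀ (hc 0) (abs_nonneg _) (ha1 i)
    · intro i hi
      have : i = 0 := by simpa using hi
      subst this
      exact ⟨i1, i1.2, by rw [abs_mul, ha2, mul_one]⟩
  · intro f hf
    obtain ⟨k, rfl⟩ := List.get_of_mem hf
    have h1 := congrFun hg k
    simp only [Finset.sum_apply, Pi.smul_apply, smul_eq_mul, Pi.zero_apply] at h1
    rw [comb_eq_sum, map_sum]
    simp only [map_smul, smul_eq_mul]
    have : ∀ i : Fin w.length, a i * (Φ.get k) (w.get i) =
        |g i1|⁻¹ * (g i * (Φ.get k) (w.get i)) := by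
      intro i
      simp only [ha, i.2, dif_pos]
      ring
    simp only [this]
    rw [← Finset.mul_sum, h1, mul_zero]

lemma many_blocks (Φ : List (X →L[ℝ] ℝ)) (n : ℕ) (w : List X)
    (hw : w.length = n * (Φ.length + 1)) :
    ∃ v : List X, v.length = n ∧ IsBlock v w ∧ ∀ f ∈ Φ, ∀ x ∈ v, f x = 0 := by
  induction n generalizing w with
  | zero =>
    have : w = [] := by simpa using hw
    subst this
    exact ⟨[], rfl, IsBlock.nil, by simp⟩
  | succ n ih =>
    have hw' : w.length = n * (Φ.length + 1) + (Φ.length + 1) := by rw [hw]; ring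
    obtain ⟨x, hx, hx'⟩ := single_block Φ (w.take (Φ.length + 1)) (by simp; omega)
    obtain ⟨v, hv, hv', hv''⟩ := ih (w.drop (Φ.length + 1)) (by simp; omega)
    refine ⟨[x] ++ v, by simp [hv], ?_, ?_⟩
    · have := hx.append hv'
      rwa [List.take_append_drop] at this
    · intro f hf y hy
      simp at hy
      rcases hy with rfl | hy
      · exact hx' f hf
      · exact hv'' f hf y hy

lemma hb_lemma (G : Submodule ℝ X) (x : X) (B : ℝ) (h : ∀ g ∈ G, 1 ≤ B * ‖x + g‖) :
    ∃ f : X →L[ℝ] ℝ, ‖f‖ ≤ B ∧ f x = 1 ∧ ∀ g ∈ G, f g = 0 := by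
  have hB : 0 < B := by
    by_contra hB
    have := h 0 G.zero_mem
    nlinarith [norm_nonneg (x + 0)]
  set q : X ⧸ G := Submodule.Quotient.mk x with hq
  have hn : 1 / B ≤ ‖q‖ := by
    apply le_of_forall_pos_le_add
    intro ε hε
    obtain ⟨m, hm, hm'⟩ := Submodule.Quotient.norm_mk_lt q hε
    have hm2 : m - x ∈ G := (Submodule.Quotient.eq G).1 hm
    have := h _ hm2
    rw [add_sub_cancel] at this
    have h3 : 1 / B ≤ ‖m‖ := by
      rw [div_le_iff₀ hB]; linarith
    linarith
  have hqpos : 0 < ‖q‖ := lt_of_lt_of_le (by positivity) hn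
  obtain ⟨g, hg, hg'⟩ := exists_dual_vector ℝ q hqpos.ne'
  let f0 : X →ₗ[ℝ] ℝ := ‖q‖⁻¹ • (g.toLinearMap ∘ₗ G.mkQ)
  have hf0 : ∀ y, ‖f0 y‖ ≤ B * ‖y‖ := by
    intro y
    have h1 : ‖g (G.mkQ y)‖ ≤ ‖y‖ := by
      refine (g.le_opNorm _).trans ?_
      rw [hg, one_mul]
      exact Submodule.Quotient.norm_mk_le G y
    have h2 : ‖q‖⁻¹ ≤ B := by
      rw [inv_le_comm₀ hqpos hB]; simpa using hn
    change ‖‖q‖⁻¹ * g (G.mkQ y)‖ ≤ _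
    rw [norm_mul, Real.norm_of_nonneg (inv_nonneg.2 hqpos.le)]
    exact mul_le_mul h2 h1 (norm_nonneg _) hB.le
  refine ⟨f0.mkContinuous B hf0, LinearMap.mkContinuous_norm_le _ hB.le _, ?_, ?_⟩
  · change ‖q‖⁻¹ * g q = 1
    rw [hg']
    exact inv_mul_cancel₀ hqpos.ne'
  · intro y hy
    change ‖q‖⁻¹ * g (G.mkQ y) = 0
    have : G.mkQ y = 0 := by simpa using hy
    rw [this]; simp

lemma bio_exists (F : Submodule ℝ X) (v : List X) (B : ℝ)
    (h : ∀ x ∈ F, ∀ c : ℕ → ℝ, ∀ i < v.length, |c i| ≤ B * ‖x + comb v c‖) :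
    ∃ fs : List (X →L[ℝ] ℝ), Bio fs v ∧ (∀ f ∈ fs, ‖f‖ ≤ B) ∧ ∀ f ∈ fs, ∀ x ∈ F, f x = 0 := by
  have key : ∀ i : Fin v.length, ∃ f : X →L[ℝ] ℝ, ‖f‖ ≤ B ∧ (∀ c, f (comb v c) = c i) ∧
      ∀ x ∈ F, f x = 0 := by
    intro i
    let G : Submodule ℝ X :=
      { carrier := {y | ∃ x ∈ F, ∃ c : ℕ → ℝ, c i = 0 ∧ y = x + comb v c}
        zero_mem' := ⟨0, F.zero_mem, fun _ => 0, rfl, by rw [comb_zero, add_zero]⟩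
        add_mem' := by
          rintro _ _ ⟨x, hx, c, hc, rfl⟩ ⟨x', hx', c', hc', rfl⟩
          refine ⟨x + x', F.add_mem hx hx', fun k => c k + c' k, by simp [hc, hc'], ?_⟩
          rw [comb_add]; abel
        smul_mem' := by
          rintro t _ ⟨x, hx, c, hc, rfl⟩
          refine ⟨t • x, F.smul_mem t hx, fun k => t * c k, by simp [hc], ?_⟩
          rw [comb_smul, smul_add] }
    let δ : ℕ → ℝ := fun k => if k = (i : ℕ) then 1 else 0
    obtain ⟨f, hf1, hf2, hf3⟩ := hb_lemma G (comb v δ) B (by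
      rintro _ ⟨x, hx, c, hc, rfl⟩
      have := h x hx (fun k => δ k + c k) i i.2
      rw [comb_add] at this
      simp only [δ, if_true, hc, add_zero, abs_one] at this
      convert this using 3
      simp only [δ]
      abel)
    refine ⟨f, hf1, fun c => ?_, fun x hx => hf3 x ⟨x, hx, fun _ => 0, rfl, by
      rw [comb_zero, add_zero]⟩⟩
    have e : comb v c = c i • comb v δ + comb v (fun k => c k - c i * δ k) := by
      rw [← comb_smul, ← comb_add]
      congr 1; ext k; ring
    have h0 : f (comb v (fun k => c k - c i * δ k)) = 0 :=
      hf3 _ ⟨0, F.zero_mem, _, by simp [δ], (zero_add _).symm⟩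
    rw [e, map_add, map_smul, hf2, h0]; simp
  choose f hf1 hf2 hf3 using key
  refine ⟨List.ofFn f, ⟨?_, ?_⟩, ?_, ?_⟩
  · intro g hg
    obtain ⟨i, rfl⟩ := (List.mem_ofFn' f g).1 hg
    exact ⟨i, i.2, hf2 i⟩
  · intro i hi
    exact ⟨f ⟨i, hi⟩, (List.mem_ofFn' f _).2 ⟨_, rfl⟩, hf2 ⟨i, hi⟩⟩
  · intro g hg
    obtain ⟨i, rfl⟩ := (List.mem_ofFn' f g).1 hg
    exact hf1 i
  · intro g hg
    obtain ⟨i, rfl⟩ := (List.mem_ofFn' f g).1 hg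
    exact hf3 i

lemma mazur (F : Submodule ℝ X) [FiniteDimensional ℝ F] :
    ∃ Φ : List (X →L[ℝ] ℝ), ∀ x ∈ F, ∀ y, (∀ f ∈ Φ, f y = 0) → ‖x‖ ≤ 2 * ‖x + y‖ := by
  have : ProperSpace F := FiniteDimensional.proper ℝ F
  have hc : IsCompact (Metric.sphere (0 : F) 1) := isCompact_sphere _ _
  obtain ⟨t, ht, htf, hcov⟩ := Metric.totallyBounded_iff.1 hc.totallyBounded |> fun h =>
    (Metric.finite_approx_of_totallyBounded hc.totallyBounded (1 / 2) (by norm_num))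
  choose g hg hg' using fun z : X => exists_dual_vector'' ℝ z
  refine ⟨htf.toFinset.toList.map (fun z : F => g z), ?_⟩
  have main : ∀ x : F, ‖x‖ = 1 → ∀ y : X,
      (∀ f ∈ htf.toFinset.toList.map (fun z : F => g z), f y = 0) → 1 ≤ 2 * ‖(x : X) + y‖ := by
    intro x hx y hy
    have hx' : x ∈ Metric.sphere (0 : F) 1 := by simpa using hx
    have := hcov hx'
    simp only [Set.mem_iUnion, Metric.mem_ball, exists_prop] at this
    obtain ⟨z, hz, hxz⟩ := this
    have hzn : ‖(z : X)‖ = 1 := by simpa using ht hz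
    have hgy : g z y = 0 := hy _ (List.mem_map.2 ⟨z, by simpa using hz, rfl⟩)
    have h1 : g z ((x : X) + y) = g z (x - z : X) + 1 := by
      rw [map_add, hgy, map_sub, hg' z, hzn]; simp
    have h2 : |g z (x - z : X)| ≤ 1 / 2 := by
      have a := (g z).le_opNorm (x - z : X)
      have b : ‖(x - z : X)‖ < 1 / 2 := by
        rw [dist_eq_norm] at hxz
        exact_mod_cast hxz
      rw [Real.norm_eq_abs] at a
      nlinarith [hg z, norm_nonneg (x - z : X), norm_nonneg (g (z : X))]
    have h3 : g z ((x : X) + y) ≤ ‖(x : X) + y‖ := by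
      have a := (g z).le_opNorm ((x : X) + y)
      have b := le_abs_self (g z ((x : X) + y))
      rw [Real.norm_eq_abs] at a
      nlinarith [hg z, norm_nonneg ((x : X) + y)]
    have := (abs_le.1 h2).1
    linarith
  intro x hx y hy
  by_cases h0 : ‖x‖ = 0
  · rw [h0]; positivity
  have hpos : 0 < ‖x‖ := lt_of_le_of_ne (norm_nonneg _) (Ne.symm h0)
  have := main (‖x‖⁻¹ • ⟨x, hx⟩) (by
    rw [norm_smul, norm_inv, norm_norm]; exact inv_mul_cancel₀ h0) (‖x‖⁻¹ • y) (by
    intro f hf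
    rw [map_smul, hy f hf, smul_zero])
  have e : (((‖x‖⁻¹ • (⟨x, hx⟩ : F) : F) : X) + ‖x‖⁻¹ • y) = ‖x‖⁻¹ • (x + y) := by
    rw [smul_add]; rfl
  rw [e, norm_smul, norm_inv, norm_norm] at this
  have h4 : ‖x‖ * 1 ≤ ‖x‖ * (2 * (‖x‖⁻¹ * ‖x + y‖)) := by gcongr
  have h5 : ‖x‖ * (2 * (‖x‖⁻¹ * ‖x + y‖)) = 2 * ‖x + y‖ := by field_simp
  linarith

end basics

section more
variable {X : Type*} [NormedAddCommGroup X] [NormedSpace ℝ X]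

lemma comb_ofFn' {n : ℕ} (u : Fin n → X) (a : ℕ → ℝ) :
    comb (List.ofFn u) a = ∑ i : Fin n, a i • u i := by
  induction n generalizing a with
  | zero => simp
  | succ n ih =>
    rw [List.ofFn_succ, Fin.sum_univ_succ]
    simp only [comb_cons, Fin.val_succ, Fin.val_zero]
    rw [ih]

lemma exists_top (hinf : ¬ FiniteDimensional ℝ X) (n : ℕ) :
    ∃ (v : List X) (fs : List (X →L[ℝ] ℝ)) (B : ℝ), v.length = n ∧ Bio fs v ∧
      (∀ f ∈ fs, ‖f‖ ≤ B) ∧ ∃ C, 0 ≤ C ∧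
        ∀ a : ℕ → ℝ, (∀ i, |a i| ≤ 1) → ‖comb v a‖ ≤ C := by
  let b := Module.Basis.ofVectorSpace ℝ X
  have hI : Infinite (Module.Basis.ofVectorSpaceIndex ℝ X) := by
    by_contra h
    rw [not_infinite_iff_finite] at h
    exact hinf (Module.Finite.of_basis b)
  let em : ℕ ↪ Module.Basis.ofVectorSpaceIndex ℝ X := Infinite.natEmbedding _
  let u : Fin n → X := fun i => b (em i)
  have hu : LinearIndependent ℝ u :=
    b.linearIndependent.comp (fun i : Fin n => em i)
      (em.injective.comp Fin.val_injective)
  obtain ⟨B, -, hB⟩ := (Fintype.linearCombination ℝ u).exists_antilipschitzWith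
    (by
      rw [LinearMap.ker_eq_bot']
      intro m hm
      rw [Fintype.linearCombination_apply] at hm
      ext i
      exact Fintype.linearIndependent_iff.1 hu m hm i)
  obtain ⟨fs, h1, h2, -⟩ := bio_exists (⊥ : Submodule ℝ X) (List.ofFn u) B (by
    intro x hx c i hi
    have hx : x = 0 := by simpa using hx
    subst hx
    have hi' : i < n := by simpa using hi
    have h := hB.le_mul_dist (fun i : Fin n => c i) 0
    rw [map_zero, dist_zero_right, dist_zero_right, Fintype.linearCombination_apply] at h
    rw [zero_add, comb_ofFn']
    exact (norm_le_pi_norm (fun i : Fin n => c i) ⟨i, hi'⟩).trans h)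
  refine ⟨_, fs, B, by simp, h1, h2, ∑ i, ‖u i‖, by positivity, ?_⟩
  intro a ha
  rw [comb_ofFn']
  refine (norm_sum_le _ _).trans (Finset.sum_le_sum fun i _ => ?_)
  rw [norm_smul]
  exact mul_le_of_le_one_left (norm_nonneg _) (ha _)

/-- mutual annihilation -/
def Ortho (a b : List X × List (X →L[ℝ] ℝ)) : Prop :=
  (∀ f ∈ a.2, ∀ x ∈ b.1, f x = 0) ∧ ∀ f ∈ b.2, ∀ x ∈ a.1, f x = 0

lemma step_lemma (C : ℝ) (s : List (List X × List (X →L[ℝ] ℝ))) (n : ℕ) :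
    ∃ N, (0 < n → 0 < N) ∧ ∀ w : List X, w.length = N → Est C w →
      ∃ (v : List X) (fs : List (X →L[ℝ] ℝ)), v.length = n ∧ IsBlock v w ∧ Bio fs v ∧
        (∀ f ∈ fs, ‖f‖ ≤ 6) ∧ ∀ p ∈ s, Ortho p (v, fs) := by
  classical
  let F : Submodule ℝ X := Submodule.span ℝ ((s.flatMap Prod.fst).toFinset : Set X)
  obtain ⟨Φ, hΦ⟩ := mazur F
  let Ψ := Φ ++ s.flatMap Prod.snd
  refine ⟨n * (Ψ.length + 1), fun h => by positivity, fun w hw hE => ?_⟩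
  obtain ⟨v, hv, hb, hk⟩ := many_blocks Ψ n w hw
  obtain ⟨fs, h1, h2, h3⟩ := bio_exists F v 6 (by
    intro x hx c i hi
    obtain ⟨b, hb1, -, hb3⟩ := hb c
    obtain ⟨j, hj, hj'⟩ := hb3 i hi
    have h4 := hE.2 b j hj
    rw [hb1] at h4
    have h5 := hΦ x hx (comb v c) (fun f hf =>
      comb_kill f v (fun y hy => hk f (by simp [Ψ, hf]) y hy) c)
    have h6 : ‖comb v c‖ ≤ ‖x + comb v c‖ + ‖x‖ := by
      have := norm_sub_le (x + comb v c) x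
      rwa [add_sub_cancel_left] at this
    linarith)
  refine ⟨v, fs, hv, hb, h1, h2, fun p hp => ⟨fun f hf x hx => hk f ?_ x hx,
    fun f hf x hx => h3 f hf x (Submodule.subset_span ?_)⟩⟩
  · simp only [Ψ, List.mem_append, List.mem_flatMap]
    exact Or.inr ⟨p, hp, hf⟩
  · simp only [Finset.mem_coe, List.mem_toFinset, List.mem_flatMap]
    exact ⟨p, hp, hx⟩

lemma exists_seq {α : Type*} (P : ℕ → α → Prop) (r : α → α → Prop)
    (h : ∀ n (s : List α), ∃ y, P n y ∧ ∀ x ∈ s, r x y) :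
    ∃ f : ℕ → α, (∀ n, P n (f n)) ∧ ∀ m n, m < n → r (f m) (f n) := by
  choose g hg1 hg2 using h
  let L : ℕ → List α := fun n => Nat.rec [] (fun n l => l ++ [g n l]) n
  have hL : ∀ n, L (n + 1) = L n ++ [g n (L n)] := fun n => rfl
  have hmem : ∀ m n, m < n → g m (L m) ∈ L n := by
    intro m n hmn
    induction n with
    | zero => omega
    | succ n ih =>
      rw [hL]
      rcases Nat.lt_succ_iff_lt_or_eq.1 hmn with h | rfl
      · simp [ih h]
      · simp
  exact ⟨fun n => g n (L n), fun n => hg1 _ _, fun m n hmn => hg2 _ _ _ (hmem m n hmn)⟩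

lemma c0_embeds [CompleteSpace X] (u : ℕ → X) (C : ℝ)
    (h1 : ∀ (n : ℕ) (a : ℕ → ℝ), (∀ i, |a i| ≤ 1) → ‖∑ i ∈ Finset.range n, a i • u i‖ ≤ C)
    (h2 : ∀ (n : ℕ) (a : ℕ → ℝ), ∀ i < n, |a i| ≤ 2 * ‖∑ i ∈ Finset.range n, a i • u i‖) :
    EmbedsInto (ZeroAtInftyContinuousMap ℕ ℝ) X := by
  have hC : 0 ≤ C := by simpa using h1 0 (fun _ => 0) (by simp)
  have key : ∀ (s : Finset ℕ) (a : ℕ → ℝ) (M : ℝ), 0 < M → (∀ i ∈ s, |a i| ≤ M) →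
      ‖∑ i ∈ s, a i • u i‖ ≤ C * M := by
    intro s a M hM ha
    obtain ⟨n, hn⟩ := s.exists_nat_subset_range
    have e : ∑ i ∈ s, a i • u i =
        M • ∑ i ∈ Finset.range n, (if i ∈ s then a i / M else 0) • u i := by
      rw [Finset.smul_sum, ← Finset.sum_subset hn]
      · refine Finset.sum_congr rfl fun i hi => ?_
        rw [if_pos hi, smul_smul, mul_div_cancel₀ _ hM.ne']
      · intro i _ hi
        simp [hi]
    rw [e, norm_smul, Real.norm_of_nonneg hM.le, mul_comm]
    refine mul_le_mul_of_nonneg_right (h1 n _ fun i => ?_) hM.le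
    split_ifs with hi
    · rw [abs_div, abs_of_pos hM]
      exact div_le_one_of_le₀ (ha i hi) hM.le
    · simp
  have hsum : ∀ a : ZeroAtInftyContinuousMap ℕ ℝ, Summable (fun i => a i • u i) := by
    intro a
    rw [summable_iff_vanishing_norm]
    intro ε hε
    have hδ : 0 < ε / (C + 1) := by positivity
    have hz := a.zero_at_infty'
    rw [Filter.cocompact_eq_cofinite, Nat.cofinite_eq_atTop, Metric.tendsto_atTop] at hz
    obtain ⟨N, hN⟩ := hz _ hδ
    refine ⟨Finset.range N, fun t ht => ?_⟩
    refine lt_of_le_of_lt (key t a _ hδ fun i hi => ?_) ?_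
    · have : N ≤ i := by
        by_contra hlt
        exact Finset.disjoint_left.1 ht hi (by simpa using hlt)
      have := hN i this
      rw [Real.dist_eq, sub_zero] at this
      exact this.le
    · rw [mul_div_assoc', div_lt_iff₀ (by positivity)]
      nlinarith
  have hle : ∀ (a : ZeroAtInftyContinuousMap ℕ ℝ) i, |a i| ≤ ‖a‖ := fun a i => by
    rw [← ZeroAtInftyContinuousMap.norm_toBCF_eq_norm]
    exact a.toBCF.norm_coe_le_norm i
  let T0 : ZeroAtInftyContinuousMap ℕ ℝ →ₗ[ℝ] X :=
    { toFun := fun a => ∑' i, a i • u i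
      map_add' := fun a b => by
        simp only [ZeroAtInftyContinuousMap.add_apply, add_smul]
        exact (hsum a).tsum_add (hsum b)
      map_smul' := fun t a => by
        simp only [ZeroAtInftyContinuousMap.smul_apply, smul_assoc, RingHom.id_apply]
        exact (hsum a).tsum_const_smul t }
  have hT : ∀ a, Filter.Tendsto (fun n => ∑ i ∈ Finset.range n, a i • u i) Filter.atTop
      (nhds (T0 a)) := fun a => (hsum a).hasSum.tendsto_sum_nat
  have hub : ∀ a, ‖T0 a‖ ≤ C * ‖a‖ := by
    intro a
    by_cases h0 : ‖a‖ = 0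
    · have : a = 0 := norm_eq_zero.1 h0
      simp [this]
    · exact le_of_tendsto (hT a).norm (Filter.Eventually.of_forall fun n =>
        key _ a _ (lt_of_le_of_ne (norm_nonneg _) (Ne.symm h0)) fun i _ => hle a i)
  refine ⟨T0.mkContinuous C hub, 1 / 2, by norm_num, fun a => ?_⟩
  change 1 / 2 * ‖a‖ ≤ ‖T0 a‖
  have : ‖a‖ ≤ 2 * ‖T0 a‖ := by
    rw [← ZeroAtInftyContinuousMap.norm_toBCF_eq_norm]
    refine (BoundedContinuousFunction.norm_le (by positivity)).2 fun i => ?_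
    refine ge_of_tendsto ((hT a).norm.const_mul 2) ?_
    filter_upwards [Filter.eventually_gt_atTop i] with n hn
    exact h2 n a i hn
  linarith

end more

open scoped ENNReal in
lemma renorm (X : Type) [NormedAddCommGroup X] [NormedSpace ℝ X] [CompleteSpace X] [Nontrivial X]
    (K : ℝ) (hK : IsKElastic X K) (S : Set (X →L[ℝ] ℝ)) (B : ℝ) (hB : ∀ f ∈ S, ‖f‖ ≤ B) :
    0 ≤ K ∧ ∃ T : X →ₗ[ℝ] X, ∀ x, (∀ f ∈ S, |f x| ≤ ‖T x‖) ∧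
      ∀ M, ‖x‖ ≤ M → (∀ f ∈ S, |f x| ≤ M) → ‖T x‖ ≤ K * M := by
  have hbd : ∀ x : X, ∀ f : S, ‖(f : X →L[ℝ] ℝ) x‖ ≤ |B| * ‖x‖ := by
    intro x f
    refine (ContinuousLinearMap.le_opNorm _ _).trans ?_
    gcongr
    exact (hB f f.2).trans (le_abs_self _)
  let G0 : X →ₗ[ℝ] lp (fun _ : S => ℝ) ∞ :=
    { toFun := fun x => ⟨fun f => (f : X →L[ℝ] ℝ) x, memℓp_infty
        ⟨|B| * ‖x‖, by rintro _ ⟨f, rfl⟩; exact hbd x f⟩⟩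
      map_add' := fun x y => by ext f; simp; rfl
      map_smul' := fun t x => by ext f; simp }
  let G : X →L[ℝ] lp (fun _ : S => ℝ) ∞ := G0.mkContinuous |B| (fun x =>
    lp.norm_le_of_forall_le (by positivity) (fun f => hbd x f))
  let Y : Submodule ℝ (X × lp (fun _ : S => ℝ) ∞) := G.toLinearMap.graph
  have hcl : IsClosed (Y : Set (X × lp (fun _ : S => ℝ) ∞)) := by
    have : (Y : Set (X × lp (fun _ : S => ℝ) ∞)) = {p | p.2 = G p.1} := by
      ext p; simp [Y, LinearMap.mem_graph_iff]
    rw [this]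
    exact isClosed_eq continuous_snd (G.continuous.comp continuous_fst)
  have : CompleteSpace Y := hcl.completeSpace_coe
  have hemb : EmbedsInto Y X := by
    refine ⟨(ContinuousLinearMap.fst ℝ _ _).comp Y.subtypeL, 1 / (|B| + 1), by positivity, ?_⟩
    rintro ⟨⟨x, g⟩, hy⟩
    have hg : g = G x := by simpa [Y, LinearMap.mem_graph_iff] using hy
    subst hg
    change 1 / (|B| + 1) * max ‖x‖ ‖G x‖ ≤ ‖x‖
    rw [div_mul_eq_mul_div, one_mul, div_le_iff₀ (by positivity)]
    apply max_le
    · nlinarith [norm_nonneg x, abs_nonneg B]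
    · have := lp.norm_le_of_forall_le (f := G x) (C := |B| * ‖x‖) (by positivity)
        (fun f => hbd x f)
      nlinarith [norm_nonneg x, abs_nonneg B]
  obtain ⟨T, hT⟩ := hK Y hemb
  let J : X →ₗ[ℝ] Y :=
    { toFun := fun x => ⟨(x, G x), by simp [Y, LinearMap.mem_graph_iff]⟩
      map_add' := fun x y => by ext1; simp
      map_smul' := fun t x => by ext1; simp }
  have hJ : ∀ x, ‖J x‖ = max ‖x‖ ‖G x‖ := fun x => rfl
  have hK0 : 0 ≤ K := by
    obtain ⟨x, hx⟩ := exists_ne (0 : X)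
    have h := hT (J x)
    have hpos : 0 < ‖J x‖ := lt_of_lt_of_le (norm_pos_iff.2 hx) (by rw [hJ]; exact le_max_left _ _)
    by_contra hneg
    nlinarith [h.1.trans h.2]
  refine ⟨hK0, T.toLinearMap ∘ₗ J, fun x => ⟨fun f hf => ?_, fun M h1 h2 => ?_⟩⟩
  · refine le_trans ?_ (hT (J x)).1
    rw [hJ]
    exact le_trans (lp.norm_apply_le_norm ENNReal.top_ne_zero (G x) ⟨f, hf⟩) (le_max_right _ _)
  · refine (hT (J x)).2.trans (mul_le_mul_of_nonneg_left ?_ hK0)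
    rw [hJ]
    exact max_le h1 (lp.norm_le_of_forall_le ((norm_nonneg _).trans h1) (fun f => h2 f f.2))

section tree
variable {X : Type} [NormedAddCommGroup X] [NormedSpace ℝ X]

/-- one-step extension inside the tree -/
def Ext (C : ℝ) (d : ℕ → X) (l' l : List ℕ) : Prop :=
  (∃ x, l' = l ++ [x]) ∧ Est C (l'.map d)

lemma c0_of_not_wf [CompleteSpace X] (C : ℝ) (d : ℕ → X) (h : ¬ WellFounded (Ext C d)) :
    EmbedsInto (ZeroAtInftyContinuousMap ℕ ℝ) X := by
  rw [wellFounded_iff_isEmpty_descending_chain, not_isEmpty_iff] at h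
  obtain ⟨f, hf⟩ := h
  choose x hx using fun n => (hf n).1
  have hfn : ∀ n, f n = f 0 ++ List.ofFn (fun i : Fin n => x i) := by
    intro n
    induction n with
    | zero => simp
    | succ n ih =>
      rw [hx n, List.ofFn_succ_last, ← List.append_assoc]
      congr 1
  have hE : ∀ n, Est C (List.ofFn (fun i : Fin n => d (x i))) := by
    intro n
    have h1 := (hf n).2
    rw [hx n, hfn n, List.map_append, List.map_append] at h1
    have h2 := h1.left.right
    rw [List.map_ofFn] at h2
    exact h2
  refine c0_embeds (fun i => d (x i)) C (fun n a ha => ?_) (fun n a i hi => ?_)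
  · rw [← comb_ofFn (fun i => d (x i))]
    exact (hE n).1 a ha
  · rw [← comb_ofFn (fun i => d (x i))]
    exact (hE n).2 a i (by simpa using hi)

lemma rank_ext (C : ℝ) (d : ℕ → X) [IsWellFounded (List ℕ) (Ext C d)] (l w : List ℕ)
    (h : Est C ((l ++ w).map d)) :
    IsWellFounded.rank (Ext C d) (l ++ w) + (w.length : Ordinal) ≤
      IsWellFounded.rank (Ext C d) l := by
  induction w generalizing l with
  | nil => simp
  | cons x w ih =>
    have e : l ++ x :: w = (l ++ [x]) ++ w := by simp
    rw [e] at h ⊢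
    have h1 := ih _ h
    have h2 : Ext C d (l ++ [x]) l := ⟨⟨x, rfl⟩, by rw [List.map_append] at h; exact h.left⟩
    have h3 := IsWellFounded.rank_lt_of_rel h2
    rw [List.length_cons, Nat.cast_add, Nat.cast_one, ← add_assoc]
    exact Order.add_one_le_of_lt (h1.trans_lt h3)

lemma rank_desc (C : ℝ) (d : ℕ → X) [IsWellFounded (List ℕ) (Ext C d)] (o : Ordinal.{0}) (N : ℕ)
    (l : List ℕ) (hl : Est C (l.map d)) (h : o + (N : Ordinal) ≤ IsWellFounded.rank (Ext C d) l) :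
    ∃ w : List ℕ, w.length = N ∧ Est C ((l ++ w).map d) ∧
      o ≤ IsWellFounded.rank (Ext C d) (l ++ w) := by
  induction N generalizing l with
  | zero => exact ⟨[], rfl, by simpa using hl, by simpa using h⟩
  | succ N ih =>
    have h1 : o + (N : Ordinal) < IsWellFounded.rank (Ext C d) l := by
      refine lt_of_lt_of_le ?_ h
      rw [Nat.cast_add, Nat.cast_one, ← add_assoc]
      exact Order.lt_add_one_iff.2 le_rfl
    rw [IsWellFounded.rank_eq, Ordinal.lt_iSup_iff] at h1
    obtain ⟨⟨l', ⟨x, rfl⟩, hE⟩, h1⟩ := h1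
    rw [Order.lt_succ_iff] at h1
    obtain ⟨w, hw1, hw2, hw3⟩ := ih _ hE h1
    exact ⟨x :: w, by simp [hw1], by simpa using hw2, by simpa using hw3⟩

/-- position dependent approximation -/
def approx (near : ℕ → X → ℕ) : ℕ → List X → List ℕ
  | _, [] => []
  | k, x :: l => near k x :: approx near (k + 1) l

lemma approx_append (near : ℕ → X → ℕ) (k : ℕ) (l m : List X) :
    approx near k (l ++ m) = approx near k l ++ approx near (k + l.length) m := by
  induction l generalizing k with
  | nil => simp [approx]
  | cons x l ih =>
    have : k + 1 + l.length = k + (l.length + 1) := by ring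
    simp [approx, ih, this]

lemma approx_length (near : ℕ → X → ℕ) (k : ℕ) (l : List X) :
    (approx near k l).length = l.length := by
  induction l generalizing k with
  | nil => simp [approx]
  | cons x l ih => simp [approx, ih]

lemma approx_close (d : ℕ → X) (near : ℕ → X → ℕ)
    (hn : ∀ k y, ‖d (near k y) - y‖ ≤ (1 / 2 : ℝ) ^ (k + 2)) (k : ℕ) (V : List X) (a : ℕ → ℝ)
    (M : ℝ) (ha : ∀ i, |a i| ≤ M) :
    ‖comb ((approx near k V).map d) a - comb V a‖ ≤ M * (1 / 2 : ℝ) ^ (k + 1) := by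
  have hM : 0 ≤ M := (abs_nonneg _).trans (ha 0)
  induction V generalizing k a with
  | nil => simp [approx]; positivity
  | cons x V ih =>
    simp only [approx, List.map_cons, comb_cons]
    have h1 := ih (k + 1) (fun i => a (i + 1)) (fun i => ha _)
    have e : a 0 • d (near k x) + comb ((approx near (k + 1) V).map d) (fun i => a (i + 1)) -
        (a 0 • x + comb V (fun i => a (i + 1))) =
        a 0 • (d (near k x) - x) + (comb ((approx near (k + 1) V).map d) (fun i => a (i + 1)) -
          comb V (fun i => a (i + 1))) := by
      rw [smul_sub]; abel
    rw [e]
    refine (norm_add_le _ _).trans ?_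
    have h2 : ‖a 0 • (d (near k x) - x)‖ ≤ M * (1 / 2 : ℝ) ^ (k + 2) := by
      rw [norm_smul]
      exact mul_le_mul (ha 0) (hn k x) (norm_nonneg _) hM
    have h3 : M * (1 / 2 : ℝ) ^ (k + 1) =
        M * (1 / 2 : ℝ) ^ (k + 2) + M * (1 / 2 : ℝ) ^ (k + 1 + 1) := by ring
    rw [h3]
    exact add_le_add h2 h1

lemma approx_est (d : ℕ → X) (near : ℕ → X → ℕ)
    (hn : ∀ k y, ‖d (near k y) - y‖ ≤ (1 / 2 : ℝ) ^ (k + 2)) (V : List X) (K : ℝ)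
    (h1 : ∀ a : ℕ → ℝ, (∀ i, |a i| ≤ 1) → ‖comb V a‖ ≤ K)
    (h2 : ∀ a : ℕ → ℝ, ∀ i < V.length, |a i| ≤ ‖comb V a‖) :
    Est (K + 1) ((approx near 0 V).map d) := by
  refine ⟨fun a ha => ?_, fun a i hi => ?_⟩
  · have h := approx_close d near hn 0 V a 1 ha
    have h3 := h1 a ha
    have h4 := norm_add_le (comb ((approx near 0 V).map d) a - comb V a) (comb V a)
    rw [sub_add_cancel] at h4
    norm_num at h
    linarith
  · rw [List.length_map, approx_length] at hi
    obtain ⟨m, hm, hmax⟩ := Finset.exists_max_image (Finset.range V.length) (fun i => |a i|)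
      ⟨i, by simpa using hi⟩
    set a' : ℕ → ℝ := fun i => if i < V.length then a i else 0 with ha'
    have hm' : m < V.length := by simpa using hm
    have hb : ∀ i, |a' i| ≤ |a m| := by
      intro i
      simp only [ha']
      split_ifs with h
      · exact hmax i (by simpa using h)
      · simp
    have h := approx_close d near hn 0 V a' _ hb
    have e : comb ((approx near 0 V).map d) a = comb ((approx near 0 V).map d) a' :=
      comb_congr _ _ _ (fun i hi => by
        rw [List.length_map, approx_length] at hi; simp [ha', hi])
    have h3 := h2 a' m hm'
    have h5 : a' m = a m := by simp [ha', hm']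
    rw [h5] at h3
    have h4 := norm_sub_le (comb ((approx near 0 V).map d) a')
      (comb ((approx near 0 V).map d) a' - comb V a')
    rw [sub_sub_cancel] at h4
    have h6 := hmax i (by simpa using hi)
    rw [e]
    norm_num at h
    linarith

open Ordinal in
lemma main_wf [CompleteSpace X] (hinf : ¬ FiniteDimensional ℝ X) (K : ℝ) (hK : IsKElastic X K)
    (d : ℕ → X) (hd : DenseRange d) [IsWellFounded (List ℕ) (Ext (K + 1) d)] : False := by
  have hnt : Nontrivial X := by
    by_contra h
    rw [not_nontrivial_iff_subsingleton] at h
    exact hinf inferInstance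
  have hK0 : 0 ≤ K := (renorm X K hK ∅ 0 (by simp)).1
  set C : ℝ := K + 1 with hC
  set r : List ℕ → Ordinal.{0} := IsWellFounded.rank (Ext C d) with hr
  have hω : (ω : Ordinal.{0}) ≠ 0 := omega0_ne_zero
  obtain ⟨k, hk⟩ := lt_omega0.1 (mod_lt (r []) hω)
  obtain ⟨e, fe, Be, he1, he2, he3, Ce, hCe, he4⟩ := exists_top hinf (k + 1)
  obtain ⟨σ, hσ⟩ := exists_surjective_nat (List ℕ × ℕ × List ℕ)
  let Cond : List ℕ → List ℕ → Prop := fun l q =>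
    ∀ N : ℕ, ∃ w : List ℕ, w.length = N ∧ Est C ((l ++ w).map d) ∧ ω * (r q / ω) ≤ r (l ++ w)
  let Good : List ℕ × ℕ × List ℕ → List ℕ × (List X × List (X →L[ℝ] ℝ)) → Prop := fun s y =>
    ∃ w, y.1 = s.1 ++ w ∧ 0 < w.length ∧ Est C (y.1.map d) ∧ ω * (r s.2.2 / ω) ≤ r y.1 ∧
      IsBlock y.2.1 (w.map d) ∧ y.2.1.length = s.2.1 ∧ Bio y.2.2 y.2.1
  obtain ⟨Y, hY1, hY2⟩ := exists_seq
    (fun j (y : List ℕ × (List X × List (X →L[ℝ] ℝ))) => (∀ f ∈ y.2.2, ‖f‖ ≤ 6) ∧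
      Ortho (e, fe) y.2 ∧ (Cond (σ j).1 (σ j).2.2 → 0 < (σ j).2.1 → Good (σ j) y))
    (fun x y => Ortho x.2 y.2) (by
      intro j s
      by_cases hc : Cond (σ j).1 (σ j).2.2 ∧ 0 < (σ j).2.1
      · obtain ⟨N, hN, hN'⟩ := step_lemma C ((e, fe) :: s.map Prod.snd) (σ j).2.1
        obtain ⟨w, hw1, hw2, hw3⟩ := hc.1 N
        obtain ⟨v, fs, h1, h2, h3, h4, h5⟩ := hN' (w.map d) (by simpa using hw1)
          (by rw [List.map_append] at hw2; exact hw2.right)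
        refine ⟨((σ j).1 ++ w, (v, fs)), ⟨h4, h5 _ (by simp), fun _ _ =>
          ⟨w, rfl, by rw [hw1]; exact hN hc.2, hw2, hw3, h2, h1, h3⟩⟩, fun x hx => h5 _ ?_⟩
        simp only [List.mem_cons, List.mem_map]
        exact Or.inr ⟨x, hx, rfl⟩
      · refine ⟨([], ([], [])), ⟨by simp, by simp [Ortho], fun h1 h2 => absurd ⟨h1, h2⟩ hc⟩, ?_⟩
        intro x _
        simp [Ortho])
  have hOrth : ∀ i j, i ≠ j → Ortho (Y i).2 (Y j).2 := by
    intro i j hij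
    rcases lt_or_gt_of_ne hij with h | h
    · exact hY2 i j h
    · exact ⟨(hY2 j i h).2, (hY2 j i h).1⟩
  let S : Set (X →L[ℝ] ℝ) := {f | f ∈ fe ∨ ∃ j, f ∈ (Y j).2.2}
  have hSb : ∀ f ∈ S, ‖f‖ ≤ max Be 6 := by
    rintro f (hf | ⟨j, hf⟩)
    · exact (he3 f hf).trans (le_max_left _ _)
    · exact ((hY1 j).1 f hf).trans (le_max_right _ _)
  set K' : ℝ := Ce + C with hK'
  have hK'pos : 0 < K' := by rw [hK', hC]; linarith
  obtain ⟨-, T, hT⟩ := renorm X K hK ((fun f => K' • f) '' S) (K' * max Be 6) (by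
    rintro _ ⟨f, hf, rfl⟩
    simp only [norm_smul, Real.norm_of_nonneg hK'pos.le]
    exact mul_le_mul_of_nonneg_left (hSb f hf) hK'pos.le)
  let W : X →ₗ[ℝ] X := K'⁻¹ • T
  have hWn : ∀ x, ‖W x‖ = K'⁻¹ * ‖T x‖ := by
    intro x
    simp only [W, LinearMap.smul_apply, norm_smul, Real.norm_of_nonneg (inv_nonneg.2 hK'pos.le)]
  have hW1 : ∀ x, ∀ f ∈ S, |f x| ≤ ‖W x‖ := by
    intro x f hf
    have h := (hT x).1 _ ⟨f, hf, rfl⟩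
    simp only [ContinuousLinearMap.smul_apply, _root_.smul_eq_mul, abs_mul, abs_of_pos hK'pos] at h
    rw [hWn, inv_mul_eq_div, le_div_iff₀ hK'pos]
    linarith
  have hW2 : ∀ x, ‖x‖ ≤ K' → (∀ f ∈ S, |f x| ≤ 1) → ‖W x‖ ≤ K := by
    intro x hx h
    have h1 := (hT x).2 K' hx (by
      rintro _ ⟨f, hf, rfl⟩
      simp only [ContinuousLinearMap.smul_apply, _root_.smul_eq_mul, abs_mul, abs_of_pos hK'pos]
      exact mul_le_of_le_one_right hK'pos.le (h f hf))
    rw [hWn, inv_mul_eq_div, div_le_iff₀ hK'pos]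
    exact h1
  have hnear : ∀ (k : ℕ) (y : X), ∃ m, ‖d m - y‖ ≤ (1 / 2 : ℝ) ^ (k + 2) := by
    intro k y
    obtain ⟨m, hm⟩ := hd.exists_dist_lt y (show (0 : ℝ) < (1 / 2 : ℝ) ^ (k + 2) by positivity)
    refine ⟨m, ?_⟩
    rw [dist_comm, dist_eq_norm] at hm
    exact hm.le
  choose near hnear using hnear
  let φ : List X → List ℕ := fun V => approx near 0 (V.map W)
  have hφapp : ∀ V v, ∃ w, φ (V ++ v) = φ V ++ w ∧ w.length = v.length := by
    intro V v
    refine ⟨_, by simp only [φ]; rw [List.map_append, approx_append], by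
      rw [approx_length, List.length_map]⟩
  let Path : List ℕ → List X → Prop := fun l V =>
    Est C (l.map d) ∧ (∃ U, V = e ++ U ∧ IsBlock U (l.map d)) ∧
    (∀ f ∈ S, (∀ c, f (comb V c) = 0) ∨ ∃ i < V.length, ∀ c, f (comb V c) = c i) ∧
    (∀ i < V.length, ∃ f ∈ S, ∀ c, f (comb V c) = c i) ∧
    (∀ j, l.length < (Y j).1.length → ∀ f ∈ (Y j).2.2, ∀ c, f (comb V c) = 0)
  have path_est : ∀ l V, Path l V → Est C ((φ V).map d) := by
    rintro l V ⟨hl, ⟨U, rfl, hU⟩, h1, h2, -⟩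
    refine approx_est d near hnear _ K (fun a ha => ?_) (fun a i hi => ?_)
    · rw [← map_comb]
      apply hW2
      · rw [comb_append, hK']
        refine (norm_add_le _ _).trans (add_le_add (he4 a ha) ?_)
        obtain ⟨b, hb1, hb2, -⟩ := hU (fun i => a (i + e.length))
        rw [← hb1]
        exact hl.1 b (hb2 fun i => ha _)
      · intro f hf
        rcases h1 f hf with h | ⟨i, -, h⟩
        · rw [h]; simp
        · rw [h]; exact ha i
    · rw [← map_comb]
      obtain ⟨f, hf, h⟩ := h2 i (by simpa using hi)
      rw [← h a]
      exact hW1 _ f hf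
  have path_base : Path [] e := by
    refine ⟨⟨fun a _ => by simp [hC]; linarith, by simp⟩, ⟨[], by simp, IsBlock.nil⟩, ?_, ?_, ?_⟩
    · rintro f (hf | ⟨j, hf⟩)
      · exact Or.inr (he2.1 f hf)
      · exact Or.inl (comb_kill f e ((hY1 j).2.1.2 f hf))
    · intro i hi
      obtain ⟨f, hf, h⟩ := he2.2 i hi
      exact ⟨f, Or.inl hf, h⟩
    · intro j _ f hf
      exact comb_kill f e ((hY1 j).2.1.2 f hf)
  have path_step : ∀ l V j, Path l V → (σ j).1 = l → Good (σ j) (Y j) →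
      Path (Y j).1 (V ++ (Y j).2.1) := by
    rintro l V j ⟨hl, ⟨U, rfl, hU⟩, h1, h2, h3⟩ hσl ⟨w, hw1, hw2, hw3, -, hw5, -, hw7⟩
    rw [hσl] at hw1
    have hlen : l.length < (Y j).1.length := by rw [hw1]; simp; omega
    refine ⟨hw3, ⟨U ++ (Y j).2.1, by simp, ?_⟩, ?_, ?_, ?_⟩
    · rw [hw1, List.map_append]
      exact hU.append hw5
    · intro f hf
      by_cases hfj : f ∈ (Y j).2.2
      · obtain ⟨i, hi, h⟩ := hw7.1 f hfj
        refine Or.inr ⟨i + (e ++ U).length, by simp at hi ⊢; omega, fun c => ?_⟩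
        rw [comb_append, map_add, h3 j hlen f hfj, h, zero_add]
      · have hkill : ∀ c, f (comb (Y j).2.1 c) = 0 := by
          rcases hf with hf | ⟨i, hf⟩
          · exact comb_kill f _ ((hY1 j).2.1.1 f hf)
          · have hij : i ≠ j := by rintro rfl; exact hfj hf
            exact comb_kill f _ ((hOrth i j hij).1 f hf)
        rcases h1 f hf with h | ⟨i, hi, h⟩
        · exact Or.inl fun c => by rw [comb_append, map_add, h, hkill, zero_add]
        · exact Or.inr ⟨i, by simp at hi ⊢; omega, fun c => by
            rw [comb_append, map_add, h, hkill, add_zero]⟩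
    · intro i hi
      by_cases hiV : i < (e ++ U).length
      · obtain ⟨f, hf, h⟩ := h2 i hiV
        have hfj : f ∉ (Y j).2.2 := by
          intro hfj
          have h4 := h3 j hlen f hfj (fun _ => 1)
          rw [h] at h4
          norm_num at h4
        have hkill : ∀ c, f (comb (Y j).2.1 c) = 0 := by
          rcases hf with hf | ⟨i, hf⟩
          · exact comb_kill f _ ((hY1 j).2.1.1 f hf)
          · have hij : i ≠ j := by rintro rfl; exact hfj hf
            exact comb_kill f _ ((hOrth i j hij).1 f hf)
        exact ⟨f, hf, fun c => by rw [comb_append, map_add, h, hkill, add_zero]⟩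
      · rw [List.length_append] at hi
        obtain ⟨f, hf, h⟩ := hw7.2 (i - (e ++ U).length) (by omega)
        refine ⟨f, Or.inr ⟨j, hf⟩, fun c => ?_⟩
        rw [comb_append, map_add, h3 j hlen f hf, h, zero_add]
        congr 1
        omega
    · intro j' hj' f hf c
      have hij : j' ≠ j := by rintro rfl; exact lt_irrefl _ hj'
      rw [comb_append, map_add, h3 j' (hlen.trans hj') f hf,
        comb_kill f _ ((hOrth j' j hij).1 f hf), add_zero]
  have main : ∀ γ : Ordinal.{0}, ∀ l V, Path l V → ω * γ ≤ r l → ω * γ ≤ r (φ V) := by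
    intro γ
    induction γ using WellFoundedLT.induction with
    | ind γ ih =>
    intro l V hP hl
    apply le_of_forall_lt
    intro o ho
    obtain ⟨n, hn⟩ := lt_omega0.1 (mod_lt o hω)
    have hγ' : o / ω < γ := (div_lt hω).2 ho
    have ho' : ω * (o / ω) + (n : Ordinal) = o := by rw [← hn]; exact div_add_mod o ω
    have hsucc : ∀ N : ℕ, ω * (o / ω) + (N : Ordinal) ≤ r l := by
      intro N
      refine le_trans ?_ hl
      refine le_trans ?_ (mul_le_mul_right (Order.succ_le_of_lt hγ') ω)
      rw [mul_succ]
      exact add_le_add_right (natCast_lt_omega0 N).le _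
    obtain ⟨q, hq⟩ : ω * (o / ω) ∈ Set.range r :=
      IsWellFounded.mem_range_rank_of_le (a := l) (by simpa using hsucc 0)
    have hq' : r q / ω = o / ω := by rw [hq, mul_div_cancel _ hω]
    obtain ⟨j, hj⟩ := hσ (l, n + 1, q)
    have hG : Good (σ j) (Y j) := by
      refine (hY1 j).2.2 ?_ (by rw [hj]; simp)
      rw [hj]
      intro N
      simp only [hq']
      exact rank_desc C d _ N l hP.1 (hsucc N)
    have hP' := path_step l V j hP (by rw [hj]) hG
    obtain ⟨w, hw1, hw2, hw3, hw4, hw5, hw6, hw7⟩ := hG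
    rw [hj] at hw4 hw6
    simp only [hq'] at hw4 hw6
    have h1 := ih _ hγ' _ _ hP' hw4
    obtain ⟨w', hw', hw''⟩ := hφapp V (Y j).2.1
    have h2 := path_est _ _ hP'
    rw [hw'] at h1 h2
    have h3 := rank_ext C d (φ V) w' h2
    rw [hw'', hw6, Nat.cast_add, Nat.cast_one, ← add_assoc] at h3
    have h4 := (Order.add_one_le_iff.1 h3)
    refine lt_of_le_of_lt ?_ h4
    rw [← ho']
    exact add_le_add_left h1 _
  have hfin := main (r [] / ω) [] e path_base (mul_div_le _ _)
  have h2 := path_est _ _ path_base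
  have h3 := rank_ext C d [] (φ e) (by simpa using h2)
  have hlen : (φ e).length = k + 1 := by simp only [φ]; rw [approx_length, List.length_map, he1]
  rw [hlen, Nat.cast_add, Nat.cast_one, ← add_assoc, List.nil_append] at h3
  have h4 := Order.add_one_le_iff.1 h3
  have h5 : r [] ≤ r (φ e) + (k : Ordinal) := by
    conv_lhs => rw [← div_add_mod (r []) ω, hk]
    exact add_le_add_left hfin _
  exact absurd h4 (not_lt.2 h5)

end tree

end JO

/-- **Johnson–Odell.** A separable infinite dimensional elastic Banach space contains
an isomorphic copy of `c₀` (here realized as the space `C₀(ℕ, ℝ)` of real sequences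
vanishing at infinity, with the supremum norm). -/
theorem elastic_contains_c0
    (X : Type) [NormedAddCommGroup X] [NormedSpace ℝ X] [CompleteSpace X]
    [TopologicalSpace.SeparableSpace X]
    (hinf : ¬ FiniteDimensional ℝ X)
    (K : ℝ) (hK : IsKElastic X K) :
    EmbedsInto (ZeroAtInftyContinuousMap ℕ ℝ) X := by
  by_cases h : WellFounded (JO.Ext (K + 1) (TopologicalSpace.denseSeq X))
  · exfalso
    have : IsWellFounded (List ℕ) (JO.Ext (K + 1) (TopologicalSpace.denseSeq X)) := ⟨h⟩
    exact JO.main_wf hinf K hK (TopologicalSpace.denseSeq X) (TopologicalSpace.denseRange_denseSeq X)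
  · exact JO.c0_of_not_wf _ _ h
end
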